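/- There exist ε > 0, T₀ > 0, C₁ > 0 and β > 0 such that the following holds for every Borel probability measure μ on ℂ whose support equals Λ and which satisfies ∫ ℒ_δ f dμ = ∫ f dμ for every continuous function f on the closure of I: for every unitary representation (ρ, V) of Γ on a complex Hilbert space V, every s = σ + it with |σ − δ| ≤ ε and |t| ≥ T₀, and every F ∈ C¹(I, V), setting N = ⌊C₁ log|t|⌋, one has ∫_Λ ‖(ℒ_{s,ρ}^N F)(x)‖²_V dμ(x) ≤ ‖F‖²_{(t),V} / |t|^β. -/

import Mathlib

open MeasureTheory

/-- `SL(2,ℝ)`. -/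
abbrev SL2 : Type := Matrix.SpecialLinearGroup (Fin 2) ℝ

/-- The Möbius transformation of `g ∈ SL(2,ℝ)` acting on `ℂ` (junk at the pole). -/
noncomputable def mobiusC (g : SL2) (z : ℂ) : ℂ :=
  ((g.1 0 0 : ℂ) * z + (g.1 0 1 : ℂ)) / ((g.1 1 0 : ℂ) * z + (g.1 1 1 : ℂ))

/-- The Möbius transformation of `g ∈ SL(2,ℝ)` acting on `ℝ` (junk at the pole). -/
noncomputable def mobiusR (g : SL2) (x : ℝ) : ℝ :=
  (g.1 0 0 * x + g.1 0 1) / (g.1 1 0 * x + g.1 1 1)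

/-- The derivative `γ'(z) = (uz+v)⁻²` of the Möbius transformation of `g`. -/
noncomputable def mobiusDerivC (g : SL2) (z : ℂ) : ℂ :=
  ((g.1 1 0 : ℂ) * z + (g.1 1 1 : ℂ))⁻¹ ^ 2

/-- The derivative `γ'(x) = (ux+v)⁻²` of the Möbius transformation of `g`, real version. -/
noncomputable def mobiusDerivR (g : SL2) (x : ℝ) : ℝ :=
  (g.1 1 0 * x + g.1 1 1)⁻¹ ^ 2

/-- The Möbius transformation of `g ∈ SL(2,ℝ)` acting on the Riemann sphere `ℂ ∪ {∞}`. -/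
noncomputable def mobiusS (g : SL2) (z : OnePoint ℂ) : OnePoint ℂ :=
  Option.elim z
    (if (g.1 1 0 : ℝ) = 0 then OnePoint.infty else (((g.1 0 0 / g.1 1 0 : ℝ) : ℂ) : OnePoint ℂ))
    (fun w => if ((g.1 1 0 : ℂ) * w + (g.1 1 1 : ℂ)) = 0 then OnePoint.infty
      else ((mobiusC g w : ℂ) : OnePoint ℂ))

/-- The involution `a ↦ ā = a + r mod 2r` on the alphabet `𝒜 = Fin (2r)`. -/
def wordBar {r : ℕ} (a : Fin (2 * r)) : Fin (2 * r) :=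
  ⟨(a.1 + r) % (2 * r), Nat.mod_lt _ (Nat.lt_of_le_of_lt (Nat.zero_le _) a.isLt)⟩

/-- A word: a finite sequence of letters with no adjacent letter equal to the bar of the
previous one. -/
def IsWord {r : ℕ} (w : List (Fin (2 * r))) : Prop :=
  w.Chain' (fun x y => x ≠ wordBar y)

/-- The mirror word `𝐚̄ = (ā_n, …, ā_1)`. -/
def mirror {r : ℕ} (w : List (Fin (2 * r))) : List (Fin (2 * r)) :=
  (w.map wordBar).reverse

/-- `𝐚 → 𝐛` : either word is empty, or the last letter of `𝐚` is not the bar of the first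
letter of `𝐛`. -/
def arrow {r : ℕ} (w v : List (Fin (2 * r))) : Prop :=
  ∀ x ∈ w.getLast?, ∀ y ∈ v.head?, x ≠ wordBar y

/-- `𝐚 ⇝ 𝐛` : both words are nonempty and the last letter of `𝐚` equals the first letter
of `𝐛`. -/
def wiggly {r : ℕ} (w v : List (Fin (2 * r))) : Prop :=
  w ≠ [] ∧ v ≠ [] ∧ w.getLast? = v.head?

/-- Schottky data: pairwise disjoint closed discs centered on the real line, paired by
elements of `SL(2,ℝ)`. -/
structure Schottky where
  r : ℕ
  two_le_r : 2 ≤ r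
  center : Fin (2 * r) → ℝ
  radius : Fin (2 * r) → ℝ
  radius_pos : ∀ a, 0 < radius a
  g : Fin (2 * r) → SL2
  disjoint : ∀ a b : Fin (2 * r), a ≠ b →
    Disjoint (closure (Metric.ball ((center a : ℂ)) (radius a)))
             (closure (Metric.ball ((center b : ℂ)) (radius b)))
  g_bar : ∀ a : Fin (2 * r), g (wordBar a) = (g a)⁻¹
  maps : ∀ a : Fin (2 * r),
    mobiusS (g a) '' (((fun w : ℂ => (w : OnePoint ℂ)) ''
        Metric.ball ((center (wordBar a) : ℂ)) (radius (wordBar a)))ᶜ)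
      = (fun w : ℂ => (w : OnePoint ℂ)) '' closure (Metric.ball ((center a : ℂ)) (radius a))

namespace Schottky

variable (S : Schottky)

/-- The open disc `D_a`. -/
def D (a : Fin (2 * S.r)) : Set ℂ := Metric.ball ((S.center a : ℂ)) (S.radius a)

/-- The union `𝐃` of the open discs. -/
def Dall : Set ℂ := ⋃ a, S.D a

/-- The open interval `I_a = D_a ∩ ℝ`. -/
def Ireal (a : Fin (2 * S.r)) : Set ℝ := {x : ℝ | (x : ℂ) ∈ S.D a}

/-- The union `I` of the intervals `I_a`. -/
def Iall : Set ℝ := ⋃ a, S.Ireal a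

/-- The group element `γ_𝐚 = γ_{a₁} ⋯ γ_{a_n}` associated to a word. -/
noncomputable def wprod (w : List (Fin (2 * S.r))) : SL2 := (w.map S.g).prod

/-- The Schottky group `Γ`, generated by the `γ_a`. -/
def SGroup : Subgroup SL2 := Subgroup.closure (Set.range S.g)

theorem wprod_mem (w : List (Fin (2 * S.r))) : S.wprod w ∈ S.SGroup := by
  apply Subgroup.list_prod_mem
  intro x hx
  obtain ⟨a, -, rfl⟩ := List.mem_map.mp hx
  exact Subgroup.subset_closure ⟨a, rfl⟩

/-- `γ_𝐚` as an element of the Schottky group `Γ`. -/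
noncomputable def wprodG (w : List (Fin (2 * S.r))) : S.SGroup := ⟨S.wprod w, S.wprod_mem w⟩

/-- The generator `γ_a` as an element of `Γ`. -/
noncomputable def genG (a : Fin (2 * S.r)) : S.SGroup :=
  ⟨S.g a, Subgroup.subset_closure ⟨a, rfl⟩⟩

/-- The interval `I_𝐚 = γ_{𝐚'}(I_{a_n})` of a nonempty word. -/
noncomputable def Iset (w : List (Fin (2 * S.r))) : Set ℝ :=
  if h : w = [] then ∅ else mobiusR (S.wprod w.dropLast) '' S.Ireal (w.getLast h)

/-- `Υ_𝐚 = |I_𝐚|`, the length of the interval `I_𝐚`; `Υ_∅ = 1`. -/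
noncomputable def ups (w : List (Fin (2 * S.r))) : ℝ :=
  if w = [] then 1 else (volume (S.Iset w)).toReal

/-- The Bourgain–Dyatlov partition `Z(τ)`. -/
def Zset (τ : ℝ) : Set (List (Fin (2 * S.r))) :=
  {w | IsWord w ∧ w ≠ [] ∧ S.ups w ≤ τ ∧ τ < S.ups w.dropLast}

/-- The mirror set `Z̄(τ) = {𝐚 ∈ 𝒲 : 𝐚̄ ∈ Z(τ)}`. -/
def Zbar (τ : ℝ) : Set (List (Fin (2 * S.r))) :=
  {w | IsWord w ∧ mirror w ∈ S.Zset τ}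

open Classical in
/-- The Bowen–Series map on the Riemann sphere (junk value `∞` off `𝐃`). -/
noncomputable def TS (z : OnePoint ℂ) : OnePoint ℂ :=
  if h : ∃ a : Fin (2 * S.r), ∃ w : ℂ, z = (w : OnePoint ℂ) ∧ w ∈ S.D a
  then mobiusS (S.g h.choose)⁻¹ z
  else OnePoint.infty

/-- The limit set `Λ`: points of `𝐃` all of whose forward iterates under the Bowen–Series
map are defined (finite) and remain in `𝐃`. -/
def limitSet : Set ℂ :=
  {z : ℂ | ∀ n : ℕ, ∃ w : ℂ, (S.TS)^[n] (z : OnePoint ℂ) = (w : OnePoint ℂ) ∧ w ∈ S.Dall}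

/-- The limit set, viewed inside `ℝ`. -/
def limitSetR : Set ℝ := {x : ℝ | (x : ℂ) ∈ S.limitSet}

/-- `δ`, the Hausdorff dimension of the limit set. -/
noncomputable def delta : ℝ := (dimH S.limitSet).toReal

/-- `PowerPairs(τ)`: pairs `(𝐚,𝐛) ∈ Z̄(τ)²` such that `γ_{𝐚'}γ_{𝐛'}⁻¹` is a nontrivial
proper power in `Γ`. -/
def PowerPairs (τ : ℝ) : Set (List (Fin (2 * S.r)) × List (Fin (2 * S.r))) :=
  {p | p.1 ∈ S.Zbar τ ∧ p.2 ∈ S.Zbar τ ∧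
    S.wprod p.1.dropLast * (S.wprod p.2.dropLast)⁻¹ ≠ 1 ∧
    ∃ γ₀ ∈ S.SGroup, ∃ q : ℕ, 2 ≤ q ∧
      S.wprod p.1.dropLast * (S.wprod p.2.dropLast)⁻¹ = (γ₀ : SL2) ^ q}

end Schottky

namespace Schottky

open Classical in
/-- The scalar transfer operator `ℒ_σ` (trivial one-dimensional twist):
`(ℒ_σ f)(x) = Σ_{j → i} (γ'_j(x))^σ f(γ_j x)` for `x ∈ I_i` (junk `0` off `I`). -/
noncomputable def Lscalar (S : Schottky) (σ : ℝ) (f : ℝ → ℝ) (x : ℝ) : ℝ :=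
  if h : ∃ i : Fin (2 * S.r), x ∈ S.Ireal i then
    ∑ j ∈ Finset.univ.filter (fun j : Fin (2 * S.r) => h.choose ≠ wordBar j),
      (mobiusDerivR (S.g j) x) ^ σ * f (mobiusR (S.g j) x)
  else 0

open Classical in
/-- The `N`-th iterate of the twisted transfer operator `ℒ_{s,ρ}`, given by its explicit
formula `(ℒ_{s,ρ}^N F)(x) = Σ_{𝐚 ∈ 𝒲_N, 𝐚 → j} (γ'_𝐚(x))^s ρ(γ_𝐚⁻¹) F(γ_𝐚 x)` for
`x ∈ I_j` (junk `0` off `I`). -/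
noncomputable def LIterate (S : Schottky) {V : Type*} [NormedAddCommGroup V]
    [InnerProductSpace ℂ V] (s : ℂ) (ρ : S.SGroup →* (V ≃ₗᵢ[ℂ] V)) (N : ℕ)
    (F : ℝ → V) (x : ℝ) : V :=
  if h : ∃ i : Fin (2 * S.r), x ∈ S.Ireal i then
    ∑ᶠ w ∈ {w : List (Fin (2 * S.r)) | IsWord w ∧ w.length = N ∧ arrow w [h.choose]},
      (((mobiusDerivR (S.wprod w) x : ℝ) : ℂ) ^ s) •
        ((ρ (S.wprodG w)⁻¹) (F (mobiusR (S.wprod w) x)))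
  else 0

end Schottky

/-- The denominator `ux + v` of the Möbius transformation of `g`. -/
noncomputable def den (g : SL2) (x : ℝ) : ℝ := g.1 1 0 * x + g.1 1 1

lemma SL2.det_eq (g : SL2) : g.1 0 0 * g.1 1 1 - g.1 0 1 * g.1 1 0 = 1 := by
  have := g.2
  rwa [Matrix.det_fin_two] at this

lemma mobiusDerivR_eq (g : SL2) (x : ℝ) : mobiusDerivR g x = ((den g x)⁻¹) ^ 2 := rfl

lemma mobiusDerivR_pos {g : SL2} {x : ℝ} (h : den g x ≠ 0) : 0 < mobiusDerivR g x := by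
  rw [mobiusDerivR_eq]; positivity

lemma mobiusDerivR_nonneg (g : SL2) (x : ℝ) : 0 ≤ mobiusDerivR g x := by
  rw [mobiusDerivR_eq]; positivity

lemma mobiusR_sub {g : SL2} {x y : ℝ} (hx : den g x ≠ 0) (hy : den g y ≠ 0) :
    mobiusR g x - mobiusR g y = (x - y) / (den g x * den g y) := by
  have hd := g.det_eq
  unfold mobiusR
  change _ / den g x - _ / den g y = _
  rw [div_sub_div _ _ hx hy]
  congr 1
  unfold den
  linear_combination (x - y) * hd

lemma mobiusR_sub_sq {g : SL2} {x y : ℝ} (hx : den g x ≠ 0) (hy : den g y ≠ 0) :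
    (mobiusR g x - mobiusR g y) ^ 2 = mobiusDerivR g x * mobiusDerivR g y * (x - y) ^ 2 := by
  rw [mobiusR_sub hx hy, mobiusDerivR_eq, mobiusDerivR_eq]
  field_simp

lemma den_mul {g h : SL2} {x : ℝ} (hx : den h x ≠ 0) :
    den (g * h) x = den g (mobiusR h x) * den h x := by
  have e : den g (mobiusR h x) * den h x
      = g.1 1 0 * (h.1 0 0 * x + h.1 0 1) + g.1 1 1 * den h x := by
    have : mobiusR h x = (h.1 0 0 * x + h.1 0 1) / den h x := rfl
    unfold den at this ⊢
    unfold den at hx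
    rw [this, add_mul, mul_assoc, div_mul_cancel₀ _ hx]
  rw [e]
  simp only [den, Matrix.SpecialLinearGroup.coe_mul, Matrix.mul_apply, Fin.sum_univ_two]
  ring

lemma mobiusR_mul {g h : SL2} {x : ℝ} (hx : den h x ≠ 0) :
    mobiusR (g * h) x = mobiusR g (mobiusR h x) := by
  have e1 : mobiusR (g * h) x = ((g * h).1 0 0 * x + (g * h).1 0 1) / den (g * h) x := rfl
  have e2 : mobiusR g (mobiusR h x)
      = (g.1 0 0 * mobiusR h x + g.1 0 1) / den g (mobiusR h x) := rfl
  rw [e1, e2, den_mul hx, ← mul_div_mul_right (g.1 0 0 * mobiusR h x + g.1 0 1) _ hx]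
  congr 1
  have k : mobiusR h x * den h x = h.1 0 0 * x + h.1 0 1 := div_mul_cancel₀ _ hx
  have kd : den h x = h.1 1 0 * x + h.1 1 1 := rfl
  simp only [Matrix.SpecialLinearGroup.coe_mul, Matrix.mul_apply, Fin.sum_univ_two]
  linear_combination (-g.1 0 0) * k - g.1 0 1 * kd

lemma mobiusDerivR_mul {g h : SL2} {x : ℝ} (hx : den h x ≠ 0) :
    mobiusDerivR (g * h) x = mobiusDerivR g (mobiusR h x) * mobiusDerivR h x := by
  simp only [mobiusDerivR_eq, den_mul hx]
  rw [mul_inv, mul_pow]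

@[simp] lemma den_one (x : ℝ) : den 1 x = 1 := by simp [den]
@[simp] lemma mobiusR_one (x : ℝ) : mobiusR 1 x = x := by simp [mobiusR]
@[simp] lemma mobiusDerivR_one (x : ℝ) : mobiusDerivR 1 x = 1 := by simp [mobiusDerivR]

lemma measurable_mobiusR (g : SL2) : Measurable (mobiusR g) := by
  unfold mobiusR; fun_prop

lemma measurable_mobiusDerivR (g : SL2) : Measurable (mobiusDerivR g) := by
  unfold mobiusDerivR; fun_prop

lemma continuousAt_mobiusR {g : SL2} {x : ℝ} (h : den g x ≠ 0) : ContinuousAt (mobiusR g) x := by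
  unfold mobiusR
  exact ContinuousAt.div (by fun_prop) (by fun_prop) h

lemma continuousAt_mobiusDerivR {g : SL2} {x : ℝ} (h : den g x ≠ 0) :
    ContinuousAt (mobiusDerivR g) x := by
  unfold mobiusDerivR
  exact (ContinuousAt.inv₀ (f := fun x => g.1 1 0 * x + g.1 1 1) (by fun_prop) h).pow 2

lemma wordBar_wordBar {r : ℕ} (a : Fin (2 * r)) : wordBar (wordBar a) = a := by
  have ha := a.2
  apply Fin.ext
  simp only [wordBar]
  rcases lt_or_ge (a.1 + r) (2 * r) with h | h
  · rw [Nat.mod_eq_of_lt h, show a.1 + r + r = a.1 + 2 * r by ring, Nat.add_mod_right,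
      Nat.mod_eq_of_lt ha]
  · rw [show a.1 + r = (a.1 - r) + 2 * r by omega, Nat.add_mod_right,
      Nat.mod_eq_of_lt (show a.1 - r < 2 * r by omega), show a.1 - r + r = a.1 by omega,
      Nat.mod_eq_of_lt ha]

lemma wordBar_ne {r : ℕ} (a : Fin (2 * r)) : wordBar a ≠ a := by
  have ha := a.2
  intro h
  have := congrArg Fin.val h
  simp only [wordBar] at this
  rcases lt_or_ge (a.1 + r) (2 * r) with h | h
  · rw [Nat.mod_eq_of_lt h] at this; omega
  · rw [show a.1 + r = (a.1 - r) + 2 * r by omega, Nat.add_mod_right,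
      Nat.mod_eq_of_lt (show a.1 - r < 2 * r by omega)] at this; omega

lemma ne_wordBar_comm {r : ℕ} {a b : Fin (2 * r)} : a ≠ wordBar b ↔ b ≠ wordBar a := by
  constructor <;> (rintro h rfl; exact h (wordBar_wordBar _).symm)

namespace Schottky

variable (S : Schottky)

lemma mem_Ireal {a : Fin (2 * S.r)} {x : ℝ} : x ∈ S.Ireal a ↔ |x - S.center a| < S.radius a := by
  simp only [Ireal, D, Set.mem_ofPred_eq, Metric.mem_ball]
  rw [Complex.dist_eq, ← Complex.ofReal_sub, Complex.norm_real, Real.norm_eq_abs]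

lemma Ireal_eq_ball (a : Fin (2 * S.r)) : S.Ireal a = Metric.ball (S.center a) (S.radius a) := by
  ext x; rw [mem_Ireal, Metric.mem_ball, Real.dist_eq]

lemma isOpen_Ireal (a : Fin (2 * S.r)) : IsOpen (S.Ireal a) := by
  rw [Ireal_eq_ball]; exact Metric.isOpen_ball

lemma isOpen_Iall : IsOpen S.Iall := isOpen_iUnion S.isOpen_Ireal

lemma measurableSet_Ireal (a : Fin (2 * S.r)) : MeasurableSet (S.Ireal a) :=
  (S.isOpen_Ireal a).measurableSet

lemma measurableSet_Iall : MeasurableSet S.Iall := S.isOpen_Iall.measurableSet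

lemma mem_Iall {x : ℝ} : x ∈ S.Iall ↔ ∃ i, x ∈ S.Ireal i := by simp [Iall]

/-- Closed intervals of distinct letters are a definite distance apart. -/
lemma exists_gap : ∃ d : ℝ, 0 < d ∧ d ≤ 1 ∧ ∀ a b : Fin (2 * S.r), a ≠ b → ∀ x y : ℝ,
    |x - S.center a| ≤ S.radius a → |y - S.center b| ≤ S.radius b → d ≤ |x - y| := by
  classical
  have key : ∀ a b : Fin (2 * S.r), a ≠ b →
      0 < |S.center a - S.center b| - S.radius a - S.radius b := by
    intro a b hab
    by_contra hneg
    have hd := S.disjoint a b hab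
    rw [closure_ball _ (S.radius_pos a).ne', closure_ball _ (S.radius_pos b).ne'] at hd
    have ha := S.radius_pos a
    have hb := S.radius_pos b
    have hs : 0 < S.radius a + S.radius b := by linarith
    set z : ℝ := (S.radius b * S.center a + S.radius a * S.center b) /
      (S.radius a + S.radius b) with hz
    have h1 : z - S.center a = S.radius a * (S.center b - S.center a) /
      (S.radius a + S.radius b) := by rw [hz]; field_simp; ring
    have h2 : z - S.center b = S.radius b * (S.center a - S.center b) /
      (S.radius a + S.radius b) := by rw [hz]; field_simp; ring
    have hle : |S.center a - S.center b| ≤ S.radius a + S.radius b := by linarith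
    refine Set.disjoint_left.1 hd (show (z : ℂ) ∈ _ from ?_) ?_
    · rw [Metric.mem_closedBall, Complex.dist_eq, ← Complex.ofReal_sub, Complex.norm_real,
        Real.norm_eq_abs, h1, abs_div, abs_mul, abs_of_pos ha, abs_of_pos hs, div_le_iff₀ hs,
        abs_sub_comm]
      gcongr
    · rw [Metric.mem_closedBall, Complex.dist_eq, ← Complex.ofReal_sub, Complex.norm_real,
        Real.norm_eq_abs, h2, abs_div, abs_mul, abs_of_pos hb, abs_of_pos hs, div_le_iff₀ hs]
      gcongr
  have hfin : ∃ d : ℝ, 0 < d ∧ ∀ p : Fin (2 * S.r) × Fin (2 * S.r), p.1 ≠ p.2 →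
      d ≤ |S.center p.1 - S.center p.2| - S.radius p.1 - S.radius p.2 := by
    let f : Fin (2 * S.r) × Fin (2 * S.r) → ℝ := fun p =>
      if p.1 ≠ p.2 then |S.center p.1 - S.center p.2| - S.radius p.1 - S.radius p.2 else 1
    have : Nonempty (Fin (2 * S.r) × Fin (2 * S.r)) := by
      have := S.two_le_r
      exact ⟨(⟨0, by omega⟩, ⟨0, by omega⟩)⟩
    obtain ⟨p0, hp0⟩ := Finite.exists_min f
    refine ⟨f p0, ?_, ?_⟩
    · by_cases h : p0.1 ≠ p0.2
      · simp only [f, if_pos h]; exact key _ _ h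
      · simp only [f, if_neg h]; norm_num
    · intro p hp
      have := hp0 p
      simpa only [f, if_pos hp] using this
  obtain ⟨d, hd, hfin⟩ := hfin
  refine ⟨min d 1, by positivity, min_le_right _ _, ?_⟩
  intro a b hab x y hx hy
  refine (min_le_left _ _).trans ?_
  have := hfin (a, b) hab
  simp only at this
  have h3 : |S.center a - S.center b| ≤ |x - S.center a| + |x - y| + |y - S.center b| := by
    have : S.center a - S.center b = -(x - S.center a) + (x - y) + (y - S.center b) := by ring
    rw [this]
    refine (abs_add_le _ _).trans ?_
    gcongr
    refine (abs_add_le _ _).trans ?_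
    rw [abs_neg]
  linarith

lemma disjoint_closed {a b : Fin (2 * S.r)} {x : ℝ} (ha : |x - S.center a| ≤ S.radius a)
    (hb : |x - S.center b| ≤ S.radius b) : a = b := by
  obtain ⟨d, hd, -, h⟩ := S.exists_gap
  by_contra hab
  have := h a b hab x x ha hb
  simp at this
  linarith

lemma Ireal_unique {a b : Fin (2 * S.r)} {x : ℝ} (ha : x ∈ S.Ireal a) (hb : x ∈ S.Ireal b) :
    a = b :=
  S.disjoint_closed (S.mem_Ireal.1 ha).le (S.mem_Ireal.1 hb).le

lemma mobiusC_ofReal (g : SL2) (x : ℝ) : mobiusC g (x : ℂ) = (mobiusR g x : ℂ) := by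
  simp [mobiusC, mobiusR]

lemma g_maps {a : Fin (2 * S.r)} {x : ℝ}
    (hx : S.radius (wordBar a) ≤ |x - S.center (wordBar a)|) :
    den (S.g a) x ≠ 0 ∧ |mobiusR (S.g a) x - S.center a| ≤ S.radius a := by
  have hmem : mobiusS (S.g a) ((x : ℂ) : OnePoint ℂ) ∈
      (fun w : ℂ => (w : OnePoint ℂ)) '' closure (Metric.ball ((S.center a : ℂ)) (S.radius a)) := by
    rw [← S.maps a]
    refine ⟨_, ?_, rfl⟩
    rintro ⟨w, hw, hwx⟩
    have : w = (x : ℂ) := OnePoint.coe_injective hwx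
    subst this
    have h2 : x ∈ S.Ireal (wordBar a) := hw
    rw [mem_Ireal] at h2
    linarith
  obtain ⟨w, hw, hwx⟩ := hmem
  have e : mobiusS (S.g a) ((x : ℂ) : OnePoint ℂ) =
    if (((S.g a).1 1 0 : ℂ) * (x : ℂ) + ((S.g a).1 1 1 : ℂ)) = 0 then OnePoint.infty
      else ((mobiusC (S.g a) x : ℂ) : OnePoint ℂ) := rfl
  simp only [e] at hwx
  have hcast : (((S.g a).1 1 0 : ℂ) * (x : ℂ) + ((S.g a).1 1 1 : ℂ)) = ((den (S.g a) x : ℝ) : ℂ) := by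
    simp [den]
  rw [hcast] at hwx
  split_ifs at hwx with h0
  · exact absurd hwx (OnePoint.coe_ne_infty _)
  · refine ⟨fun h => h0 (by simp [h]), ?_⟩
    have : w = mobiusC (S.g a) x := OnePoint.coe_injective hwx
    rw [this, mobiusC_ofReal, closure_ball _ (S.radius_pos a).ne', Metric.mem_closedBall,
      Complex.dist_eq, ← Complex.ofReal_sub, Complex.norm_real, Real.norm_eq_abs] at hw
    exact hw

lemma g_lower_ne (a : Fin (2 * S.r)) : (S.g a).1 1 0 ≠ 0 := by
  intro h0
  have hmem : mobiusS (S.g a) OnePoint.infty ∈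
      (fun w : ℂ => (w : OnePoint ℂ)) '' closure (Metric.ball ((S.center a : ℂ)) (S.radius a)) := by
    rw [← S.maps a]
    refine ⟨_, ?_, rfl⟩
    rintro ⟨w, hw, hwx⟩
    exact OnePoint.coe_ne_infty _ hwx
  obtain ⟨w, hw, hwx⟩ := hmem
  have e : mobiusS (S.g a) OnePoint.infty =
    if ((S.g a).1 1 0 : ℝ) = 0 then OnePoint.infty
      else ((((S.g a).1 0 0 / (S.g a).1 1 0 : ℝ) : ℂ) : OnePoint ℂ) := rfl
  rw [e, if_pos h0] at hwx
  exact OnePoint.coe_ne_infty _ hwx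

lemma g_pole (a : Fin (2 * S.r)) : ∃ p : ℝ,
    |p - S.center (wordBar a)| ≤ S.radius (wordBar a) ∧
    ∀ x, den (S.g a) x = (S.g a).1 1 0 * (x - p) := by
  have hu := S.g_lower_ne a
  refine ⟨-(S.g a).1 1 1 / (S.g a).1 1 0, ?_, ?_⟩
  · by_contra h
    push Not at h
    refine (S.g_maps h.le).1 ?_
    unfold den; field_simp; ring
  · intro x; unfold den; field_simp; ring

lemma g_bar_g {a : Fin (2 * S.r)} {x : ℝ} (hx : den (S.g a) x ≠ 0) :
    mobiusR (S.g (wordBar a)) (mobiusR (S.g a) x) = x := by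
  rw [← mobiusR_mul hx, S.g_bar, inv_mul_cancel, mobiusR_one]

lemma g_g_bar {a : Fin (2 * S.r)} {x : ℝ} (hx : den (S.g (wordBar a)) x ≠ 0) :
    mobiusR (S.g a) (mobiusR (S.g (wordBar a)) x) = x := by
  rw [← mobiusR_mul hx, S.g_bar, mul_inv_cancel, mobiusR_one]

lemma g_maps_open {a : Fin (2 * S.r)} {x : ℝ}
    (hx : S.radius (wordBar a) < |x - S.center (wordBar a)|) :
    mobiusR (S.g a) x ∈ S.Ireal a := by
  rw [mem_Ireal]
  by_contra h
  push Not at h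
  have h1 := S.g_maps hx.le
  have h2 := (S.g_maps (a := wordBar a) (x := mobiusR (S.g a) x)
    (by rwa [wordBar_wordBar])).2
  rw [S.g_bar_g h1.1] at h2
  linarith

lemma far_of_closed {i b : Fin (2 * S.r)} (hib : i ≠ b) {x : ℝ}
    (hx : |x - S.center i| ≤ S.radius i) : S.radius b < |x - S.center b| := by
  by_contra h
  push Not at h
  exact hib (S.disjoint_closed hx h)

lemma far_of_mem {i b : Fin (2 * S.r)} (hib : i ≠ b) {x : ℝ} (hx : x ∈ S.Ireal i) :
    S.radius b < |x - S.center b| :=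
  S.far_of_closed hib (S.mem_Ireal.1 hx).le

lemma g_mem {i j : Fin (2 * S.r)} (hij : i ≠ wordBar j) {x : ℝ} (hx : x ∈ S.Ireal i) :
    mobiusR (S.g j) x ∈ S.Ireal j :=
  S.g_maps_open (S.far_of_mem hij hx)

lemma g_den_ne {i j : Fin (2 * S.r)} (hij : i ≠ wordBar j) {x : ℝ} (hx : x ∈ S.Ireal i) :
    den (S.g j) x ≠ 0 :=
  (S.g_maps (S.far_of_mem hij hx).le).1

end Schottky

namespace Schottky

variable (S : Schottky)

/-- The words of length `n` that may precede the letter `i`. -/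
noncomputable def Words : ℕ → Fin (2 * S.r) → Finset (List (Fin (2 * S.r)))
  | 0, _ => {[]}
  | n + 1, i => (Finset.univ.filter (fun j => i ≠ wordBar j)).biUnion
      (fun j => (Words n j).image (fun b => b ++ [j]))

/-- The letters that may precede the letter `i`. -/
def Pred (i : Fin (2 * S.r)) : Finset (Fin (2 * S.r)) :=
  Finset.univ.filter (fun j => i ≠ wordBar j)

variable {S}

lemma mem_Pred {i j : Fin (2 * S.r)} : j ∈ S.Pred i ↔ i ≠ wordBar j := by simp [Pred]

lemma mem_words_succ {n : ℕ} {i : Fin (2 * S.r)} {w : List (Fin (2 * S.r))} :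
    w ∈ S.Words (n + 1) i ↔ ∃ j, i ≠ wordBar j ∧ ∃ b ∈ S.Words n j, w = b ++ [j] := by
  simp only [Words, Finset.mem_biUnion, Finset.mem_filter, Finset.mem_univ, true_and,
    Finset.mem_image]
  constructor
  · rintro ⟨j, hj, b, hb, rfl⟩; exact ⟨j, hj, b, hb, rfl⟩
  · rintro ⟨j, hj, b, hb, rfl⟩; exact ⟨j, hj, b, hb, rfl⟩

lemma sum_words_succ {M : Type*} [AddCommMonoid M] (n : ℕ) (i : Fin (2 * S.r))
    (f : List (Fin (2 * S.r)) → M) :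
    ∑ w ∈ S.Words (n + 1) i, f w = ∑ j ∈ S.Pred i, ∑ b ∈ S.Words n j, f (b ++ [j]) := by
  rw [Words, Finset.sum_biUnion]
  · refine Finset.sum_congr rfl fun j _ => ?_
    rw [Finset.sum_image]
    intro a _ b _ h
    simpa using h
  · intro j _ k _ hjk
    rw [Function.onFun, Finset.disjoint_left]
    intro w hw hw'
    simp only [Finset.mem_image] at hw hw'
    obtain ⟨b, -, rfl⟩ := hw
    obtain ⟨c, -, h⟩ := hw'
    have := congrArg List.getLast? h
    simp at this
    exact hjk this.symm

lemma mem_words_zero {i : Fin (2 * S.r)} {w : List (Fin (2 * S.r))} :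
    w ∈ S.Words 0 i ↔ w = [] := by simp [Words]

lemma mem_words_iff {n : ℕ} {i : Fin (2 * S.r)} {w : List (Fin (2 * S.r))} :
    w ∈ S.Words n i ↔ IsWord w ∧ w.length = n ∧ arrow w [i] := by
  induction n generalizing i w with
  | zero =>
    rw [mem_words_zero]
    constructor
    · rintro rfl; simp [IsWord, List.Chain', arrow]
    · rintro ⟨-, h, -⟩; exact List.length_eq_zero_iff.1 h
  | succ n ih =>
    rw [mem_words_succ]
    constructor
    · rintro ⟨j, hj, b, hb, rfl⟩
      rw [ih] at hb
      obtain ⟨h1, h2, h3⟩ := hb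
      refine ⟨?_, by simp [h2], ?_⟩
      · unfold IsWord List.Chain' at *
        rw [List.isChain_append]
        refine ⟨h1, by simp, ?_⟩
        intro x hx y hy
        simp at hy
        exact h3 x hx y (by simp [hy])
      · intro x hx y hy
        simp at hx hy
        subst hx hy
        rwa [ne_wordBar_comm]
    · rintro ⟨h1, h2, h3⟩
      have hne : w ≠ [] := by rintro rfl; simp at h2
      obtain ⟨b, j, rfl⟩ : ∃ b j, w = b ++ [j] :=
        ⟨w.dropLast, w.getLast hne, (List.dropLast_append_getLast hne).symm⟩
      refine ⟨j, ?_, b, ?_, rfl⟩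
      · rw [ne_wordBar_comm]
        exact h3 j (by simp) i (by simp)
      · rw [ih]
        unfold IsWord List.Chain' at *
        rw [List.isChain_append] at h1
        refine ⟨h1.1, by simpa using h2, ?_⟩
        intro x hx y hy
        simp at hy
        exact h1.2.2 x hx y (by simp [hy])

lemma wprod_append_singleton (b : List (Fin (2 * S.r))) (j : Fin (2 * S.r)) :
    S.wprod (b ++ [j]) = S.wprod b * S.g j := by simp [wprod]

@[simp] lemma wprod_nil : S.wprod [] = 1 := by simp [wprod]

lemma wprod_append (b c : List (Fin (2 * S.r))) :
    S.wprod (b ++ c) = S.wprod b * S.wprod c := by simp [wprod]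

lemma words_maps {n : ℕ} {i : Fin (2 * S.r)} {w : List (Fin (2 * S.r))} (hw : w ∈ S.Words n i) :
    ∃ k, ∀ x ∈ S.Ireal i, den (S.wprod w) x ≠ 0 ∧ mobiusR (S.wprod w) x ∈ S.Ireal k := by
  induction n generalizing i w with
  | zero =>
    rw [mem_words_zero] at hw
    subst hw
    exact ⟨i, fun x hx => by simpa using hx⟩
  | succ n ih =>
    obtain ⟨j, hj, b, hb, rfl⟩ := mem_words_succ.1 hw
    obtain ⟨k, hk⟩ := ih hb
    refine ⟨k, fun x hx => ?_⟩
    have h1 := S.g_den_ne hj hx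
    have h2 := hk _ (S.g_mem hj hx)
    rw [wprod_append_singleton, den_mul h1, mobiusR_mul h1]
    exact ⟨mul_ne_zero h2.1 h1, h2.2⟩

lemma words_den {n : ℕ} {i : Fin (2 * S.r)} {w : List (Fin (2 * S.r))} (hw : w ∈ S.Words n i)
    {x : ℝ} (hx : x ∈ S.Ireal i) : den (S.wprod w) x ≠ 0 :=
  let ⟨_, hk⟩ := words_maps hw; (hk x hx).1

lemma words_deriv_pos {n : ℕ} {i : Fin (2 * S.r)} {w : List (Fin (2 * S.r))}
    (hw : w ∈ S.Words n i) {x : ℝ} (hx : x ∈ S.Ireal i) : 0 < mobiusDerivR (S.wprod w) x :=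
  mobiusDerivR_pos (words_den hw hx)

lemma words_mem_Iall {n : ℕ} {i : Fin (2 * S.r)} {w : List (Fin (2 * S.r))}
    (hw : w ∈ S.Words n i) {x : ℝ} (hx : x ∈ S.Ireal i) : mobiusR (S.wprod w) x ∈ S.Iall :=
  let ⟨k, hk⟩ := words_maps hw; S.mem_Iall.2 ⟨k, (hk x hx).2⟩

lemma words_succ_apply {j i : Fin (2 * S.r)} (hj : i ≠ wordBar j) (b : List (Fin (2 * S.r)))
    {x : ℝ} (hx : x ∈ S.Ireal i) :
    mobiusR (S.wprod (b ++ [j])) x = mobiusR (S.wprod b) (mobiusR (S.g j) x) ∧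
    mobiusDerivR (S.wprod (b ++ [j])) x =
      mobiusDerivR (S.wprod b) (mobiusR (S.g j) x) * mobiusDerivR (S.g j) x := by
  rw [wprod_append_singleton]
  exact ⟨mobiusR_mul (S.g_den_ne hj hx), mobiusDerivR_mul (S.g_den_ne hj hx)⟩

/-- The pole of `γ_w` lies in the closed interval opposite to the last letter of `w`. -/
lemma words_pole {n : ℕ} {j : Fin (2 * S.r)} {b : List (Fin (2 * S.r))} (hb : b ∈ S.Words n j) :
    ∃ p u : ℝ, u ≠ 0 ∧ |p - S.center (wordBar j)| ≤ S.radius (wordBar j) ∧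
      ∀ x, S.radius (wordBar j) ≤ |x - S.center (wordBar j)| →
        den (S.wprod (b ++ [j])) x = u * (x - p) := by
  induction n generalizing j b with
  | zero =>
    rw [mem_words_zero] at hb
    subst hb
    obtain ⟨p, hp, h⟩ := S.g_pole j
    refine ⟨p, _, S.g_lower_ne j, hp, fun x _ => ?_⟩
    simpa [wprod] using h x
  | succ n ih =>
    obtain ⟨k, hk, b', hb', rfl⟩ := mem_words_succ.1 hb
    obtain ⟨p, u, hu, hp, h⟩ := ih hb'
    have hfar : S.radius j < |p - S.center j| := S.far_of_closed hk.symm hp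
    have hbar := S.g_maps (a := wordBar j) (x := p) (by rw [wordBar_wordBar]; exact hfar.le)
    set q := mobiusR (S.g (wordBar j)) p with hq
    have hpq : mobiusR (S.g j) q = p := S.g_g_bar hbar.1
    have hdq : den (S.g j) q ≠ 0 := by
      have h1 := den_mul (g := S.g j) (h := S.g (wordBar j)) (x := p) hbar.1
      rw [S.g_bar, mul_inv_cancel, den_one, ← S.g_bar] at h1
      intro h0
      rw [← hq, h0, zero_mul] at h1
      exact one_ne_zero h1
    refine ⟨q, u / den (S.g j) q, div_ne_zero hu hdq, hbar.2, fun x hx => ?_⟩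
    have hm := S.g_maps hx
    have hfar2 : S.radius (wordBar k) < |mobiusR (S.g j) x - S.center (wordBar k)| :=
      S.far_of_closed hk hm.2
    rw [wprod_append_singleton, den_mul hm.1, h _ hfar2.le, ← hpq, mobiusR_sub hm.1 hdq]
    have := hm.1
    field_simp

variable (S)

/-- A lower bound for the distance between closed intervals of distinct letters. -/
noncomputable def gap : ℝ := S.exists_gap.choose

lemma gap_pos : 0 < S.gap := S.exists_gap.choose_spec.1
lemma gap_le_one : S.gap ≤ 1 := S.exists_gap.choose_spec.2.1
lemma gap_le {a b : Fin (2 * S.r)} (hab : a ≠ b) {x y : ℝ}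
    (hx : |x - S.center a| ≤ S.radius a) (hy : |y - S.center b| ≤ S.radius b) :
    S.gap ≤ |x - y| := S.exists_gap.choose_spec.2.2 a b hab x y hx hy

/-- An upper bound for the diameter of the union of the closed intervals. -/
noncomputable def span : ℝ := 1 + 2 * ∑ a, (|S.center a| + S.radius a)

lemma one_le_span : 1 ≤ S.span := by
  unfold span
  have : 0 ≤ ∑ a, (|S.center a| + S.radius a) :=
    Finset.sum_nonneg fun a _ => add_nonneg (abs_nonneg _) (S.radius_pos a).le
  linarith

lemma le_span {a b : Fin (2 * S.r)} {x y : ℝ}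
    (hx : |x - S.center a| ≤ S.radius a) (hy : |y - S.center b| ≤ S.radius b) :
    |x - y| ≤ S.span := by
  have h (c : Fin (2 * S.r)) : |S.center c| + S.radius c ≤ ∑ a, (|S.center a| + S.radius a) :=
    Finset.single_le_sum (f := fun a => |S.center a| + S.radius a)
      (fun a _ => add_nonneg (abs_nonneg _) (S.radius_pos a).le) (Finset.mem_univ c)
  have ha := h a
  have hb := h b
  have h1 : |x - y| ≤ |x - S.center a| + |S.center a| + (|S.center b| + |y - S.center b|) := by
    have : x - y = (x - S.center a + S.center a) - (S.center b + (y - S.center b)) := by ring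
    rw [this]
    exact (abs_sub _ _).trans (add_le_add (abs_add_le _ _) (abs_add_le _ _))
  unfold span
  linarith

/-- A bound for the derivatives of the generators and their inverses. -/
lemma exists_derivBound : ∃ C : ℝ, 1 ≤ C ∧ ∀ i j : Fin (2 * S.r), i ≠ wordBar j →
    ∀ x ∈ S.Ireal i, C⁻¹ ≤ mobiusDerivR (S.g j) x ∧ mobiusDerivR (S.g j) x ≤ C := by
  have hj : ∀ j : Fin (2 * S.r), ∃ C : ℝ, 1 ≤ C ∧ ∀ i, i ≠ wordBar j →
    ∀ x ∈ S.Ireal i, C⁻¹ ≤ mobiusDerivR (S.g j) x ∧ mobiusDerivR (S.g j) x ≤ C := by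
    intro j
    obtain ⟨p, hp, h⟩ := S.g_pole j
    have hu := S.g_lower_ne j
    set u := (S.g j).1 1 0
    have hd := S.gap_pos
    have hs := S.one_le_span
    refine ⟨max 1 (max ((u ^ 2 * S.gap ^ 2)⁻¹) (u ^ 2 * S.span ^ 2)), le_max_left _ _, ?_⟩
    intro i hi x hx
    have h1 := S.gap_le hi (S.mem_Ireal.1 hx).le hp
    have h2 := S.le_span (S.mem_Ireal.1 hx).le hp
    have e : mobiusDerivR (S.g j) x = (u ^ 2 * |x - p| ^ 2)⁻¹ := by
      rw [mobiusDerivR_eq, h, sq_abs, inv_pow, mul_pow]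
    rw [e]
    constructor
    · apply inv_anti₀
      · have : 0 < |x - p| := by linarith
        positivity
      · refine le_trans ?_ ((le_max_right _ _).trans (le_max_right _ _))
        gcongr
    · refine le_trans ?_ ((le_max_left _ _).trans (le_max_right _ _))
      apply inv_anti₀ (by positivity)
      gcongr
  choose C hC1 hC2 using hj
  refine ⟨∑ j, C j, ?_, ?_⟩
  · have := S.two_le_r
    have h0 : C ⟨0, by omega⟩ ≤ ∑ j, C j :=
      Finset.single_le_sum (fun a _ => zero_le_one.trans (hC1 a)) (Finset.mem_univ _)
    exact (hC1 _).trans h0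
  · intro i j hij x hx
    have h0 : C j ≤ ∑ j, C j :=
      Finset.single_le_sum (fun a _ => zero_le_one.trans (hC1 a)) (Finset.mem_univ _)
    obtain ⟨h1, h2⟩ := hC2 j i hij x hx
    have := hC1 j
    exact ⟨(inv_anti₀ (by linarith) h0).trans h1, h2.trans h0⟩

/-- A bound for the derivatives of the generators and their inverses. -/
noncomputable def dC : ℝ := S.exists_derivBound.choose

lemma one_le_dC : 1 ≤ S.dC := S.exists_derivBound.choose_spec.1

variable {S}

lemma le_deriv {i j : Fin (2 * S.r)} (hij : i ≠ wordBar j) {x : ℝ} (hx : x ∈ S.Ireal i) :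
    S.dC⁻¹ ≤ mobiusDerivR (S.g j) x := (S.exists_derivBound.choose_spec.2 i j hij x hx).1

lemma deriv_le {i j : Fin (2 * S.r)} (hij : i ≠ wordBar j) {x : ℝ} (hx : x ∈ S.Ireal i) :
    mobiusDerivR (S.g j) x ≤ S.dC := (S.exists_derivBound.choose_spec.2 i j hij x hx).2

lemma abs_log_deriv_le {n : ℕ} {i : Fin (2 * S.r)} {w : List (Fin (2 * S.r))}
    (hw : w ∈ S.Words n i) {x : ℝ} (hx : x ∈ S.Ireal i) :
    |Real.log (mobiusDerivR (S.wprod w) x)| ≤ n * Real.log S.dC := by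
  induction n generalizing i w x with
  | zero =>
    rw [mem_words_zero] at hw
    subst hw
    simp
  | succ n ih =>
    obtain ⟨j, hj, b, hb, rfl⟩ := mem_words_succ.1 hw
    rw [(words_succ_apply hj b hx).2, Real.log_mul (words_deriv_pos hb (S.g_mem hj hx)).ne'
      (mobiusDerivR_pos (S.g_den_ne hj hx)).ne']
    refine (abs_add_le _ _).trans ?_
    have h1 := ih hb (S.g_mem hj hx)
    have h2 := le_deriv hj hx
    have h3 := deriv_le hj hx
    have hC := S.one_le_dC
    have h4 : |Real.log (mobiusDerivR (S.g j) x)| ≤ Real.log S.dC := by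
      rw [abs_le]
      constructor
      · rw [← Real.log_inv]; exact Real.log_le_log (by positivity) h2
      · exact Real.log_le_log (mobiusDerivR_pos (S.g_den_ne hj hx)) h3
    push_cast
    linarith

lemma dist_sq_words {n m : ℕ} {i k : Fin (2 * S.r)} {w : List (Fin (2 * S.r))}
    (hw : w ∈ S.Words n i) (hw' : w ∈ S.Words m k) {x y : ℝ} (hx : x ∈ S.Ireal i)
    (hy : y ∈ S.Ireal k) :
    (mobiusR (S.wprod w) x - mobiusR (S.wprod w) y) ^ 2
      = mobiusDerivR (S.wprod w) x * mobiusDerivR (S.wprod w) y * (x - y) ^ 2 :=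
  mobiusR_sub_sq (words_den hw hx) (words_den hw' hy)

/-- Bounded distortion. -/
lemma distortion {n : ℕ} {i k : Fin (2 * S.r)} {w : List (Fin (2 * S.r))}
    (hw : w ∈ S.Words n i) (hw' : w ∈ S.Words n k) {x y : ℝ} (hx : x ∈ S.Ireal i)
    (hy : y ∈ S.Ireal k) :
    mobiusDerivR (S.wprod w) x ≤ (S.span / S.gap) ^ 2 * mobiusDerivR (S.wprod w) y := by
  have hd := S.gap_pos
  have hs := S.one_le_span
  have hds : 1 ≤ S.span / S.gap := by
    rw [le_div_iff₀ hd]; linarith [S.gap_le_one]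
  cases n with
  | zero =>
    rw [mem_words_zero] at hw
    subst hw
    simp only [wprod_nil, mobiusDerivR_one, mul_one]
    exact one_le_pow₀ hds
  | succ n =>
    obtain ⟨j, hj, b, hb, rfl⟩ := mem_words_succ.1 hw
    obtain ⟨j', hj', b', hb', he⟩ := mem_words_succ.1 hw'
    have hjj : j = j' := by
      have := congrArg List.getLast? he
      simpa using this
    subst hjj
    obtain ⟨p, u, hu, hp, h⟩ := words_pole hb
    rw [mobiusDerivR_eq, mobiusDerivR_eq, h x (S.far_of_mem hj hx).le,
      h y (S.far_of_mem hj' hy).le, ← mul_pow]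
    rw [← sq_abs, ← sq_abs (_ * _)]
    have h1 := S.gap_le hj (S.mem_Ireal.1 hx).le hp
    have h2 := S.le_span (S.mem_Ireal.1 hy).le hp
    have h3 := S.gap_le hj' (S.mem_Ireal.1 hy).le hp
    apply pow_le_pow_left₀ (abs_nonneg _)
    rw [abs_mul, abs_inv, abs_inv, abs_mul, abs_mul, abs_of_pos (by positivity : 0 < S.span / S.gap)]
    have hx0 : 0 < |x - p| := by linarith
    have hy0 : 0 < |y - p| := by linarith
    have hu0 : 0 < |u| := abs_pos.2 hu
    rw [inv_le_iff_one_le_mul₀ (by positivity)]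
    have : S.span / S.gap * (|u| * |y - p|)⁻¹ * (|u| * |x - p|)
      = (S.span / |y - p|) * (|x - p| / S.gap) := by field_simp
    rw [this]
    have e1 : 1 ≤ S.span / |y - p| := by rw [le_div_iff₀ hy0]; linarith
    have e2 : 1 ≤ |x - p| / S.gap := by rw [le_div_iff₀ hd]; linarith
    nlinarith

lemma Ireal_convex (i : Fin (2 * S.r)) : Convex ℝ (S.Ireal i) := by
  rw [Ireal_eq_ball]; exact convex_ball _ _

lemma sub_pole_div_pos {i k : Fin (2 * S.r)} (hik : i ≠ k) {p : ℝ}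
    (hp : |p - S.center k| ≤ S.radius k) {x y : ℝ} (hx : x ∈ S.Ireal i) (hy : y ∈ S.Ireal i) :
    0 < (x - p) / (y - p) := by
  have hpi : p ∉ S.Ireal i := fun h => hik (S.disjoint_closed (S.mem_Ireal.1 h).le hp)
  have hoc := (Ireal_convex (S := S) i).ordConnected
  rcases lt_trichotomy x p with h1 | h1 | h1
  · rcases lt_or_ge y p with h2 | h2
    · exact div_pos_of_neg_of_neg (by linarith) (by linarith)
    · exact absurd (hoc.out hx hy ⟨h1.le, h2⟩) hpi
  · subst h1; exact absurd hx hpi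
  · rcases lt_or_ge p y with h2 | h2
    · exact div_pos (by linarith) (by linarith)
    · exact absurd (hoc.out hy hx ⟨h2, h1.le⟩) hpi

lemma log_deriv_eq {n : ℕ} {j i : Fin (2 * S.r)} {b : List (Fin (2 * S.r))}
    (hb : b ∈ S.Words n j) (hij : i ≠ wordBar j) :
    ∃ p : ℝ, |p - S.center (wordBar j)| ≤ S.radius (wordBar j) ∧
      ∀ x ∈ S.Ireal i, ∀ y ∈ S.Ireal i,
        Real.log (mobiusDerivR (S.wprod (b ++ [j])) x) -
          Real.log (mobiusDerivR (S.wprod (b ++ [j])) y) = 2 * Real.log ((y - p) / (x - p)) := by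
  obtain ⟨p, u, hu, hp, h⟩ := words_pole hb
  refine ⟨p, hp, fun x hx y hy => ?_⟩
  have hd := S.gap_pos
  have h1 := S.gap_le hij (S.mem_Ireal.1 hx).le hp
  have h2 := S.gap_le hij (S.mem_Ireal.1 hy).le hp
  have hx0 : x - p ≠ 0 := abs_pos.1 (by linarith)
  have hy0 : y - p ≠ 0 := abs_pos.1 (by linarith)
  rw [mobiusDerivR_eq, mobiusDerivR_eq, h x (S.far_of_mem hij hx).le,
      h y (S.far_of_mem hij hy).le, Real.log_pow, Real.log_pow, Real.log_inv, Real.log_inv,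
      Real.log_mul hu hx0, Real.log_mul hu hy0, Real.log_div hy0 hx0]
  push_cast
  ring

lemma log_deriv_lipschitz {n : ℕ} {i : Fin (2 * S.r)} {w : List (Fin (2 * S.r))}
    (hw : w ∈ S.Words n i) {x y : ℝ} (hx : x ∈ S.Ireal i) (hy : y ∈ S.Ireal i) :
    |Real.log (mobiusDerivR (S.wprod w) x) - Real.log (mobiusDerivR (S.wprod w) y)|
      ≤ 2 / S.gap * |x - y| := by
  have hd := S.gap_pos
  cases n with
  | zero =>
    rw [mem_words_zero] at hw
    subst hw
    simp; positivity
  | succ n =>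
    obtain ⟨j, hj, b, hb, rfl⟩ := mem_words_succ.1 hw
    obtain ⟨p, hp, h⟩ := log_deriv_eq hb hj
    have key : ∀ x ∈ S.Ireal i, ∀ y ∈ S.Ireal i,
        Real.log (mobiusDerivR (S.wprod (b ++ [j])) x) -
          Real.log (mobiusDerivR (S.wprod (b ++ [j])) y) ≤ 2 / S.gap * |x - y| := by
      intro x hx y hy
      rw [h x hx y hy]
      have h1 := S.gap_le hj (S.mem_Ireal.1 hx).le hp
      have hx0 : x - p ≠ 0 := abs_pos.1 (by linarith)
      have h3 := Real.log_le_sub_one_of_pos (sub_pole_div_pos hj hp hy hx)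
      have h4 : (y - p) / (x - p) - 1 = (y - x) / (x - p) := by field_simp; ring
      have h5 : (y - x) / (x - p) ≤ |x - y| / S.gap := by
        refine (le_abs_self _).trans ?_
        rw [abs_div, abs_sub_comm y x]
        gcongr
      have h6 : 2 / S.gap * |x - y| = 2 * (|x - y| / S.gap) := by ring
      rw [h6]
      linarith
    rw [abs_le]
    have h1 := key x hx y hy
    have h2 := key y hy x hx
    rw [abs_sub_comm] at h2
    constructor <;> linarith

/-- Uniform non-integrability: phases of words with distinct last letters separate. -/
lemma log_deriv_uni {n m : ℕ} {i j j' : Fin (2 * S.r)} {b b' : List (Fin (2 * S.r))}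
    (hb : b ∈ S.Words n j) (hij : i ≠ wordBar j) (hb' : b' ∈ S.Words m j')
    (hij' : i ≠ wordBar j') (hjj : j ≠ j') {x y : ℝ} (hx : x ∈ S.Ireal i) (hy : y ∈ S.Ireal i) :
    S.gap / S.span ^ 2 * |x - y| ≤
      |(Real.log (mobiusDerivR (S.wprod (b ++ [j])) x) -
        Real.log (mobiusDerivR (S.wprod (b ++ [j])) y)) -
       (Real.log (mobiusDerivR (S.wprod (b' ++ [j'])) x) -
        Real.log (mobiusDerivR (S.wprod (b' ++ [j'])) y))| := by
  obtain ⟨p, hp, h⟩ := log_deriv_eq hb hij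
  obtain ⟨q, hq, h'⟩ := log_deriv_eq hb' hij'
  have hd := S.gap_pos
  have hs := S.one_le_span
  have hbb : wordBar j ≠ wordBar j' := fun hh => hjj (by
    rw [← wordBar_wordBar j, hh, wordBar_wordBar])
  have hpq := S.gap_le hbb hp hq
  set L : ℝ → ℝ → ℝ := fun x y => (Real.log (mobiusDerivR (S.wprod (b ++ [j])) x) -
        Real.log (mobiusDerivR (S.wprod (b ++ [j])) y)) -
       (Real.log (mobiusDerivR (S.wprod (b' ++ [j'])) x) -
        Real.log (mobiusDerivR (S.wprod (b' ++ [j'])) y)) with hL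
  have key : ∀ x ∈ S.Ireal i, ∀ y ∈ S.Ireal i, 0 ≤ (y - x) * (p - q) / ((x - p) * (y - q)) →
      S.gap / S.span ^ 2 * |x - y| ≤ |L x y| := by
    intro x hx y hy hpos
    have h1 := S.gap_le hij (S.mem_Ireal.1 hx).le hp
    have h2 := S.gap_le hij (S.mem_Ireal.1 hy).le hp
    have h3 := S.gap_le hij' (S.mem_Ireal.1 hx).le hq
    have h4 := S.gap_le hij' (S.mem_Ireal.1 hy).le hq
    have g2 := S.le_span (S.mem_Ireal.1 hy).le hp
    have g3 := S.le_span (S.mem_Ireal.1 hx).le hq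
    have n1 : x - p ≠ 0 := abs_pos.1 (by linarith)
    have n2 : y - p ≠ 0 := abs_pos.1 (by linarith)
    have n3 : x - q ≠ 0 := abs_pos.1 (by linarith)
    have n4 : y - q ≠ 0 := abs_pos.1 (by linarith)
    have hR : L x y = 2 * Real.log (((y - p) / (x - p)) * ((x - q) / (y - q))) := by
      rw [Real.log_mul (div_ne_zero n2 n1) (div_ne_zero n3 n4), hL]
      simp only
      rw [h x hx y hy, h' x hx y hy, ← inv_div (y - q) (x - q), Real.log_inv]
      ring
    have hRpos : 0 < ((y - p) / (x - p)) * ((x - q) / (y - q)) :=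
      mul_pos (sub_pole_div_pos hij hp hy hx) (sub_pole_div_pos hij' hq hx hy)
    have hlog := Real.one_sub_inv_le_log_of_pos hRpos
    have e1 : 1 - (((y - p) / (x - p)) * ((x - q) / (y - q)))⁻¹
        = (y - x) * (p - q) / ((y - p) * (x - q)) := by field_simp; ring
    have e2 : (y - x) * (p - q) / ((y - p) * (x - q)) =
      ((y - x) * (p - q) / ((x - p) * (y - q))) *
        (((y - p) / (x - p)) * ((x - q) / (y - q)))⁻¹ := by field_simp
    have e3 : 0 ≤ (y - x) * (p - q) / ((y - p) * (x - q)) := by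
      rw [e2]; exact mul_nonneg hpos (inv_nonneg.2 hRpos.le)
    have e4 : S.gap / S.span ^ 2 * |x - y| ≤ (y - x) * (p - q) / ((y - p) * (x - q)) := by
      rw [← abs_of_nonneg e3, abs_div, abs_mul, abs_mul, abs_sub_comm y x]
      have : S.gap / S.span ^ 2 * |x - y| = |x - y| * S.gap / (S.span * S.span) := by
        field_simp
      rw [this]
      have k2 : 0 < |y - p| := abs_pos.2 n2
      have k3 : 0 < |x - q| := abs_pos.2 n3
      gcongr
    rw [e1] at hlog
    rw [hR]
    refine e4.trans (le_trans ?_ (le_abs_self _))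
    linarith
  have hxy : ∀ x y, L y x = - L x y := by intro x y; simp only [hL]; ring
  have hgoal : S.gap / S.span ^ 2 * |x - y| ≤ |L x y| := by
    rcases le_or_gt 0 ((y - x) * (p - q) / ((x - p) * (y - q))) with hc | hc
    · exact key x hx y hy hc
    · have := key y hy x hx ?_
      · rwa [abs_sub_comm, hxy, abs_neg] at this
      · have r1 := sub_pole_div_pos hij hp hx hy
        have r2 := sub_pole_div_pos hij' hq hy hx
        have h1 := S.gap_le hij (S.mem_Ireal.1 hx).le hp
        have h2 := S.gap_le hij (S.mem_Ireal.1 hy).le hp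
        have h3 := S.gap_le hij' (S.mem_Ireal.1 hx).le hq
        have h4 := S.gap_le hij' (S.mem_Ireal.1 hy).le hq
        have n1 : x - p ≠ 0 := abs_pos.1 (by linarith)
        have n2 : y - p ≠ 0 := abs_pos.1 (by linarith)
        have n3 : x - q ≠ 0 := abs_pos.1 (by linarith)
        have n4 : y - q ≠ 0 := abs_pos.1 (by linarith)
        have : (x - y) * (p - q) / ((y - p) * (x - q)) =
          -((y - x) * (p - q) / ((x - p) * (y - q))) *
            (((x - p) / (y - p)) * ((y - q) / (x - q))) := by
          field_simp; ring
        rw [this]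
        exact mul_nonneg (by linarith) (mul_pos r1 r2).le
  exact hgoal

end Schottky

namespace Schottky

variable (S : Schottky)

/-- The (Hilbert) metric density of the interval `I_a` enlarged by half the gap. -/
noncomputable def hilb (a : Fin (2 * S.r)) (x : ℝ) : ℝ :=
  1 / (x - (S.center a - S.radius a - S.gap / 2)) +
    1 / (S.center a + S.radius a + S.gap / 2 - x)

/-- A uniform bound for the derivatives of `γ_w`, `w` of length `n`. -/
noncomputable def kap (n : ℕ) : ℝ := 8 * S.span / S.gap * (S.span / (S.span + S.gap / 2)) ^ n

lemma kap_pos (n : ℕ) : 0 < S.kap n := by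
  have := S.gap_pos
  have := S.one_le_span
  unfold kap; positivity

lemma tendsto_kap : Filter.Tendsto S.kap Filter.atTop (nhds 0) := by
  have h1 := S.gap_pos
  have h2 := S.one_le_span
  have : Filter.Tendsto (fun n : ℕ => (S.span / (S.span + S.gap / 2)) ^ n) Filter.atTop (nhds 0) :=
    tendsto_pow_atTop_nhds_zero_of_lt_one (by positivity) (by
      rw [div_lt_one (by positivity)]; linarith)
  have h := this.const_mul (8 * S.span / S.gap)
  rw [mul_zero] at h
  exact h

lemma radius_le (a : Fin (2 * S.r)) : 2 * S.radius a ≤ S.span := by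
  have h := S.radius_pos a
  have := S.le_span (a := a) (b := a) (x := S.center a + S.radius a)
    (y := S.center a - S.radius a) (by simp [abs_of_pos h]) (by simp [abs_of_pos h])
  rw [abs_of_pos (by linarith)] at this
  linarith

variable {S}

lemma hilb_bounds {a : Fin (2 * S.r)} {x : ℝ} (hx : |x - S.center a| ≤ S.radius a) :
    1 / (2 * S.span) ≤ S.hilb a x ∧ S.hilb a x ≤ 4 / S.gap := by
  have h1 := S.gap_pos
  have h2 := S.one_le_span
  have h3 := S.gap_le_one
  have h4 := S.radius_le a
  rw [abs_le] at hx
  have e1 : S.gap / 2 ≤ x - (S.center a - S.radius a - S.gap / 2) := by linarith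
  have e2 : S.gap / 2 ≤ S.center a + S.radius a + S.gap / 2 - x := by linarith
  have e3 : x - (S.center a - S.radius a - S.gap / 2) ≤ 2 * S.span := by linarith
  unfold hilb
  constructor
  · have : 1 / (2 * S.span) ≤ 1 / (x - (S.center a - S.radius a - S.gap / 2)) :=
      one_div_le_one_div_of_le (by linarith) e3
    have : 0 ≤ 1 / (S.center a + S.radius a + S.gap / 2 - x) :=
      one_div_nonneg.2 (by linarith)
    linarith
  · have i1 := one_div_le_one_div_of_le (by linarith) e1
    have i2 := one_div_le_one_div_of_le (by linarith) e2
    have : 4 / S.gap = 1 / (S.gap / 2) + 1 / (S.gap / 2) := by field_simp; norm_num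
    rw [this]; linarith

lemma far_of_enlarged {i b : Fin (2 * S.r)} (hib : i ≠ b) {x : ℝ}
    (hx : |x - S.center i| ≤ S.radius i + S.gap / 2) : S.radius b < |x - S.center b| := by
  by_contra h
  push Not at h
  have h1 := S.gap_pos
  obtain ⟨y, hy, hxy⟩ : ∃ y, |y - S.center i| ≤ S.radius i ∧ |y - x| ≤ S.gap / 2 := by
    have hr := S.radius_pos i
    rw [abs_le] at hx
    refine ⟨max (S.center i - S.radius i) (min x (S.center i + S.radius i)), ?_, ?_⟩
    · rw [abs_le]
      have a1 := le_max_left (S.center i - S.radius i) (min x (S.center i + S.radius i))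
      have a2 : max (S.center i - S.radius i) (min x (S.center i + S.radius i)) ≤
        S.center i + S.radius i := max_le (by linarith) (min_le_right _ _)
      constructor <;> linarith
    · rw [abs_le]
      rcases le_total x (S.center i + S.radius i) with h2 | h2
      · rw [min_eq_left h2]
        rcases le_total (S.center i - S.radius i) x with h3 | h3
        · rw [max_eq_right h3]; constructor <;> linarith
        · rw [max_eq_left h3]; constructor <;> linarith
      · rw [min_eq_right h2, max_eq_right (by linarith)]; constructor <;> linarith
  have := S.gap_le hib hy h
  linarith

lemma hilb_contract {i j : Fin (2 * S.r)} (hij : i ≠ wordBar j) {x : ℝ} (hx : x ∈ S.Ireal i) :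
    S.hilb j (mobiusR (S.g j) x) * mobiusDerivR (S.g j) x ≤
      S.span / (S.span + S.gap / 2) * S.hilb i x := by
  obtain ⟨p, hp, hden⟩ := S.g_pole j
  have hu := S.g_lower_ne j
  set u := (S.g j).1 1 0
  have h1 := S.gap_pos
  have h2 := S.one_le_span
  have hri := S.radius_pos i
  have hrj := S.radius_le j
  have hx' := S.mem_Ireal.1 hx
  rw [abs_lt] at hx'
  set α := S.center i - S.radius i - S.gap / 2 with hα
  set β := S.center i + S.radius i + S.gap / 2 with hβ
  have fα : S.radius (wordBar j) < |α - S.center (wordBar j)| :=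
    far_of_enlarged hij (by rw [abs_le]; constructor <;> linarith)
  have fβ : S.radius (wordBar j) < |β - S.center (wordBar j)| :=
    far_of_enlarged hij (by rw [abs_le]; constructor <;> linarith)
  have hpαβ : p < α ∨ β < p := by
    by_contra hcon
    push Not at hcon
    have := far_of_enlarged hij (x := p) (by rw [abs_le]; constructor <;> linarith)
    linarith
  obtain ⟨dα, mα⟩ := S.g_maps fα.le
  obtain ⟨dβ, mβ⟩ := S.g_maps fβ.le
  have dx := S.g_den_ne hij hx
  have mx := (S.mem_Ireal.1 (S.g_mem hij hx)).le
  rw [abs_le] at mα mβ mx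
  have sα := mobiusR_sub dx dα
  have sβ := mobiusR_sub dβ dx
  set y := mobiusR (S.g j) x
  set yα := mobiusR (S.g j) α
  set yβ := mobiusR (S.g j) β
  rw [hden] at dα dβ dx
  rw [hden, hden] at sα sβ
  have nx : x - p ≠ 0 := right_ne_zero_of_mul dx
  have nα : α - p ≠ 0 := right_ne_zero_of_mul dα
  have nβ : β - p ≠ 0 := right_ne_zero_of_mul dβ
  have u2 : 0 < u ^ 2 := by positivity
  have pα : 0 < (x - p) * (α - p) := by
    rcases hpαβ with h | h
    · exact mul_pos (by linarith) (by linarith)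
    · exact mul_pos_of_neg_of_neg (by linarith) (by linarith)
  have pβ : 0 < (β - p) * (x - p) := by
    rcases hpαβ with h | h
    · exact mul_pos (by linarith) (by linarith)
    · exact mul_pos_of_neg_of_neg (by linarith) (by linarith)
  have yα0 : 0 < y - yα := by
    rw [sα, show u * (x - p) * (u * (α - p)) = u ^ 2 * ((x - p) * (α - p)) by ring]
    exact div_pos (by linarith) (mul_pos u2 pα)
  have yβ0 : 0 < yβ - y := by
    rw [sβ, show u * (β - p) * (u * (x - p)) = u ^ 2 * ((β - p) * (x - p)) by ring]
    exact div_pos (by linarith) (mul_pos u2 pβ)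
  have xα0 : x - α ≠ 0 := by linarith
  have xβ0 : β - x ≠ 0 := by linarith
  have key : (1 / (y - yα) + 1 / (yβ - y)) * mobiusDerivR (S.g j) x = S.hilb i x := by
    rw [sα, sβ, mobiusDerivR_eq, hden]
    unfold hilb
    rw [← hα, ← hβ]
    field_simp
    ring
  have hκ : ∀ Y Z : ℝ, 0 < Y → Y ≤ S.span → Y + S.gap / 2 ≤ Z →
      1 / Z ≤ S.span / (S.span + S.gap / 2) * (1 / Y) := by
    intro Y Z hY hY2 hZ
    rw [div_mul_div_comm, mul_one, div_le_div_iff₀ (by linarith) (by positivity)]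
    nlinarith
  have k1 := hκ (y - yα) (y - (S.center j - S.radius j - S.gap / 2)) yα0 (by linarith)
    (by linarith)
  have k2 := hκ (yβ - y) (S.center j + S.radius j + S.gap / 2 - y) yβ0 (by linarith)
    (by linarith)
  rw [← key, ← mul_assoc]
  apply mul_le_mul_of_nonneg_right _ (mobiusDerivR_nonneg _ _)
  unfold hilb
  linarith

lemma hilb_words {n : ℕ} {i : Fin (2 * S.r)} {w : List (Fin (2 * S.r))}
    (hw : w ∈ S.Words n i) {x : ℝ} (hx : x ∈ S.Ireal i) :
    ∃ k, mobiusR (S.wprod w) x ∈ S.Ireal k ∧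
      S.hilb k (mobiusR (S.wprod w) x) * mobiusDerivR (S.wprod w) x ≤
        (S.span / (S.span + S.gap / 2)) ^ n * S.hilb i x := by
  have h1 := S.gap_pos
  have h2 := S.one_le_span
  induction n generalizing i w x with
  | zero =>
    rw [mem_words_zero] at hw
    subst hw
    exact ⟨i, by simpa using hx, by simp⟩
  | succ n ih =>
    obtain ⟨j, hj, b, hb, rfl⟩ := mem_words_succ.1 hw
    obtain ⟨k, hk, hle⟩ := ih hb (S.g_mem hj hx)
    obtain ⟨e1, e2⟩ := words_succ_apply hj b hx
    rw [e1, e2]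
    refine ⟨k, hk, ?_⟩
    have hc := hilb_contract hj hx
    calc _ = (S.hilb k (mobiusR (S.wprod b) (mobiusR (S.g j) x)) *
          mobiusDerivR (S.wprod b) (mobiusR (S.g j) x)) * mobiusDerivR (S.g j) x := by ring
      _ ≤ ((S.span / (S.span + S.gap / 2)) ^ n * S.hilb j (mobiusR (S.g j) x)) *
          mobiusDerivR (S.g j) x := mul_le_mul_of_nonneg_right hle (mobiusDerivR_nonneg _ _)
      _ = (S.span / (S.span + S.gap / 2)) ^ n * (S.hilb j (mobiusR (S.g j) x) *
          mobiusDerivR (S.g j) x) := by ring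
      _ ≤ (S.span / (S.span + S.gap / 2)) ^ n * (S.span / (S.span + S.gap / 2) * S.hilb i x) :=
          mul_le_mul_of_nonneg_left hc (by positivity)
      _ = _ := by ring

/-- Uniform exponential contraction. -/
lemma words_contract {n : ℕ} {i : Fin (2 * S.r)} {w : List (Fin (2 * S.r))}
    (hw : w ∈ S.Words n i) {x : ℝ} (hx : x ∈ S.Ireal i) :
    mobiusDerivR (S.wprod w) x ≤ S.kap n := by
  have h1 := S.gap_pos
  have h2 := S.one_le_span
  obtain ⟨k, hk, hle⟩ := hilb_words hw hx
  have b1 := (hilb_bounds (S.mem_Ireal.1 hk).le).1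
  have b2 := (hilb_bounds (S.mem_Ireal.1 hx).le).2
  have hd := mobiusDerivR_nonneg (S.wprod w) x
  have h3 : 1 / (2 * S.span) * mobiusDerivR (S.wprod w) x ≤
      (S.span / (S.span + S.gap / 2)) ^ n * (4 / S.gap) :=
    (mul_le_mul_of_nonneg_right b1 hd).trans
      (hle.trans (mul_le_mul_of_nonneg_left b2 (by positivity)))
  have h4 : S.kap n = 2 * S.span * ((S.span / (S.span + S.gap / 2)) ^ n * (4 / S.gap)) := by
    unfold kap; ring
  rw [h4]
  calc _ = 2 * S.span * (1 / (2 * S.span) * mobiusDerivR (S.wprod w) x) := by field_simp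
    _ ≤ _ := by gcongr

lemma words_dist_le {n : ℕ} {i : Fin (2 * S.r)} {w : List (Fin (2 * S.r))}
    (hw : w ∈ S.Words n i) {x y : ℝ} (hx : x ∈ S.Ireal i) (hy : y ∈ S.Ireal i) :
    |mobiusR (S.wprod w) x - mobiusR (S.wprod w) y| ≤ S.kap n * |x - y| := by
  have h := dist_sq_words hw hw hx hy
  have hk := (S.kap_pos n).le
  rw [← abs_of_nonneg (mul_nonneg hk (abs_nonneg (x - y))), ← sq_le_sq, h, mul_pow, sq_abs, pow_two (S.kap n)]
  have h1 := words_contract hw hx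
  have h2 := words_contract hw hy
  have := mobiusDerivR_nonneg (S.wprod w) x
  have := mobiusDerivR_nonneg (S.wprod w) y
  gcongr

end Schottky

namespace Schottky

variable (S : Schottky)

open Classical in
/-- The letter `i` with `x ∈ I_i` (junk off `I`). -/
noncomputable def idx (x : ℝ) : Fin (2 * S.r) :=
  if h : ∃ i, x ∈ S.Ireal i then h.choose else ⟨0, by have := S.two_le_r; omega⟩

variable {S}

lemma idx_eq {i : Fin (2 * S.r)} {x : ℝ} (hx : x ∈ S.Ireal i) : S.idx x = i := by
  have h : ∃ i, x ∈ S.Ireal i := ⟨i, hx⟩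
  rw [idx, dif_pos h]
  exact S.Ireal_unique h.choose_spec hx

lemma mem_idx {x : ℝ} (hx : x ∈ S.Iall) : x ∈ S.Ireal (S.idx x) := by
  obtain ⟨i, hi⟩ := S.mem_Iall.1 hx
  rwa [idx_eq hi]

lemma idx_g {x : ℝ} (hx : x ∈ S.Iall) {j : Fin (2 * S.r)} (hj : j ∈ S.Pred (S.idx x)) :
    S.idx (mobiusR (S.g j) x) = j := idx_eq (S.g_mem (mem_Pred.1 hj) (mem_idx hx))

variable (S)

lemma measurable_idx : Measurable S.idx := by
  have h0 : 0 < 2 * S.r := by have := S.two_le_r; omega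
  refine measurable_to_countable' fun i => ?_
  have : S.idx ⁻¹' {i} = S.Ireal i ∪ (if (⟨0, h0⟩ : Fin (2 * S.r)) = i then S.Iallᶜ else ∅) := by
    ext x
    simp only [Set.mem_preimage, Set.mem_singleton_iff, Set.mem_union]
    by_cases hx : x ∈ S.Iall
    · have hm := mem_idx hx
      constructor
      · rintro rfl; exact Or.inl hm
      · rintro (h | h)
        · exact idx_eq h
        · split_ifs at h
          · exact absurd hx h
          · exact absurd h (Set.notMem_empty _)
    · have hne : ¬ ∃ i, x ∈ S.Ireal i := fun h => hx (S.mem_Iall.2 h)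
      rw [idx, dif_neg hne]
      constructor
      · intro h; rw [if_pos h]; exact Or.inr hx
      · rintro (h | h)
        · exact absurd ⟨i, h⟩ hne
        · split_ifs at h with h2
          · exact h2
          · exact absurd h (Set.notMem_empty _)
  rw [this]
  refine (S.measurableSet_Ireal i).union ?_
  split_ifs
  · exact S.measurableSet_Iall.compl
  · exact MeasurableSet.empty

/-- The positive transfer operator on `ENNReal`-valued functions. -/
noncomputable def opL (δ : ℝ) (n : ℕ) (f : ℝ → ENNReal) (x : ℝ) : ENNReal :=
  ∑ w ∈ S.Words n (S.idx x),
    ENNReal.ofReal (mobiusDerivR (S.wprod w) x ^ δ) * f (mobiusR (S.wprod w) x)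

lemma measurable_of_idx {β : Type*} [MeasurableSpace β] {F : Fin (2 * S.r) → ℝ → β}
    (hF : ∀ i, Measurable (F i)) : Measurable fun x => F (S.idx x) x := by
  have : Measurable (fun p : Fin (2 * S.r) × ℝ => F p.1 p.2) :=
    measurable_from_prod_countable_right hF
  exact this.comp (S.measurable_idx.prodMk measurable_id)

lemma measurable_opL (δ : ℝ) (n : ℕ) {f : ℝ → ENNReal} (hf : Measurable f) :
    Measurable (S.opL δ n f) := by
  refine S.measurable_of_idx (F := fun i x => ∑ w ∈ S.Words n i,
    ENNReal.ofReal (mobiusDerivR (S.wprod w) x ^ δ) * f (mobiusR (S.wprod w) x)) fun i => ?_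
  refine Finset.measurable_sum _ fun w _ => ?_
  exact (((measurable_mobiusDerivR _).pow_const δ).ennreal_ofReal).mul
    (hf.comp (measurable_mobiusR _))

/-- A conformal probability measure carried by `I`. -/
structure Conf (δ : ℝ) (μ : Measure ℝ) : Prop where
  prob : IsProbabilityMeasure μ
  null : μ S.Iallᶜ = 0
  inv_one : ∀ f : ℝ → ENNReal, Measurable f → ∫⁻ x, f x ∂μ = ∫⁻ x, S.opL δ 1 f x ∂μ

variable {S}

lemma sum_words_one {M : Type*} [AddCommMonoid M] (i : Fin (2 * S.r))
    (f : List (Fin (2 * S.r)) → M) : ∑ w ∈ S.Words 1 i, f w = ∑ j ∈ S.Pred i, f [j] := by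
  rw [sum_words_succ]
  simp [Words]

lemma wprod_singleton (j : Fin (2 * S.r)) : S.wprod [j] = S.g j := by simp [wprod]

lemma opL_one_apply (δ : ℝ) (f : ℝ → ENNReal) (x : ℝ) : S.opL δ 1 f x =
    ∑ j ∈ S.Pred (S.idx x),
      ENNReal.ofReal (mobiusDerivR (S.g j) x ^ δ) * f (mobiusR (S.g j) x) := by
  rw [opL, sum_words_one]
  simp only [wprod_singleton]

lemma opL_succ (δ : ℝ) (n : ℕ) (f : ℝ → ENNReal) {x : ℝ} (hx : x ∈ S.Iall) :
    S.opL δ (n + 1) f x = S.opL δ 1 (S.opL δ n f) x := by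
  rw [opL_one_apply, opL, sum_words_succ]
  refine Finset.sum_congr rfl fun j hj => ?_
  have hij := mem_Pred.1 hj
  have hxi := mem_idx hx
  rw [opL, idx_g hx hj, Finset.mul_sum]
  refine Finset.sum_congr rfl fun b _ => ?_
  obtain ⟨e1, e2⟩ := words_succ_apply hij b hxi
  rw [e1, e2, Real.mul_rpow (mobiusDerivR_nonneg _ _) (mobiusDerivR_nonneg _ _),
    ENNReal.ofReal_mul (Real.rpow_nonneg (mobiusDerivR_nonneg _ _) _)]
  ring

namespace Conf

variable {δ : ℝ} {μ : Measure ℝ}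

lemma ae_mem (hμ : S.Conf δ μ) : ∀ᵐ x ∂μ, x ∈ S.Iall := by
  rw [ae_iff]; exact hμ.null

lemma inv (hμ : S.Conf δ μ) (n : ℕ) {f : ℝ → ENNReal} (hf : Measurable f) :
    ∫⁻ x, f x ∂μ = ∫⁻ x, S.opL δ n f x ∂μ := by
  induction n with
  | zero => simp [opL, Words]
  | succ n ih =>
    rw [ih, hμ.inv_one _ (S.measurable_opL δ n hf)]
    refine lintegral_congr_ae ?_
    filter_upwards [hμ.ae_mem] with x hx
    exact (opL_succ δ n f hx).symm

end Conf

lemma Lscalar_eq (δ : ℝ) (f : ℝ → ℝ) {x : ℝ} (hx : x ∈ S.Iall) :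
    S.Lscalar δ f x = ∑ j ∈ S.Pred (S.idx x),
      mobiusDerivR (S.g j) x ^ δ * f (mobiusR (S.g j) x) := by
  have h := S.mem_Iall.1 hx
  rw [Lscalar, dif_pos h]
  have : h.choose = S.idx x := (idx_eq h.choose_spec).symm
  rw [this]
  refine Finset.sum_congr ?_ fun _ _ => rfl
  ext j
  simp [Pred]

lemma Lscalar_eq_toReal (δ : ℝ) (f : BoundedContinuousFunction ℝ NNReal) {x : ℝ}
    (hx : x ∈ S.Iall) :
    ENNReal.ofReal (S.Lscalar δ (fun x => (f x : ℝ)) x) = S.opL δ 1 (fun x => (f x : ENNReal)) x := by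
  rw [Lscalar_eq δ _ hx, opL_one_apply, ENNReal.ofReal_sum_of_nonneg]
  · refine Finset.sum_congr rfl fun j _ => ?_
    rw [ENNReal.ofReal_mul (Real.rpow_nonneg (mobiusDerivR_nonneg _ _) _),
      ENNReal.ofReal_coe_nnreal]
  · intro j _
    exact mul_nonneg (Real.rpow_nonneg (mobiusDerivR_nonneg _ _) _) (NNReal.coe_nonneg _)

lemma deriv_rpow_le {δ : ℝ} (hδ : 0 ≤ δ) {i j : Fin (2 * S.r)} (hij : i ≠ wordBar j) {x : ℝ}
    (hx : x ∈ S.Ireal i) : mobiusDerivR (S.g j) x ^ δ ≤ S.dC ^ δ :=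
  Real.rpow_le_rpow (mobiusDerivR_nonneg _ _) (deriv_le hij hx) hδ

lemma opL_one_le {δ : ℝ} (hδ : 0 ≤ δ) {f : ℝ → ENNReal} {C : ENNReal} (hf : ∀ x, f x ≤ C)
    {x : ℝ} (hx : x ∈ S.Iall) :
    S.opL δ 1 f x ≤ (2 * S.r : ℕ) * (ENNReal.ofReal (S.dC ^ δ) * C) := by
  rw [opL_one_apply]
  refine (Finset.sum_le_card_nsmul _ _ (ENNReal.ofReal (S.dC ^ δ) * C) fun j hj => ?_).trans ?_
  · exact mul_le_mul' (ENNReal.ofReal_le_ofReal (deriv_rpow_le hδ (mem_Pred.1 hj) (mem_idx hx)))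
      (hf _)
  · rw [nsmul_eq_mul]
    gcongr
    exact (Finset.card_le_univ _).trans (by simp)

/-- The hypotheses of the theorem give a conformal measure. -/
lemma conf_of_invariant {δ : ℝ} (hδ : 0 ≤ δ) {μ : Measure ℝ} [hp : IsProbabilityMeasure μ]
    (hsupp : {x : ℝ | ∀ U ∈ nhds x, 0 < μ U} = S.limitSetR)
    (hinv : ∀ f : ℝ → ℝ, ContinuousOn f (closure S.Iall) →
      ∫ x, S.Lscalar δ f x ∂μ = ∫ x, f x ∂μ) : S.Conf δ μ := by
  have hnull : μ S.Iallᶜ = 0 := by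
    refine measure_mono_null ?_ (Measure.measure_compl_support (μ := μ))
    apply Set.compl_subset_compl.2
    intro x hx
    have hx' : x ∈ {x : ℝ | ∀ U ∈ nhds x, 0 < μ U} := (Measure.mem_support_iff_forall x).1 hx
    rw [hsupp] at hx'
    obtain ⟨w, hw, hwD⟩ := hx' 0
    have : (x : ℂ) = w := OnePoint.coe_injective hw
    rw [← this] at hwD
    obtain ⟨i, hi⟩ := Set.mem_iUnion.1 hwD
    exact S.mem_Iall.2 ⟨i, hi⟩
  have hae : ∀ᵐ x ∂μ, x ∈ S.Iall := by rw [ae_iff]; exact hnull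
  refine ⟨hp, hnull, ?_⟩
  have hbc : ∀ f : BoundedContinuousFunction ℝ NNReal,
      ∫⁻ x, (f x : ENNReal) ∂μ = ∫⁻ x, S.opL δ 1 (fun x => (f x : ENNReal)) x ∂μ := by
    intro f
    have hfc : Continuous fun x => (f x : ℝ) := NNReal.continuous_coe.comp f.continuous
    have h1 := hinv (fun x => (f x : ℝ)) hfc.continuousOn
    have hmeas : Measurable (fun x => (S.opL δ 1 (fun x => (f x : ENNReal)) x)) :=
      S.measurable_opL δ 1 (f.continuous.measurable.coe_nnreal_ennreal)
    obtain ⟨C, hC⟩ : ∃ C : NNReal, ∀ x, f x ≤ C :=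
      ⟨nndist f 0, fun x => BoundedContinuousFunction.NNReal.upper_bound f x⟩
    have hfin : ∀ x ∈ S.Iall, S.opL δ 1 (fun x => (f x : ENNReal)) x ≠ ⊤ := by
      intro x hx
      refine ne_top_of_le_ne_top ?_ (opL_one_le hδ (C := (C : ENNReal)) (fun x => by
        exact_mod_cast hC x) hx)
      exact ENNReal.mul_ne_top (ENNReal.natCast_ne_top _)
        (ENNReal.mul_ne_top ENNReal.ofReal_ne_top ENNReal.coe_ne_top)
    have h2 : ∫ x, S.Lscalar δ (fun x => (f x : ℝ)) x ∂μ =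
        (∫⁻ x, S.opL δ 1 (fun x => (f x : ENNReal)) x ∂μ).toReal := by
      rw [← integral_toReal hmeas.aemeasurable]
      · refine integral_congr_ae ?_
        filter_upwards [hae] with x hx
        rw [← Lscalar_eq_toReal δ f hx, ENNReal.toReal_ofReal]
        rw [Lscalar_eq δ _ hx]
        exact Finset.sum_nonneg fun j _ =>
          mul_nonneg (Real.rpow_nonneg (mobiusDerivR_nonneg _ _) _) (NNReal.coe_nonneg _)
      · filter_upwards [hae] with x hx
        exact (hfin x hx).lt_top
    have h3 : ∫ x, (f x : ℝ) ∂μ = (∫⁻ x, (f x : ENNReal) ∂μ).toReal := by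
      rw [← integral_toReal (f.continuous.measurable.coe_nnreal_ennreal).aemeasurable]
      · simp
      · simp
    rw [h2, h3] at h1
    refine ((ENNReal.toReal_eq_toReal_iff' ?_ ?_).1 h1).symm
    · refine ((lintegral_mono_ae (hae.mono fun x hx => opL_one_le hδ (C := (C : ENNReal))
        (fun x => by exact_mod_cast hC x) hx)).trans_lt ?_).ne
      rw [lintegral_const]
      simp only [measure_univ, mul_one]
      exact ENNReal.mul_lt_top (ENNReal.natCast_lt_top _)
        (ENNReal.mul_lt_top ENNReal.ofReal_lt_top ENNReal.coe_lt_top)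
    · refine ((lintegral_mono (fun x => show (f x : ENNReal) ≤ C by
        exact_mod_cast hC x)).trans_lt ?_).ne
      rw [lintegral_const]
      simp
  set ν : Measure ℝ := ∑ j : Fin (2 * S.r),
    ((μ.restrict {x | S.idx x ≠ wordBar j}).withDensity
      (fun x => ENNReal.ofReal (mobiusDerivR (S.g j) x ^ δ))).map (mobiusR (S.g j)) with hν
  have hset : ∀ j : Fin (2 * S.r), MeasurableSet {x | S.idx x ≠ wordBar j} := fun j =>
    S.measurable_idx (MeasurableSet.of_discrete (s := {wordBar j}ᶜ))
  have hνl : ∀ f : ℝ → ENNReal, Measurable f → ∫⁻ x, f x ∂ν = ∫⁻ x, S.opL δ 1 f x ∂μ := by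
    intro f hf
    have hdm : ∀ j : Fin (2 * S.r), Measurable
      (fun x => ENNReal.ofReal (mobiusDerivR (S.g j) x ^ δ)) := fun j =>
        ((measurable_mobiusDerivR _).pow_const δ).ennreal_ofReal
    have hfm : ∀ j : Fin (2 * S.r), Measurable (fun x => f (mobiusR (S.g j) x)) := fun j =>
      hf.comp (measurable_mobiusR _)
    have e1 : ∀ x, S.opL δ 1 f x = ∑ j, {x | S.idx x ≠ wordBar j}.indicator
        (fun x => ENNReal.ofReal (mobiusDerivR (S.g j) x ^ δ) * f (mobiusR (S.g j) x)) x := by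
      intro x
      rw [opL_one_apply, Pred, Finset.sum_filter]
      refine Finset.sum_congr rfl fun j _ => ?_
      simp only [Set.indicator_apply, Set.mem_ofPred_eq]
    simp_rw [e1]
    rw [lintegral_finsetSum, hν, lintegral_finsetSum_measure]
    · refine Finset.sum_congr rfl fun j _ => ?_
      rw [lintegral_map hf (measurable_mobiusR _), lintegral_withDensity_eq_lintegral_mul _ (hdm j)
        (hfm j), lintegral_indicator (hset j)]
      rfl
    · intro j _
      exact ((hdm j).mul (hfm j)).indicator (hset j)
  have hμν : μ = ν := by
    refine ext_of_forall_lintegral_eq_of_IsFiniteMeasure fun f => ?_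
    rw [hbc f, hνl _ (f.continuous.measurable.coe_nnreal_ennreal)]
  intro f hf
  rw [← hνl f hf, ← hμν]

end Schottky

lemma den_inv_mobiusR {g : SL2} {x : ℝ} (hx : den g x ≠ 0) :
    den g⁻¹ (mobiusR g x) ≠ 0 ∧ mobiusR g⁻¹ (mobiusR g x) = x := by
  constructor
  · have h := den_mul (g := g⁻¹) hx
    rw [inv_mul_cancel, den_one] at h
    exact left_ne_zero_of_mul (h ▸ one_ne_zero)
  · rw [← mobiusR_mul hx, inv_mul_cancel, mobiusR_one]

lemma List.exists_first_difference {α : Type*} : ∀ {w u : List α}, w.length = u.length → w ≠ u →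
    ∃ p c w' d u', c ≠ d ∧ w = p ++ c :: w' ∧ u = p ++ d :: u'
  | [], [], _, h => absurd rfl h
  | [], _ :: _, h, _ => by simp at h
  | _ :: _, [], h, _ => by simp at h
  | c :: w, d :: u, hl, hne => by
    by_cases hcd : c = d
    · subst hcd
      obtain ⟨p, c', w', d', u', h, h1, h2⟩ := List.exists_first_difference (w := w) (u := u)
        (by simpa using hl) (fun h => hne (by rw [h]))
      exact ⟨c :: p, c', w', d', u', h, by simp [h1], by simp [h2]⟩
    · exact ⟨[], c, w, d, u, hcd, rfl, rfl⟩

namespace Schottky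

variable {S : Schottky}

lemma one_le_span_div_gap (S : Schottky) : 1 ≤ S.span / S.gap := by
  rw [le_div_iff₀ S.gap_pos]; linarith [S.gap_le_one, S.one_le_span]

lemma words_dist_bounds {n : ℕ} {i k : Fin (2 * S.r)} {w : List (Fin (2 * S.r))}
    (hw : w ∈ S.Words n i) (hw' : w ∈ S.Words n k) {x y : ℝ} (hx : x ∈ S.Ireal i)
    (hy : y ∈ S.Ireal k) :
    |mobiusR (S.wprod w) x - mobiusR (S.wprod w) y| ≤
      S.span / S.gap * mobiusDerivR (S.wprod w) y * |x - y| ∧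
    mobiusDerivR (S.wprod w) y * |x - y| ≤
      S.span / S.gap * |mobiusR (S.wprod w) x - mobiusR (S.wprod w) y| := by
  have hK := S.one_le_span_div_gap
  have h := dist_sq_words hw hw' hx hy
  have d1 := distortion hw hw' hx hy
  have d2 := distortion hw' hw hy hx
  have p1 := words_deriv_pos hw hx
  have p2 := words_deriv_pos hw' hy
  set K := S.span / S.gap
  constructor
  · have h2 : (mobiusR (S.wprod w) x - mobiusR (S.wprod w) y) ^ 2 ≤
        (K * mobiusDerivR (S.wprod w) y * |x - y|) ^ 2 := by
      rw [h, mul_pow, mul_pow, sq_abs]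
      refine mul_le_mul_of_nonneg_right ?_ (sq_nonneg _)
      exact (mul_le_mul_of_nonneg_right d1 p2.le).trans (by rw [mul_assoc, ← sq])
    exact abs_le_of_sq_le_sq h2 (by positivity)
  · have h2 : (mobiusDerivR (S.wprod w) y * |x - y|) ^ 2 ≤
        (K * |mobiusR (S.wprod w) x - mobiusR (S.wprod w) y|) ^ 2 := by
      rw [mul_pow, mul_pow, sq_abs, sq_abs, h, ← mul_assoc]
      gcongr
      calc _ = mobiusDerivR (S.wprod w) y * mobiusDerivR (S.wprod w) y := by ring
        _ ≤ K ^ 2 * mobiusDerivR (S.wprod w) x * mobiusDerivR (S.wprod w) y := by gcongr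
        _ = _ := by ring
    exact (abs_le_of_sq_le_sq' h2 (by positivity)).2

lemma words_head {n : ℕ} {i c : Fin (2 * S.r)} {v : List (Fin (2 * S.r))}
    (hw : c :: v ∈ S.Words n i) {x : ℝ} (hx : x ∈ S.Ireal i) :
    mobiusR (S.wprod (c :: v)) x ∈ S.Ireal c := by
  induction n generalizing i v x with
  | zero => rw [mem_words_zero] at hw; simp at hw
  | succ n ih =>
    obtain ⟨j, hj, b, hb, he⟩ := mem_words_succ.1 hw
    rw [he, (words_succ_apply hj b hx).1]
    cases b with
    | nil =>
      simp at he
      rw [he.1]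
      simpa using S.g_mem hj hx
    | cons c' b' =>
      simp at he
      rw [← he.1] at hb ⊢
      exact ih hb (S.g_mem hj hx)

lemma words_split {m : ℕ} {i c : Fin (2 * S.r)} {p v : List (Fin (2 * S.r))}
    (hw : p ++ c :: v ∈ S.Words m i) :
    p ∈ S.Words p.length c ∧ c :: v ∈ S.Words (v.length + 1) i := by
  rw [mem_words_iff] at hw
  obtain ⟨h1, -, h3⟩ := hw
  unfold IsWord List.Chain' at h1
  rw [List.isChain_append] at h1
  constructor
  · rw [mem_words_iff]
    refine ⟨h1.1, rfl, fun x hx y hy => h1.2.2 x hx y (by simpa using hy)⟩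
  · rw [mem_words_iff]
    refine ⟨h1.2.1, by simp, fun x hx y hy => h3 x ?_ y hy⟩
    rw [List.getLast?_append]
    simp only [Option.mem_def] at hx
    simp [hx]

lemma kap_le (n : ℕ) : S.kap n ≤ S.kap 0 := by
  have h1 := S.gap_pos
  have h2 := S.one_le_span
  unfold kap
  have : (S.span / (S.span + S.gap / 2)) ^ n ≤ 1 := pow_le_one₀ (by positivity) (by
    rw [div_le_one (by positivity)]; linarith)
  rw [pow_zero]
  gcongr

/-- Distinct cylinders of the same generation are separated. -/
lemma words_sep {m : ℕ} {i k : Fin (2 * S.r)} {w u : List (Fin (2 * S.r))}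
    (hw : w ∈ S.Words m i) (hu : u ∈ S.Words m k) (hne : w ≠ u) {y z : ℝ} (hy : y ∈ S.Ireal i)
    (hz : z ∈ S.Ireal k) :
    S.gap / (S.span / S.gap * S.kap 0) * mobiusDerivR (S.wprod u) z ≤
      |mobiusR (S.wprod w) y - mobiusR (S.wprod u) z| := by
  have hK := S.one_le_span_div_gap
  have hg := S.gap_pos
  have hk := S.kap_pos 0
  obtain ⟨p, c, w', d, u', hcd, rfl, rfl⟩ := List.exists_first_difference
    ((mem_words_iff.1 hw).2.1.trans (mem_words_iff.1 hu).2.1.symm) hne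
  obtain ⟨hp1, hw1⟩ := words_split hw
  obtain ⟨hp2, hu1⟩ := words_split hu
  have a1 := words_head hw1 hy
  have a2 := words_head hu1 hz
  rw [wprod_append, wprod_append, mobiusR_mul (words_den hw1 hy), mobiusR_mul (words_den hu1 hz),
    mobiusDerivR_mul (words_den hu1 hz)]
  have b1 := (words_dist_bounds hp1 hp2 a1 a2).2
  have b2 := (words_contract hu1 hz).trans (kap_le _)
  have b3 := S.gap_le hcd (S.mem_Ireal.1 a1).le (S.mem_Ireal.1 a2).le
  have b4 := words_deriv_pos hp2 a2
  have b5 := mobiusDerivR_nonneg (S.wprod (d :: u')) z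
  set P := mobiusR (S.wprod (c :: w')) y
  set Q := mobiusR (S.wprod (d :: u')) z
  set K := S.span / S.gap
  have hK0 : 0 < K := by linarith
  rw [div_mul_eq_mul_div, div_le_iff₀ (by positivity)]
  calc _ = mobiusDerivR (S.wprod p) Q * S.gap * mobiusDerivR (S.wprod (d :: u')) z := by ring
    _ ≤ mobiusDerivR (S.wprod p) Q * |P - Q| * S.kap 0 := by gcongr
    _ ≤ (K * |mobiusR (S.wprod p) P - mobiusR (S.wprod p) Q|) * S.kap 0 := by gcongr
    _ = _ := by ring

/-- Stopping a word at a prescribed scale. -/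
lemma words_stop {n : ℕ} {i : Fin (2 * S.r)} {w : List (Fin (2 * S.r))}
    (hw : w ∈ S.Words n i) {y : ℝ} (hy : y ∈ S.Ireal i) {ρ : ℝ}
    (hρ1 : ρ ≤ 1) (hle : mobiusDerivR (S.wprod w) y ≤ ρ) :
    ∃ m k, ∃ u ∈ S.Words m k, ∃ z ∈ S.Ireal k,
      mobiusR (S.wprod u) z = mobiusR (S.wprod w) y ∧
      S.dC⁻¹ * ρ ≤ mobiusDerivR (S.wprod u) z ∧ mobiusDerivR (S.wprod u) z ≤ ρ := by
  have hC := S.one_le_dC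
  induction n generalizing i w y with
  | zero =>
    refine ⟨0, i, w, hw, y, hy, rfl, ?_, hle⟩
    rw [mem_words_zero] at hw
    subst hw
    rw [wprod_nil, mobiusDerivR_one]
    rw [inv_mul_le_iff₀ (by linarith)]
    linarith
  | succ n ih =>
    obtain ⟨j, hj, b, hb, rfl⟩ := mem_words_succ.1 hw
    obtain ⟨e1, e2⟩ := words_succ_apply hj b hy
    rcases le_or_gt (mobiusDerivR (S.wprod b) (mobiusR (S.g j) y)) ρ with h | h
    · rw [e1]
      exact ih hb (S.g_mem hj hy) h
    · refine ⟨n + 1, i, _, hw, y, hy, rfl, ?_, hle⟩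
      rw [e2, mul_comm]
      have := le_deriv hj hy
      have : 0 < mobiusDerivR (S.g j) y := mobiusDerivR_pos (S.g_den_ne hj hy)
      have := words_deriv_pos hb (S.g_mem hj hy)
      gcongr

namespace Conf

variable {δ : ℝ} {μ : Measure ℝ}

lemma ae_words (hμ : S.Conf δ μ) (n : ℕ) : ∀ᵐ x ∂μ, ∃ i, ∃ w ∈ S.Words n i, ∃ y ∈ S.Ireal i,
    mobiusR (S.wprod w) y = x := by
  set B : Set ℝ := ⋃ i, ⋃ w ∈ S.Words n i, {x | mobiusR (S.wprod w)⁻¹ x ∈ S.Ireal i ∧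
    den (S.wprod w)⁻¹ x ≠ 0} with hB
  have hBm : MeasurableSet B := by
    refine MeasurableSet.iUnion fun i => Finset.measurableSet_biUnion _ fun w _ => ?_
    refine (measurable_mobiusR _ (S.measurableSet_Ireal i)).inter ?_
    have : Measurable (den (S.wprod w)⁻¹) := by unfold den; fun_prop
    exact this (measurableSet_singleton (0 : ℝ)).compl
  have h0 : μ Bᶜ = 0 := by
    rw [← lintegral_indicator_one hBm.compl,
      hμ.inv n (measurable_one.indicator hBm.compl), ← lintegral_zero (μ := μ)]
    refine lintegral_congr_ae ?_
    filter_upwards [hμ.ae_mem] with x hx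
    refine Finset.sum_eq_zero fun w hw => ?_
    have hden := words_den hw (mem_idx hx)
    obtain ⟨h1, h2⟩ := den_inv_mobiusR hden
    have : mobiusR (S.wprod w) x ∈ B := by
      simp only [hB, Set.mem_iUnion]
      exact ⟨S.idx x, w, hw, by rw [h2]; exact mem_idx hx, h1⟩
    rw [Set.indicator_of_notMem (Set.notMem_compl_iff.2 this), mul_zero]
  have h1 : ∀ᵐ x ∂μ, x ∈ B := by rw [ae_iff]; exact h0
  filter_upwards [h1] with x hx
  simp only [hB, Set.mem_iUnion] at hx
  obtain ⟨i, w, hw, h2, h3⟩ := hx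
  exact ⟨i, w, hw, _, h2, by rw [← mobiusR_mul h3, mul_inv_cancel, mobiusR_one]⟩

lemma ae_stop (hμ : S.Conf δ μ) : ∀ᵐ x ∂μ, ∀ ρ : ℝ, 0 < ρ → ρ ≤ 1 →
    ∃ m k, ∃ u ∈ S.Words m k, ∃ z ∈ S.Ireal k, mobiusR (S.wprod u) z = x ∧
      S.dC⁻¹ * ρ ≤ mobiusDerivR (S.wprod u) z ∧ mobiusDerivR (S.wprod u) z ≤ ρ := by
  filter_upwards [ae_all_iff.2 hμ.ae_words] with x hx ρ h0 h1
  obtain ⟨n, hn⟩ := (S.tendsto_kap.eventually (gt_mem_nhds h0)).exists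
  obtain ⟨i, w, hw, y, hy, rfl⟩ := hx n
  exact words_stop hw hy h1 ((words_contract hw hy).trans hn.le)

end Conf

/-- A lower bound for the conformal measure of the intervals. -/
noncomputable def mlow (S : Schottky) (δ : ℝ) : ℝ := (S.dC ^ δ)⁻¹ ^ 2 / 2

lemma mlow_pos (S : Schottky) (δ : ℝ) : 0 < S.mlow δ := by
  have := S.one_le_dC
  unfold mlow; positivity

lemma Conf.mlow_le {δ : ℝ} {μ : Measure ℝ} (hδ : 0 ≤ δ) (hμ : S.Conf δ μ) (a : Fin (2 * S.r)) :
    ENNReal.ofReal (S.mlow δ) ≤ μ (S.Ireal a) := by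
  classical
  have := hμ.prob
  have hC := S.one_le_dC
  set c : ℝ := (S.dC ^ δ)⁻¹ with hc
  have hc1 : c ≤ 1 := inv_le_one_of_one_le₀ (Real.one_le_rpow hC hδ)
  have hc0 : 0 < c := by positivity
  have key : ∀ j, c * (1 - μ.real (S.Ireal (wordBar j))) ≤ μ.real (S.Ireal j) := by
    intro j
    rw [← probReal_compl_eq_one_sub (S.measurableSet_Ireal _)]
    have h1 : ENNReal.ofReal c * μ (S.Ireal (wordBar j))ᶜ ≤ μ (S.Ireal j) := by
      rw [← lintegral_indicator_one (S.measurableSet_Ireal j),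
        hμ.inv_one _ (measurable_one.indicator (S.measurableSet_Ireal j)),
        ← lintegral_indicator_const (S.measurableSet_Ireal _).compl]
      refine lintegral_mono_ae ?_
      filter_upwards [hμ.ae_mem] with x hx
      rw [Set.indicator_apply]
      split_ifs with h
      · have hj : S.idx x ≠ wordBar j := fun h' => h (by rw [← h']; exact mem_idx hx)
        rw [opL_one_apply]
        refine le_trans ?_ (Finset.single_le_sum (fun _ _ => zero_le) (mem_Pred.2 hj))
        rw [Set.indicator_of_mem (S.g_mem hj (mem_idx hx)), Pi.one_apply, mul_one]
        apply ENNReal.ofReal_le_ofReal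
        rw [hc, ← Real.inv_rpow (by linarith)]
        exact Real.rpow_le_rpow (by positivity) (le_deriv hj (mem_idx hx)) hδ
      · exact zero_le
    have h2 := ENNReal.toReal_mono (measure_ne_top _ _) h1
    rwa [ENNReal.toReal_mul, ENNReal.toReal_ofReal hc0.le] at h2
  have hdisj : ∀ j k : Fin (2 * S.r), j ≠ k →
      Disjoint (S.Ireal j) (S.Ireal k) := fun j k hjk =>
    Set.disjoint_left.2 fun x h1 h2 => hjk (S.Ireal_unique h1 h2)
  obtain ⟨k, hk1, hk2⟩ : ∃ k : Fin (2 * S.r), k ≠ a ∧ k ≠ wordBar a := by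
    have hr := S.two_le_r
    by_contra hcon
    push Not at hcon
    have : (Finset.univ : Finset (Fin (2 * S.r))) ⊆ {a, wordBar a} := by
      intro k _
      by_cases h : k = a
      · simp [h]
      · simp [hcon k h]
    have := (Finset.card_le_card this).trans Finset.card_le_two
    simp at this
    omega
  have htwo : ∀ k, k ≠ a → k ≠ wordBar a → μ.real (S.Ireal a) +
      μ.real (S.Ireal (wordBar a)) + μ.real (S.Ireal k) ≤ 1 := by
    intro k h1 h2
    rw [← measureReal_union (hdisj _ _ (wordBar_ne a).symm) (S.measurableSet_Ireal _),
      ← measureReal_union (Set.disjoint_union_left.2 ⟨hdisj _ _ h1.symm, hdisj _ _ h2.symm⟩)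
        (S.measurableSet_Ireal _)]
    exact measureReal_le_one
  have t1 := htwo k hk1 hk2
  have t2 := htwo (wordBar k) (fun h => hk2 (by rw [← h, wordBar_wordBar]))
    (fun h => hk1 (by rw [← wordBar_wordBar k, h, wordBar_wordBar]))
  have k1 := key a
  have k2 := key k
  rw [← ENNReal.ofReal_toReal (measure_ne_top μ (S.Ireal a))]
  apply ENNReal.ofReal_le_ofReal
  change S.mlow δ ≤ μ.real (S.Ireal a)
  unfold mlow
  rw [← hc]
  have p1 : 0 ≤ μ.real (S.Ireal a) := measureReal_nonneg
  have p2 : 0 ≤ μ.real (S.Ireal k) := measureReal_nonneg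
  set A := μ.real (S.Ireal a)
  set A' := μ.real (S.Ireal (wordBar a))
  set B := μ.real (S.Ireal k)
  set B' := μ.real (S.Ireal (wordBar k))
  have s1 : c * B ≤ A := by nlinarith
  have s2 : c * B' ≤ A := by nlinarith
  nlinarith

/-- Ahlfors regularity of conformal measures, uniformly in the measure. -/
lemma ahlfors (S : Schottky) {δ : ℝ} (hδ : 0 < δ) : ∃ a₁ a₂ τ₀ : ℝ, 0 < a₁ ∧ 0 < a₂ ∧ 0 < τ₀ ∧
    ∀ μ : Measure ℝ, S.Conf δ μ → ∀ᵐ x ∂μ, ∀ τ : ℝ, 0 < τ → τ ≤ τ₀ →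
      a₁ * τ ^ δ ≤ μ.real (Metric.ball x τ) ∧ μ.real (Metric.ball x τ) ≤ a₂ * τ ^ δ := by
  classical
  have hK := S.one_le_span_div_gap
  have hg := S.gap_pos
  have hs := S.one_le_span
  have hk := S.kap_pos 0
  have hC := S.one_le_dC
  have hm := S.mlow_pos δ
  set K := S.span / S.gap
  have hK0 : 0 < K := by linarith
  set b₁ : ℝ := 2 * K * S.span with hb₁
  set b₂ : ℝ := S.gap / (K * S.kap 0) * S.dC⁻¹ with hb₂
  have hb₁0 : 0 < b₁ := by positivity
  have hb₂0 : 0 < b₂ := by positivity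
  refine ⟨S.mlow δ * (S.dC⁻¹ * b₁⁻¹ / K ^ 2) ^ δ, (K ^ 2 * b₂⁻¹) ^ δ, min b₁ b₂, by positivity,
    by positivity, by positivity, fun μ hμ => ?_⟩
  have := hμ.prob
  filter_upwards [hμ.ae_stop] with x hx τ h0 hτ
  constructor
  · obtain ⟨m, k, u, hu, z, hz, rfl, hl, hr⟩ := hx (b₁⁻¹ * τ) (by positivity) (by
      rw [inv_mul_le_iff₀ hb₁0]; linarith [min_le_left b₁ b₂])
    rw [mul_assoc, ← Real.mul_rpow (by positivity) h0.le]
    have h1 : ENNReal.ofReal ((S.dC⁻¹ * b₁⁻¹ / K ^ 2 * τ) ^ δ) * μ (S.Ireal k) ≤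
        μ (Metric.ball (mobiusR (S.wprod u) z) τ) := by
      rw [← lintegral_indicator_one measurableSet_ball,
        hμ.inv m (measurable_one.indicator measurableSet_ball),
        ← lintegral_indicator_const (S.measurableSet_Ireal _)]
      refine lintegral_mono fun x => ?_
      rw [Set.indicator_apply]
      split_ifs with h
      · have hi := idx_eq h
        unfold opL
        rw [hi]
        refine le_trans ?_ (Finset.single_le_sum (fun _ _ => zero_le) hu)
        rw [Set.indicator_of_mem, Pi.one_apply, mul_one]
        · apply ENNReal.ofReal_le_ofReal
          refine Real.rpow_le_rpow (by positivity) ?_ hδ.le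
          have h2 := distortion hu hu hz h
          rw [div_mul_eq_mul_div, div_le_iff₀ (by positivity)]
          calc _ = S.dC⁻¹ * (b₁⁻¹ * τ) := by ring
            _ ≤ _ := hl.trans h2
            _ = _ := by ring
        · rw [Metric.mem_ball, Real.dist_eq]
          have h2 := (words_dist_bounds hu hu h hz).1
          have h3 := S.le_span (S.mem_Ireal.1 h).le (S.mem_Ireal.1 hz).le
          calc _ ≤ _ := h2
            _ ≤ K * (b₁⁻¹ * τ) * S.span := by
              have := mobiusDerivR_nonneg (S.wprod u) z
              gcongr
            _ = τ / 2 := by rw [hb₁]; field_simp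
            _ < τ := by linarith
      · exact zero_le
    have h2 := ENNReal.toReal_mono (measure_ne_top _ _) h1
    rw [ENNReal.toReal_mul, ENNReal.toReal_ofReal (by positivity)] at h2
    refine le_trans ?_ h2
    rw [mul_comm]
    gcongr
    have := ENNReal.toReal_mono (measure_ne_top _ _) (hμ.mlow_le hδ.le k)
    rwa [ENNReal.toReal_ofReal hm.le] at this
  · obtain ⟨m, k, u, hu, z, hz, rfl, hl, hr⟩ := hx (b₂⁻¹ * τ) (by positivity) (by
      rw [inv_mul_le_iff₀ hb₂0]; linarith [min_le_right b₁ b₂])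
    rw [← Real.mul_rpow (by positivity) h0.le]
    have h1 : μ (Metric.ball (mobiusR (S.wprod u) z) τ) ≤
        ENNReal.ofReal ((K ^ 2 * b₂⁻¹ * τ) ^ δ) := by
      rw [← lintegral_indicator_one measurableSet_ball,
        hμ.inv m (measurable_one.indicator measurableSet_ball)]
      have : ENNReal.ofReal ((K ^ 2 * b₂⁻¹ * τ) ^ δ) =
          ∫⁻ _, ENNReal.ofReal ((K ^ 2 * b₂⁻¹ * τ) ^ δ) ∂μ := by simp
      rw [this]
      refine lintegral_mono_ae ?_
      filter_upwards [hμ.ae_mem] with y hy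
      have hyi := mem_idx hy
      have hother : ∀ w ∈ S.Words m (S.idx y), w ≠ u →
          ENNReal.ofReal (mobiusDerivR (S.wprod w) y ^ δ) *
            (Metric.ball (mobiusR (S.wprod u) z) τ).indicator 1 (mobiusR (S.wprod w) y) = 0 := by
        intro w hw hne
        rw [Set.indicator_of_notMem, mul_zero]
        rw [Metric.mem_ball, Real.dist_eq, not_lt]
        refine le_trans ?_ (words_sep hw hu hne hyi hz)
        calc τ = S.gap / (K * S.kap 0) * (S.dC⁻¹ * (b₂⁻¹ * τ)) := by rw [hb₂]; field_simp
          _ ≤ _ := by gcongr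
      unfold opL
      by_cases hmem : u ∈ S.Words m (S.idx y)
      · rw [Finset.sum_eq_single u (fun w hw hne => hother w hw hne) (fun h => absurd hmem h)]
        refine (mul_le_of_le_one_right zero_le ?_).trans (ENNReal.ofReal_le_ofReal ?_)
        · exact Set.indicator_le (fun _ _ => le_rfl) _ |>.trans (by simp)
        · refine Real.rpow_le_rpow (mobiusDerivR_nonneg _ _) ?_ hδ.le
          refine (distortion hmem hu hyi hz).trans ?_
          rw [mul_assoc]
          gcongr
      · rw [Finset.sum_eq_zero]
        · exact zero_le
        · intro w hw
          exact hother w hw (fun h => hmem (h ▸ hw))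
    have h2 := ENNReal.toReal_mono ENNReal.ofReal_ne_top h1
    rwa [ENNReal.toReal_ofReal (by positivity)] at h2

end Schottky

namespace Schottky

variable {S : Schottky}

/-- The kernel `|x - z| ^ (-2δ)` restricted to `z ∉ I_i`. -/
noncomputable def ker (S : Schottky) (δ : ℝ) (i : Fin (2 * S.r)) (x z : ℝ) : ENNReal :=
  (S.Ireal i)ᶜ.indicator (fun z => ENNReal.ofReal (|x - z| ^ (-(2 * δ)))) z

/-- The Patterson–Sullivan eigenfunction of the transfer operator. -/
noncomputable def eigE (S : Schottky) (δ : ℝ) (μ : Measure ℝ) (x : ℝ) : ENNReal :=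
  ∫⁻ z, S.ker δ (S.idx x) x z ∂μ

lemma measurable_ker (δ : ℝ) (i : Fin (2 * S.r)) :
    Measurable (Function.uncurry (S.ker δ i)) := by
  have : Function.uncurry (S.ker δ i) = (Set.univ ×ˢ (S.Ireal i)ᶜ).indicator
      (fun p : ℝ × ℝ => ENNReal.ofReal (|p.1 - p.2| ^ (-(2 * δ)))) := by
    ext ⟨x, z⟩
    by_cases h : z ∈ S.Ireal i <;> simp [ker, h, Set.indicator]
  rw [this]
  refine Measurable.indicator ?_ (MeasurableSet.univ.prod (S.measurableSet_Ireal i).compl)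
  have h1 : Measurable fun p : ℝ × ℝ => |p.1 - p.2| := by fun_prop
  exact (h1.pow_const _).ennreal_ofReal

lemma measurable_ker_right (δ : ℝ) (i : Fin (2 * S.r)) (x : ℝ) : Measurable (S.ker δ i x) :=
  (measurable_ker δ i).of_uncurry_left

lemma measurable_eigE (δ : ℝ) (μ : Measure ℝ) [SFinite μ] : Measurable (S.eigE δ μ) :=
  S.measurable_of_idx (F := fun i x => ∫⁻ z, S.ker δ i x z ∂μ)
    fun i => (measurable_ker δ i).lintegral_prod_right'

lemma ker_mobius {δ : ℝ} {i k m : Fin (2 * S.r)} {x z : ℝ} (hx : x ∈ S.Ireal i)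
    (hz : z ∈ S.Ireal k) (hmk : k ≠ wordBar m) (him : i ≠ m) :
    ENNReal.ofReal (mobiusDerivR (S.g m) z ^ δ) *
      ENNReal.ofReal (|x - mobiusR (S.g m) z| ^ (-(2 * δ))) =
    ENNReal.ofReal (mobiusDerivR (S.g (wordBar m)) x ^ δ) *
      ENNReal.ofReal (|mobiusR (S.g (wordBar m)) x - z| ^ (-(2 * δ))) := by
  have him' : i ≠ wordBar (wordBar m) := by rwa [wordBar_wordBar]
  have hd1 : den (S.g m) z ≠ 0 := S.g_den_ne hmk hz
  have hd2 : den (S.g (wordBar m)) x ≠ 0 := S.g_den_ne him' hx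
  have hp1 := mobiusDerivR_pos hd1
  have hp2 := mobiusDerivR_pos hd2
  rw [← ENNReal.ofReal_mul (by positivity), ← ENNReal.ofReal_mul (by positivity)]
  congr 1
  have hy := S.g_mem him' hx
  set y := mobiusR (S.g (wordBar m)) x with hydef
  have hg : (S.g m) = (S.g (wordBar m))⁻¹ := by rw [S.g_bar, inv_inv]
  obtain ⟨hd3, hyx⟩ := den_inv_mobiusR hd2
  rw [← hg, ← hydef] at hd3 hyx
  have hder : mobiusDerivR (S.g m) y * mobiusDerivR (S.g (wordBar m)) x = 1 := by
    have := mobiusDerivR_mul (g := S.g m) hd2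
    rw [hg, inv_mul_cancel, mobiusDerivR_one, ← hydef, ← hg] at this
    exact this.symm
  have hyz : y ≠ z := by
    rintro rfl
    exact hmk (S.Ireal_unique hz hy)
  have hsq : (x - mobiusR (S.g m) z) ^ 2 =
      mobiusDerivR (S.g m) y * mobiusDerivR (S.g m) z * (y - z) ^ 2 := by
    conv_lhs => rw [← hyx]
    exact mobiusR_sub_sq hd3 hd1
  have e : ∀ u : ℝ, |u| ^ (-(2 * δ)) = (u ^ 2) ^ (-δ) := by
    intro u
    rw [← sq_abs, ← Real.rpow_natCast, ← Real.rpow_mul (abs_nonneg _)]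
    congr 1; push_cast; ring
  have hp3 : 0 < mobiusDerivR (S.g m) y := mobiusDerivR_pos hd3
  rw [e, e, hsq, Real.mul_rpow (by positivity) (by positivity),
    Real.mul_rpow (by positivity) (by positivity), eq_inv_of_mul_eq_one_left hder,
    Real.inv_rpow (by positivity), Real.rpow_neg hp2.le, inv_inv, Real.rpow_neg hp1.le]
  have : mobiusDerivR (S.g m) z ^ δ ≠ 0 := by positivity
  field_simp

lemma Conf.eigE_one {δ : ℝ} {μ : Measure ℝ} (hμ : S.Conf δ μ) {x : ℝ} (hx : x ∈ S.Iall) :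
    S.opL δ 1 (S.eigE δ μ) x = S.eigE δ μ x := by
  classical
  have hi := mem_idx hx
  set i := S.idx x
  conv_rhs => rw [eigE, hμ.inv_one _ (measurable_ker_right δ _ x)]
  rw [opL_one_apply]
  have h1 : ∀ j ∈ S.Pred i, ENNReal.ofReal (mobiusDerivR (S.g j) x ^ δ) *
      S.eigE δ μ (mobiusR (S.g j) x) = ∫⁻ z, ENNReal.ofReal (mobiusDerivR (S.g j) x ^ δ) *
        S.ker δ j (mobiusR (S.g j) x) z ∂μ := by
    intro j hj
    rw [lintegral_const_mul _ (measurable_ker_right _ _ _), eigE, idx_g hx hj]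
  rw [Finset.sum_congr rfl h1, ← lintegral_finsetSum _
    (fun j _ => (measurable_ker_right _ _ _).const_mul _)]
  refine lintegral_congr_ae ?_
  filter_upwards [hμ.ae_mem] with z hz
  have hk := mem_idx hz
  rw [opL_one_apply]
  set k := S.idx z
  have e1 : ∀ j, (if j ∈ S.Pred i then ENNReal.ofReal (mobiusDerivR (S.g j) x ^ δ) *
        S.ker δ j (mobiusR (S.g j) x) z else 0) =
      if wordBar j ∈ S.Pred k then ENNReal.ofReal (mobiusDerivR (S.g (wordBar j)) z ^ δ) *
        S.ker δ i x (mobiusR (S.g (wordBar j)) z) else 0 := by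
    intro j
    simp only [mem_Pred, wordBar_wordBar]
    by_cases h1 : k = j
    · subst h1
      simp [ker, hk]
    by_cases h2 : i = wordBar j
    · have h3 : mobiusR (S.g (wordBar j)) z ∈ S.Ireal i := by
        rw [h2]; exact S.g_mem (by rwa [wordBar_wordBar]) hk
      have h4 : S.ker δ i x (mobiusR (S.g (wordBar j)) z) = 0 :=
        Set.indicator_of_notMem (Set.notMem_compl_iff.2 h3) _
      rw [h4, mul_zero, ite_self, if_neg (not_not_intro h2)]
    · rw [if_pos h2, if_pos h1]
      have h3 : mobiusR (S.g (wordBar j)) z ∈ (S.Ireal i)ᶜ := fun h =>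
        h2 (S.Ireal_unique h (S.g_mem (by rwa [wordBar_wordBar]) hk))
      have h4 : z ∈ (S.Ireal j)ᶜ := fun h => h1 (S.Ireal_unique hk h)
      have := ker_mobius (δ := δ) (m := wordBar j) hi hk (by rwa [wordBar_wordBar]) h2
      rw [wordBar_wordBar] at this
      rw [ker, ker, Set.indicator_of_mem h3, Set.indicator_of_mem h4, this]
  have e2 : ∀ (P : Finset (Fin (2 * S.r))) (f : Fin (2 * S.r) → ENNReal),
      ∑ j ∈ P, f j = ∑ j, if j ∈ P then f j else 0 := by
    intro P f
    rw [← Finset.sum_filter]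
    congr 1
    ext; simp
  rw [e2 (S.Pred i), e2 (S.Pred k), Finset.sum_congr rfl (fun j _ => e1 j)]
  exact Fintype.sum_equiv (Function.Involutive.toPerm wordBar wordBar_wordBar) _ _ (fun _ => rfl)

lemma opL_congr {δ : ℝ} {n : ℕ} {f f' : ℝ → ENNReal} (h : ∀ x ∈ S.Iall, f x = f' x) {x : ℝ}
    (hx : x ∈ S.Iall) : S.opL δ n f x = S.opL δ n f' x :=
  Finset.sum_congr rfl fun w hw => by rw [h _ (words_mem_Iall hw (mem_idx hx))]

lemma Conf.opL_eigE {δ : ℝ} {μ : Measure ℝ} (hμ : S.Conf δ μ) (n : ℕ) {x : ℝ}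
    (hx : x ∈ S.Iall) : S.opL δ n (S.eigE δ μ) x = S.eigE δ μ x := by
  induction n generalizing x with
  | zero =>
    have : S.Words 0 (S.idx x) = {[]} := rfl
    simp [opL, this, wprod_nil]
  | succ n ih => rw [opL_succ _ _ _ hx, opL_congr (fun y hy => ih hy) hx, hμ.eigE_one hx]

/-- Uniform lower bound of the eigenfunction. -/
noncomputable def eigLow (S : Schottky) (δ : ℝ) : ℝ := S.span ^ (-(2 * δ)) * S.mlow δ

/-- Uniform upper bound of the eigenfunction. -/
noncomputable def eigUp (S : Schottky) (δ : ℝ) : ℝ := S.gap ^ (-(2 * δ))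

lemma eigLow_pos (S : Schottky) (δ : ℝ) : 0 < S.eigLow δ := by
  have := S.one_le_span
  have := S.mlow_pos δ
  unfold eigLow; positivity

lemma eigUp_pos (S : Schottky) (δ : ℝ) : 0 < S.eigUp δ := by
  have := S.gap_pos
  unfold eigUp; positivity

lemma Conf.eigE_bounds {δ : ℝ} (hδ : 0 ≤ δ) {μ : Measure ℝ} (hμ : S.Conf δ μ) {x : ℝ}
    (hx : x ∈ S.Iall) : ENNReal.ofReal (S.eigLow δ) ≤ S.eigE δ μ x ∧
      S.eigE δ μ x ≤ ENNReal.ofReal (S.eigUp δ) := by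
  have := hμ.prob
  have hs := S.one_le_span
  have hg := S.gap_pos
  have hi := mem_idx hx
  constructor
  · have h1 := hμ.mlow_le hδ (wordBar (S.idx x))
    rw [eigLow, ENNReal.ofReal_mul (by positivity)]
    refine (mul_le_mul' le_rfl h1).trans ?_
    rw [← lintegral_indicator_const (S.measurableSet_Ireal _), eigE]
    refine lintegral_mono fun z => Set.indicator_le' (fun z hz => ?_) (fun _ _ => zero_le) z
    have hz' : z ∈ (S.Ireal (S.idx x))ᶜ := fun h => wordBar_ne _ (S.Ireal_unique hz h)
    have h2 := S.gap_le (wordBar_ne (S.idx x)).symm (S.mem_Ireal.1 hi).le (S.mem_Ireal.1 hz).le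
    rw [ker, Set.indicator_of_mem hz']
    apply ENNReal.ofReal_le_ofReal
    exact Real.rpow_le_rpow_of_nonpos (by linarith)
      (S.le_span (S.mem_Ireal.1 hi).le (S.mem_Ireal.1 hz).le) (by linarith)
  · have : ENNReal.ofReal (S.eigUp δ) = ∫⁻ _, ENNReal.ofReal (S.eigUp δ) ∂μ := by simp
    rw [this, eigE]
    refine lintegral_mono_ae ?_
    filter_upwards [hμ.ae_mem] with z hz
    by_cases hzi : z ∈ S.Ireal (S.idx x)
    · simp [ker, hzi]
    have hz' : z ∈ (S.Ireal (S.idx x))ᶜ := hzi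
    have hzk := mem_idx hz
    have hne : S.idx x ≠ S.idx z := fun h => hzi (h ▸ hzk)
    rw [ker, Set.indicator_of_mem hz']
    apply ENNReal.ofReal_le_ofReal
    exact Real.rpow_le_rpow_of_nonpos hg
      (S.gap_le hne (S.mem_Ireal.1 hi).le (S.mem_Ireal.1 hzk).le) (by linarith)

/-- The logarithmic Lipschitz constant of the eigenfunction. -/
noncomputable def eigLip (S : Schottky) (δ : ℝ) : ℝ := 2 * δ / S.gap

lemma Conf.eigE_lip {δ : ℝ} (hδ : 0 ≤ δ) {μ : Measure ℝ} (hμ : S.Conf δ μ) {i : Fin (2 * S.r)}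
    {x y : ℝ} (hx : x ∈ S.Ireal i) (hy : y ∈ S.Ireal i) :
    S.eigE δ μ x ≤ ENNReal.ofReal (Real.exp (S.eigLip δ * |x - y|)) * S.eigE δ μ y := by
  have hg := S.gap_pos
  rw [eigE, eigE, idx_eq hx, idx_eq hy, ← lintegral_const_mul _ (measurable_ker_right _ _ _)]
  refine lintegral_mono_ae ?_
  filter_upwards [hμ.ae_mem] with z hz
  by_cases hzi : z ∈ S.Ireal i
  · simp [ker, hzi]
  have hz' : z ∈ (S.Ireal i)ᶜ := hzi
  rw [ker, ker, Set.indicator_of_mem hz', Set.indicator_of_mem hz',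
    ← ENNReal.ofReal_mul (Real.exp_pos _).le]
  apply ENNReal.ofReal_le_ofReal
  have hzk := mem_idx hz
  have hne : i ≠ S.idx z := fun h => hzi (h ▸ hzk)
  have g1 := S.gap_le hne (S.mem_Ireal.1 hx).le (S.mem_Ireal.1 hzk).le
  have g2 := S.gap_le hne (S.mem_Ireal.1 hy).le (S.mem_Ireal.1 hzk).le
  have h1 : |y - z| ≤ Real.exp (|x - y| / S.gap) * |x - z| := by
    have t1 : |y - z| ≤ |x - y| + |x - z| := by
      have := abs_sub_le y x z
      rwa [abs_sub_comm y x] at this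
    have t2 := Real.add_one_le_exp (|x - y| / S.gap)
    have t3 : |x - y| ≤ |x - y| / S.gap * |x - z| := by
      rw [div_mul_eq_mul_div, le_div_iff₀ hg]
      gcongr
    nlinarith [abs_nonneg (x - z)]
  have h2 := Real.rpow_le_rpow_of_nonpos (by linarith) h1 (z := -(2 * δ)) (by linarith)
  rw [Real.mul_rpow (Real.exp_pos _).le (abs_nonneg _), ← Real.exp_mul] at h2
  calc |x - z| ^ (-(2 * δ)) = Real.exp (S.eigLip δ * |x - y|) *
        (Real.exp (|x - y| / S.gap * -(2 * δ)) * |x - z| ^ (-(2 * δ))) := by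
        rw [← mul_assoc, ← Real.exp_add]
        have : S.eigLip δ * |x - y| + |x - y| / S.gap * -(2 * δ) = 0 := by
          unfold eigLip; ring
        rw [this, Real.exp_zero, one_mul]
    _ ≤ _ := by gcongr

/-- The Patterson–Sullivan eigenfunction, as a real function. -/
noncomputable def eig (S : Schottky) (δ : ℝ) (μ : Measure ℝ) (x : ℝ) : ℝ := (S.eigE δ μ x).toReal

namespace Conf

variable {δ : ℝ} {μ : Measure ℝ}

lemma ofReal_eig (hδ : 0 ≤ δ) (hμ : S.Conf δ μ) {x : ℝ} (hx : x ∈ S.Iall) :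
    ENNReal.ofReal (S.eig δ μ x) = S.eigE δ μ x :=
  ENNReal.ofReal_toReal (ne_top_of_le_ne_top ENNReal.ofReal_ne_top (hμ.eigE_bounds hδ hx).2)

lemma eig_bounds (hδ : 0 ≤ δ) (hμ : S.Conf δ μ) {x : ℝ} (hx : x ∈ S.Iall) :
    S.eigLow δ ≤ S.eig δ μ x ∧ S.eig δ μ x ≤ S.eigUp δ := by
  obtain ⟨h1, h2⟩ := hμ.eigE_bounds hδ hx
  rw [← hμ.ofReal_eig hδ hx] at h1 h2
  exact ⟨(ENNReal.ofReal_le_ofReal_iff ENNReal.toReal_nonneg).1 h1,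
    (ENNReal.ofReal_le_ofReal_iff (S.eigUp_pos δ).le).1 h2⟩

lemma eig_lip (hδ : 0 ≤ δ) (hμ : S.Conf δ μ) {i : Fin (2 * S.r)} {x y : ℝ} (hx : x ∈ S.Ireal i)
    (hy : y ∈ S.Ireal i) :
    S.eig δ μ x ≤ Real.exp (S.eigLip δ * |x - y|) * S.eig δ μ y := by
  have h := hμ.eigE_lip hδ hx hy
  rw [← hμ.ofReal_eig hδ (S.mem_Iall.2 ⟨i, hx⟩), ← hμ.ofReal_eig hδ (S.mem_Iall.2 ⟨i, hy⟩),
    ← ENNReal.ofReal_mul (Real.exp_pos _).le] at h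
  exact (ENNReal.ofReal_le_ofReal_iff (mul_nonneg (Real.exp_pos _).le ENNReal.toReal_nonneg)).1 h

lemma eig_sum (hδ : 0 ≤ δ) (hμ : S.Conf δ μ) (n : ℕ) {i : Fin (2 * S.r)} {x : ℝ}
    (hx : x ∈ S.Ireal i) :
    ∑ w ∈ S.Words n i, mobiusDerivR (S.wprod w) x ^ δ * S.eig δ μ (mobiusR (S.wprod w) x) =
      S.eig δ μ x := by
  have hxI := S.mem_Iall.2 ⟨i, hx⟩
  have h := hμ.opL_eigE n hxI
  have hnn : ∀ w ∈ S.Words n i,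
      0 ≤ mobiusDerivR (S.wprod w) x ^ δ * S.eig δ μ (mobiusR (S.wprod w) x) := fun w hw =>
    mul_nonneg (Real.rpow_nonneg (mobiusDerivR_nonneg _ _) _) ENNReal.toReal_nonneg
  rw [opL, idx_eq hx] at h
  rw [eig, ← h, ← ENNReal.toReal_ofReal (Finset.sum_nonneg hnn), ENNReal.ofReal_sum_of_nonneg hnn]
  congr 1
  refine Finset.sum_congr rfl fun w hw => ?_
  rw [ENNReal.ofReal_mul (Real.rpow_nonneg (mobiusDerivR_nonneg _ _) _),
    hμ.ofReal_eig hδ (words_mem_Iall hw hx)]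

end Conf

end Schottky

namespace Schottky

variable {S : Schottky}

lemma continuousOn_Iall {E : Type*} [TopologicalSpace E] {f : ℝ → E}
    (h : ∀ i, ContinuousOn f (S.Ireal i)) : ContinuousOn f S.Iall :=
  ContinuousOn.iUnion_of_isOpen h S.isOpen_Ireal

lemma continuousOn_idx {E : Type*} [TopologicalSpace E] {F : Fin (2 * S.r) → ℝ → E}
    (h : ∀ i, ContinuousOn (F i) (S.Ireal i)) : ContinuousOn (fun x => F (S.idx x) x) S.Iall :=
  continuousOn_Iall fun i => (h i).congr fun x hx => by rw [idx_eq hx]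

lemma continuousOn_comp_word {E : Type*} [TopologicalSpace E] {f : ℝ → E}
    (hf : ContinuousOn f S.Iall) {n : ℕ} {i : Fin (2 * S.r)} {w : List (Fin (2 * S.r))}
    (hw : w ∈ S.Words n i) : ContinuousOn (fun x => f (mobiusR (S.wprod w) x)) (S.Ireal i) :=
  hf.comp (fun _ hx => (continuousAt_mobiusR (words_den hw hx)).continuousWithinAt)
    fun _ hx => words_mem_Iall hw hx

lemma continuousOn_deriv_word {n : ℕ} {i : Fin (2 * S.r)} {w : List (Fin (2 * S.r))}
    (hw : w ∈ S.Words n i) : ContinuousOn (mobiusDerivR (S.wprod w)) (S.Ireal i) :=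
  fun _ hx => (continuousAt_mobiusDerivR (words_den hw hx)).continuousWithinAt

/-- Continuous and bounded on the union of the intervals. -/
def Nice (S : Schottky) (f : ℝ → ℝ) : Prop :=
  ContinuousOn f S.Iall ∧ ∃ C, ∀ x ∈ S.Iall, |f x| ≤ C

lemma ae_mem_of_null {ν : Measure ℝ} (h : ν S.Iallᶜ = 0) : ∀ᵐ x ∂ν, x ∈ S.Iall := by
  rwa [ae_iff]

lemma Nice.aestronglyMeasurable {f : ℝ → ℝ} (hf : S.Nice f) {ν : Measure ℝ}
    (h : ν S.Iallᶜ = 0) : AEStronglyMeasurable f ν := by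
  rw [← Measure.restrict_eq_self_of_ae_mem (ae_mem_of_null h)]
  exact hf.1.aestronglyMeasurable S.measurableSet_Iall

lemma Nice.integrable {f : ℝ → ℝ} (hf : S.Nice f) {ν : Measure ℝ} [IsFiniteMeasure ν]
    (h : ν S.Iallᶜ = 0) : Integrable f ν := by
  obtain ⟨C, hC⟩ := hf.2
  refine Integrable.of_bound (hf.aestronglyMeasurable h) C ?_
  filter_upwards [ae_mem_of_null h] with x hx using hC x hx

lemma Nice.congr {f g : ℝ → ℝ} (hf : S.Nice f) (h : ∀ x ∈ S.Iall, g x = f x) : S.Nice g :=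
  ⟨hf.1.congr h, hf.2.imp fun _ hC x hx => by rw [h x hx]; exact hC x hx⟩

lemma nice_const (S : Schottky) (c : ℝ) : S.Nice fun _ => c :=
  ⟨continuousOn_const, |c|, fun _ _ => le_rfl⟩

lemma Nice.add {f g : ℝ → ℝ} (hf : S.Nice f) (hg : S.Nice g) : S.Nice fun x => f x + g x := by
  obtain ⟨hf1, C, hC⟩ := hf
  obtain ⟨hg1, D, hD⟩ := hg
  exact ⟨hf1.add hg1, C + D, fun x hx => (abs_add_le _ _).trans (add_le_add (hC x hx) (hD x hx))⟩

lemma Nice.mul {f g : ℝ → ℝ} (hf : S.Nice f) (hg : S.Nice g) : S.Nice fun x => f x * g x := by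
  obtain ⟨hf1, C, hC⟩ := hf
  obtain ⟨hg1, D, hD⟩ := hg
  refine ⟨hf1.mul hg1, C * D, fun x hx => ?_⟩
  rw [abs_mul]
  exact mul_le_mul (hC x hx) (hD x hx) (abs_nonneg _) ((abs_nonneg _).trans (hC x hx))

lemma Nice.pow {f : ℝ → ℝ} (hf : S.Nice f) : S.Nice fun x => f x ^ 2 := by
  simpa only [sq] using hf.mul hf

lemma nice_norm {V : Type*} [NormedAddCommGroup V] {G : ℝ → V} (hG : ContinuousOn G S.Iall)
    {C : ℝ} (hC : ∀ x ∈ S.Iall, ‖G x‖ ≤ C) : S.Nice fun x => ‖G x‖ :=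
  ⟨hG.norm, C, fun x hx => by rw [abs_norm]; exact hC x hx⟩

/-- The averaging operator with weights `W`. -/
noncomputable def avg (S : Schottky) (W : List (Fin (2 * S.r)) → ℝ → ℝ) (n : ℕ) (f : ℝ → ℝ)
    (x : ℝ) : ℝ := ∑ w ∈ S.Words n (S.idx x), W w x * f (mobiusR (S.wprod w) x)

/-- A measure with a compatible system of probabilistic weights, regular at small scales. -/
structure Gibbs (S : Schottky) (C c₃ c₁ B τ₀ m₁ : ℝ) (ν : Measure ℝ)
    (W : List (Fin (2 * S.r)) → ℝ → ℝ) : Prop where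
  fin : IsFiniteMeasure ν
  mass : ν.real Set.univ ≤ m₁
  null : ν S.Iallᶜ = 0
  cont : ∀ n i, ∀ w ∈ S.Words n i, ContinuousOn (W w) (S.Ireal i)
  pos : ∀ n i, ∀ w ∈ S.Words n i, ∀ x ∈ S.Ireal i, 0 < W w x
  sum_one : ∀ n i, ∀ x ∈ S.Ireal i, ∑ w ∈ S.Words n i, W w x = 1
  lip : ∀ n i, ∀ w ∈ S.Words n i, ∀ x ∈ S.Ireal i, ∀ y ∈ S.Ireal i,
    W w x ≤ Real.exp (C * |x - y|) * W w y
  inv : ∀ n f, S.Nice f → (∀ x ∈ S.Iall, 0 ≤ f x) → ∫ x, S.avg W n f x ∂ν = ∫ x, f x ∂ν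
  spread : ∀ n i, ∀ x ∈ S.Ireal i, ∀ j : Fin (2 * S.r),
    c₃ ≤ ∑ w ∈ (S.Words (n + 1) i).filter (fun w => w.getLast? ≠ some j), W w x
  ann : ∀ τ : ℝ, 0 < τ → τ ≤ τ₀ → ∃ m, 0 < m ∧ ∀ᵐ x ∂ν,
    m ≤ ν.real {y | c₁ * τ ≤ |x - y| ∧ |x - y| < τ} ∧
      ν.real {y | c₁ * τ ≤ |x - y| ∧ |x - y| < τ} ≤ B * m

lemma nice_avg {W : List (Fin (2 * S.r)) → ℝ → ℝ} {n : ℕ}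
    (cont : ∀ i, ∀ w ∈ S.Words n i, ContinuousOn (W w) (S.Ireal i))
    (pos : ∀ i, ∀ w ∈ S.Words n i, ∀ x ∈ S.Ireal i, 0 < W w x)
    (sum_one : ∀ i, ∀ x ∈ S.Ireal i, ∑ w ∈ S.Words n i, W w x = 1) {f : ℝ → ℝ}
    (hf : S.Nice f) : S.Nice (S.avg W n f) := by
  obtain ⟨hf1, C, hC⟩ := hf
  refine ⟨continuousOn_idx (F := fun i x => ∑ w ∈ S.Words n i, W w x * f (mobiusR (S.wprod w) x))
    fun i => continuousOn_finsetSum _ fun w hw =>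
      (cont i w hw).mul (continuousOn_comp_word hf1 hw), C, fun x hx => ?_⟩
  have hi := mem_idx hx
  calc _ ≤ ∑ w ∈ S.Words n (S.idx x), |W w x * f (mobiusR (S.wprod w) x)| :=
        Finset.abs_sum_le_sum_abs _ _
    _ ≤ ∑ w ∈ S.Words n (S.idx x), W w x * C := by
        refine Finset.sum_le_sum fun w hw => ?_
        rw [abs_mul, abs_of_pos (pos _ w hw x hi)]
        exact mul_le_mul_of_nonneg_left (hC _ (words_mem_Iall hw hi)) (pos _ w hw x hi).le
    _ = C := by rw [← Finset.sum_mul, sum_one _ _ hi, one_mul]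

lemma Gibbs.nice_avg {C c₃ c₁ B τ₀ m₁ : ℝ} {ν : Measure ℝ} {W : List (Fin (2 * S.r)) → ℝ → ℝ}
    (h : S.Gibbs C c₃ c₁ B τ₀ m₁ ν W) (n : ℕ) {f : ℝ → ℝ} (hf : S.Nice f) :
    S.Nice (S.avg W n f) :=
  Schottky.nice_avg (h.cont n) (h.pos n) (h.sum_one n) hf

/-- The normalised weights. -/
noncomputable def wt (S : Schottky) (δ : ℝ) (μ : Measure ℝ) (w : List (Fin (2 * S.r)))
    (x : ℝ) : ℝ :=
  mobiusDerivR (S.wprod w) x ^ δ * S.eig δ μ (mobiusR (S.wprod w) x) / S.eig δ μ x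

namespace Conf

variable {δ : ℝ} {μ : Measure ℝ}

lemma eig_pos (hδ : 0 ≤ δ) (hμ : S.Conf δ μ) {x : ℝ} (hx : x ∈ S.Iall) : 0 < S.eig δ μ x :=
  (S.eigLow_pos δ).trans_le (hμ.eig_bounds hδ hx).1

lemma continuousOn_eig (hδ : 0 ≤ δ) (hμ : S.Conf δ μ) : ContinuousOn (S.eig δ μ) S.Iall := by
  refine continuousOn_Iall fun i x hx => ?_
  have hg := S.gap_pos
  have h1 : Filter.Tendsto (fun y => Real.exp (S.eigLip δ * |x - y|) * S.eig δ μ x)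
      (nhdsWithin x (S.Ireal i)) (nhds (S.eig δ μ x)) := by
    have : Continuous (fun y => Real.exp (S.eigLip δ * |x - y|) * S.eig δ μ x) := by fun_prop
    have h := (this.tendsto x).mono_left (nhdsWithin_le_nhds (s := S.Ireal i))
    simpa using h
  have h2 : Filter.Tendsto (fun y => Real.exp (-(S.eigLip δ * |x - y|)) * S.eig δ μ x)
      (nhdsWithin x (S.Ireal i)) (nhds (S.eig δ μ x)) := by
    have : Continuous (fun y => Real.exp (-(S.eigLip δ * |x - y|)) * S.eig δ μ x) := by fun_prop
    have h := (this.tendsto x).mono_left (nhdsWithin_le_nhds (s := S.Ireal i))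
    simpa using h
  refine tendsto_of_tendsto_of_tendsto_of_le_of_le' h2 h1 ?_ ?_
  · filter_upwards [self_mem_nhdsWithin] with y hy
    rw [Real.exp_neg, inv_mul_le_iff₀ (Real.exp_pos _)]
    exact hμ.eig_lip hδ hx hy
  · filter_upwards [self_mem_nhdsWithin] with y hy
    rw [abs_sub_comm]
    exact hμ.eig_lip hδ hy hx

lemma wt_pos (hδ : 0 ≤ δ) (hμ : S.Conf δ μ) {n : ℕ} {i : Fin (2 * S.r)}
    {w : List (Fin (2 * S.r))} (hw : w ∈ S.Words n i) {x : ℝ} (hx : x ∈ S.Ireal i) :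
    0 < S.wt δ μ w x := by
  have := hμ.eig_pos hδ (S.mem_Iall.2 ⟨i, hx⟩)
  have := hμ.eig_pos hδ (words_mem_Iall hw hx)
  have := words_deriv_pos hw hx
  unfold wt; positivity

lemma wt_sum (hδ : 0 ≤ δ) (hμ : S.Conf δ μ) (n : ℕ) {i : Fin (2 * S.r)} {x : ℝ}
    (hx : x ∈ S.Ireal i) : ∑ w ∈ S.Words n i, S.wt δ μ w x = 1 := by
  unfold wt
  rw [← Finset.sum_div, hμ.eig_sum hδ n hx,
    div_self (hμ.eig_pos hδ (S.mem_Iall.2 ⟨i, hx⟩)).ne']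

lemma wt_cont (hδ : 0 ≤ δ) (hμ : S.Conf δ μ) {n : ℕ} {i : Fin (2 * S.r)}
    {w : List (Fin (2 * S.r))} (hw : w ∈ S.Words n i) :
    ContinuousOn (S.wt δ μ w) (S.Ireal i) := by
  have hc := hμ.continuousOn_eig hδ
  refine ContinuousOn.div (ContinuousOn.mul ?_ (continuousOn_comp_word hc hw))
    (hc.mono (Set.subset_iUnion _ i))
    (fun x hx => (hμ.eig_pos hδ (S.mem_Iall.2 ⟨i, hx⟩)).ne')
  exact (continuousOn_deriv_word hw).rpow_const
    fun x hx => Or.inl (ne_of_gt (words_deriv_pos hw hx))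

/-- The logarithmic Lipschitz constant of the weights. -/
noncomputable def _root_.Schottky.wtLip (S : Schottky) (δ : ℝ) : ℝ :=
  2 * δ / S.gap + S.eigLip δ * S.kap 0 + S.eigLip δ

lemma wt_lip (hδ : 0 ≤ δ) (hμ : S.Conf δ μ) {n : ℕ} {i : Fin (2 * S.r)}
    {w : List (Fin (2 * S.r))} (hw : w ∈ S.Words n i) {x y : ℝ} (hx : x ∈ S.Ireal i)
    (hy : y ∈ S.Ireal i) :
    S.wt δ μ w x ≤ Real.exp (S.wtLip δ * |x - y|) * S.wt δ μ w y := by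
  have hg := S.gap_pos
  have hL : 0 ≤ S.eigLip δ := by unfold eigLip; positivity
  have px := hμ.eig_pos hδ (S.mem_Iall.2 ⟨i, hx⟩)
  have py := hμ.eig_pos hδ (S.mem_Iall.2 ⟨i, hy⟩)
  have dx := words_deriv_pos hw hx
  have dy := words_deriv_pos hw hy
  have pwy := hμ.eig_pos hδ (words_mem_Iall hw hy)
  have e1 : mobiusDerivR (S.wprod w) x ^ δ ≤
      Real.exp (2 * δ / S.gap * |x - y|) * mobiusDerivR (S.wprod w) y ^ δ := by
    rw [Real.rpow_def_of_pos dx, Real.rpow_def_of_pos dy, ← Real.exp_add, Real.exp_le_exp]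
    have h1 := (abs_le.1 (log_deriv_lipschitz hw hx hy)).2
    have h2 := mul_le_mul_of_nonneg_right h1 hδ
    have h3 : 2 * δ / S.gap * |x - y| = 2 / S.gap * |x - y| * δ := by ring
    rw [sub_mul] at h2
    linarith
  obtain ⟨k, hk⟩ := words_maps hw
  have e2 : S.eig δ μ (mobiusR (S.wprod w) x) ≤
      Real.exp (S.eigLip δ * S.kap 0 * |x - y|) * S.eig δ μ (mobiusR (S.wprod w) y) := by
    refine (hμ.eig_lip hδ (hk x hx).2 (hk y hy).2).trans ?_
    refine mul_le_mul_of_nonneg_right (Real.exp_le_exp.2 ?_) pwy.le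
    rw [mul_assoc]
    refine mul_le_mul_of_nonneg_left ((words_dist_le hw hx hy).trans ?_) hL
    exact mul_le_mul_of_nonneg_right (kap_le n) (abs_nonneg _)
  have e3 := hμ.eig_lip hδ hy hx
  rw [abs_sub_comm] at e3
  unfold wt wtLip
  rw [div_le_iff₀ px, add_mul, add_mul, Real.exp_add, Real.exp_add]
  have hq : 1 ≤ Real.exp (S.eigLip δ * |x - y|) * S.eig δ μ x / S.eig δ μ y := by
    rwa [le_div_iff₀ py, one_mul]
  calc _ ≤ (Real.exp (2 * δ / S.gap * |x - y|) * mobiusDerivR (S.wprod w) y ^ δ) *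
        (Real.exp (S.eigLip δ * S.kap 0 * |x - y|) * S.eig δ μ (mobiusR (S.wprod w) y)) :=
        mul_le_mul e1 e2 ENNReal.toReal_nonneg (by positivity)
    _ ≤ _ := le_mul_of_one_le_right (by positivity) hq
    _ = _ := by ring

end Conf

/-- A lower bound for the weights of single letters. -/
noncomputable def wtLow (S : Schottky) (δ : ℝ) : ℝ := S.dC⁻¹ ^ δ * S.eigLow δ / S.eigUp δ

lemma wtLow_pos (S : Schottky) (δ : ℝ) : 0 < S.wtLow δ := by
  have := S.one_le_dC
  have := S.eigLow_pos δ
  have := S.eigUp_pos δ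
  unfold wtLow; positivity

lemma exists_pred_ne (i j₀ : Fin (2 * S.r)) : ∃ j ∈ S.Pred i, j ≠ j₀ := by
  have hr := S.two_le_r
  by_contra hcon
  push Not at hcon
  have : (Finset.univ : Finset (Fin (2 * S.r))) ⊆ {j₀, wordBar i} := by
    intro k _
    by_cases h : k = j₀
    · simp [h]
    · by_cases h2 : i = wordBar k
      · simp [h2, wordBar_wordBar]
      · exact absurd (hcon k (mem_Pred.2 h2)) h
  have := (Finset.card_le_card this).trans Finset.card_le_two
  simp at this
  omega

lemma Conf.wt_spread {δ : ℝ} {μ : Measure ℝ} (hδ : 0 ≤ δ) (hμ : S.Conf δ μ) (n : ℕ)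
    {i : Fin (2 * S.r)} {x : ℝ} (hx : x ∈ S.Ireal i) (j₀ : Fin (2 * S.r)) :
    S.wtLow δ ≤ ∑ w ∈ (S.Words (n + 1) i).filter (fun w => w.getLast? ≠ some j₀),
      S.wt δ μ w x := by
  obtain ⟨j, hj, hne⟩ := exists_pred_ne i j₀
  have hij := mem_Pred.1 hj
  have hxI := S.mem_Iall.2 ⟨i, hx⟩
  have hy := S.g_mem hij hx
  have px := hμ.eig_pos hδ hxI
  have py := hμ.eig_pos hδ (S.mem_Iall.2 ⟨j, hy⟩)
  have hC := S.one_le_dC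
  rw [Finset.sum_filter, sum_words_succ]
  have e : ∀ k ∈ S.Pred i, 0 ≤ ∑ b ∈ S.Words n k,
      if (b ++ [k]).getLast? ≠ some j₀ then S.wt δ μ (b ++ [k]) x else 0 := by
    intro k hk
    refine Finset.sum_nonneg fun b hb => ?_
    split_ifs
    · exact (hμ.wt_pos hδ (mem_words_succ.2 ⟨k, mem_Pred.1 hk, b, hb, rfl⟩) hx).le
    · exact le_rfl
  refine le_trans ?_ (Finset.single_le_sum e hj)
  have e2 : ∀ b ∈ S.Words n j,
      (if (b ++ [j]).getLast? ≠ some j₀ then S.wt δ μ (b ++ [j]) x else 0) =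
      mobiusDerivR (S.g j) x ^ δ / S.eig δ μ x * (mobiusDerivR (S.wprod b) (mobiusR (S.g j) x) ^ δ
        * S.eig δ μ (mobiusR (S.wprod b) (mobiusR (S.g j) x))) := by
    intro b hb
    have h1 : (b ++ [j]).getLast? ≠ some j₀ := by simp [hne]
    rw [if_pos h1, wt, (words_succ_apply hij b hx).1, (words_succ_apply hij b hx).2,
      Real.mul_rpow (mobiusDerivR_nonneg _ _) (mobiusDerivR_nonneg _ _)]
    ring
  rw [Finset.sum_congr rfl e2, ← Finset.mul_sum, hμ.eig_sum hδ n hy, wtLow,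
    div_mul_eq_mul_div]
  have h1 := (hμ.eig_bounds hδ (S.mem_Iall.2 ⟨j, hy⟩)).1
  have h2 := (hμ.eig_bounds hδ hxI).2
  have h3 : S.dC⁻¹ ^ δ ≤ mobiusDerivR (S.g j) x ^ δ :=
    Real.rpow_le_rpow (by positivity) (le_deriv hij hx) hδ
  have := S.eigLow_pos δ
  have := mobiusDerivR_nonneg (S.g j) x
  gcongr

namespace Conf

variable {δ : ℝ} {μ : Measure ℝ}

lemma withDensity_bounds (hδ : 0 ≤ δ) (hμ : S.Conf δ μ) {A : Set ℝ} (hA : MeasurableSet A) :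
    S.eigLow δ * μ.real A ≤ (μ.withDensity (S.eigE δ μ)).real A ∧
      (μ.withDensity (S.eigE δ μ)).real A ≤ S.eigUp δ * μ.real A := by
  have := hμ.prob
  have h1 : ENNReal.ofReal (S.eigLow δ) * μ A ≤ μ.withDensity (S.eigE δ μ) A := by
    rw [withDensity_apply _ hA, ← setLIntegral_const]
    refine lintegral_mono_ae (ae_restrict_of_ae ?_)
    filter_upwards [hμ.ae_mem] with x hx using (hμ.eigE_bounds hδ hx).1
  have h2 : μ.withDensity (S.eigE δ μ) A ≤ ENNReal.ofReal (S.eigUp δ) * μ A := by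
    rw [withDensity_apply _ hA, ← setLIntegral_const]
    refine lintegral_mono_ae (ae_restrict_of_ae ?_)
    filter_upwards [hμ.ae_mem] with x hx using (hμ.eigE_bounds hδ hx).2
  have h3 : ENNReal.ofReal (S.eigUp δ) * μ A ≠ ⊤ :=
    ENNReal.mul_ne_top ENNReal.ofReal_ne_top (measure_ne_top _ _)
  constructor
  · have := ENNReal.toReal_mono (ne_top_of_le_ne_top h3 h2) h1
    rwa [ENNReal.toReal_mul, ENNReal.toReal_ofReal (S.eigLow_pos δ).le] at this
  · have := ENNReal.toReal_mono h3 h2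
    rwa [ENNReal.toReal_mul, ENNReal.toReal_ofReal (S.eigUp_pos δ).le] at this

lemma withDensity_finite (hδ : 0 ≤ δ) (hμ : S.Conf δ μ) :
    IsFiniteMeasure (μ.withDensity (S.eigE δ μ)) := by
  have := hμ.prob
  refine isFiniteMeasure_withDensity (ne_top_of_le_ne_top
    (b := ∫⁻ _, ENNReal.ofReal (S.eigUp δ) ∂μ) (by simp) (lintegral_mono_ae ?_))
  filter_upwards [hμ.ae_mem] with x hx using (hμ.eigE_bounds hδ hx).2

lemma wt_inv (hδ : 0 ≤ δ) (hμ : S.Conf δ μ) (n : ℕ) {f : ℝ → ℝ} (hf : S.Nice f)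
    (h0 : ∀ x ∈ S.Iall, 0 ≤ f x) :
    ∫ x, S.avg (S.wt δ μ) n f x ∂(μ.withDensity (S.eigE δ μ)) =
      ∫ x, f x ∂(μ.withDensity (S.eigE δ μ)) := by
  classical
  have := hμ.prob
  have hmE := measurable_eigE (S := S) δ μ
  set ν := μ.withDensity (S.eigE δ μ)
  have hnull : ν S.Iallᶜ = 0 := withDensity_absolutelyContinuous _ _ hμ.null
  have hae := ae_mem_of_null hnull
  have hn := Schottky.nice_avg (W := S.wt δ μ) (n := n) (fun i w hw => hμ.wt_cont hδ hw)
    (fun i w hw x hx => hμ.wt_pos hδ hw hx) (fun i x hx => hμ.wt_sum hδ n hx) hf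
  have hn0 : ∀ x ∈ S.Iall, 0 ≤ S.avg (S.wt δ μ) n f x := fun x hx =>
    Finset.sum_nonneg fun w hw => mul_nonneg (hμ.wt_pos hδ hw (mem_idx hx)).le
      (h0 _ (words_mem_Iall hw (mem_idx hx)))
  rw [integral_eq_lintegral_of_nonneg_ae (hae.mono h0) (hf.aestronglyMeasurable hnull),
    integral_eq_lintegral_of_nonneg_ae (hae.mono hn0) (hn.aestronglyMeasurable hnull)]
  congr 1
  have aux : ∀ {u : ℝ → ℝ}, S.Nice u → ∃ u' : ℝ → ENNReal, Measurable u' ∧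
      ∀ x ∈ S.Iall, u' x = ENNReal.ofReal (u x) := by
    intro u hu
    refine ⟨fun x => ENNReal.ofReal (S.Iall.piecewise u (fun _ => 0) x), ?_, fun x hx => ?_⟩
    · exact (hu.1.measurable_piecewise continuousOn_const S.measurableSet_Iall).ennreal_ofReal
    · change ENNReal.ofReal (S.Iall.piecewise u (fun _ => 0) x) = _
      rw [Set.piecewise_eq_of_mem _ _ _ hx]
  obtain ⟨u, hum, hu⟩ := aux hf
  obtain ⟨v, hvm, hv⟩ := aux hn
  rw [lintegral_congr_ae (hae.mono fun x hx => (hu x hx).symm),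
    lintegral_congr_ae (hae.mono fun x hx => (hv x hx).symm),
    lintegral_withDensity_eq_lintegral_mul _ hmE hum,
    lintegral_withDensity_eq_lintegral_mul _ hmE hvm,
    hμ.inv n (hmE.mul hum)]
  refine lintegral_congr_ae ?_
  filter_upwards [hμ.ae_mem] with x hx
  have hi := mem_idx hx
  rw [Pi.mul_apply, hv x hx, ← hμ.ofReal_eig hδ hx,
    ← ENNReal.ofReal_mul (hμ.eig_pos hδ hx).le, avg, Finset.mul_sum,
    ENNReal.ofReal_sum_of_nonneg fun w hw => mul_nonneg (hμ.eig_pos hδ hx).le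
      (mul_nonneg (hμ.wt_pos hδ hw hi).le (h0 _ (words_mem_Iall hw hi))), opL]
  refine Finset.sum_congr rfl fun w hw => ?_
  have hwI := words_mem_Iall hw hi
  have p1 := hμ.eig_pos hδ hx
  have p2 := hμ.eig_pos hδ hwI
  have p3 : 0 ≤ mobiusDerivR (S.wprod w) x ^ δ := Real.rpow_nonneg (mobiusDerivR_nonneg _ _) _
  rw [Pi.mul_apply, hu _ hwI, ← hμ.ofReal_eig hδ hwI, ← ENNReal.ofReal_mul p2.le,
    ← ENNReal.ofReal_mul p3, wt]
  congr 1
  field_simp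

end Conf

lemma exists_gibbs (S : Schottky) {δ : ℝ} (hδ : 0 < δ) : ∃ c₁ B τ₀ : ℝ, 0 < c₁ ∧ 0 < B ∧ 0 < τ₀ ∧
    ∀ μ : Measure ℝ, S.Conf δ μ →
      S.Gibbs (S.wtLip δ) (S.wtLow δ) c₁ B τ₀ (S.eigUp δ) (μ.withDensity (S.eigE δ μ))
        (S.wt δ μ) := by
  obtain ⟨a₁, a₂, τ₀, h1, h2, h3, hA⟩ := S.ahlfors hδ
  have hlow := S.eigLow_pos δ
  have hup := S.eigUp_pos δ
  set c₁ := min 1 ((a₁ / (2 * a₂)) ^ (1 / δ)) with hc₁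
  have hc0 : 0 < c₁ := lt_min one_pos (by positivity)
  have hc1 : c₁ ≤ 1 := min_le_left _ _
  have hc : a₂ * c₁ ^ δ ≤ a₁ / 2 := by
    have : c₁ ^ δ ≤ a₁ / (2 * a₂) := by
      calc c₁ ^ δ ≤ ((a₁ / (2 * a₂)) ^ (1 / δ)) ^ δ :=
            Real.rpow_le_rpow hc0.le (min_le_right _ _) hδ.le
        _ = _ := by
          rw [← Real.rpow_mul (by positivity), one_div, inv_mul_cancel₀ hδ.ne', Real.rpow_one]
    calc _ ≤ a₂ * (a₁ / (2 * a₂)) := by gcongr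
      _ = _ := by field_simp
  refine ⟨c₁, 2 * (S.eigUp δ * a₂) / (S.eigLow δ * a₁), τ₀, hc0, by positivity, h3,
    fun μ hμ => ?_⟩
  have := hμ.prob
  refine
    { fin := hμ.withDensity_finite hδ.le
      mass := ?_
      null := withDensity_absolutelyContinuous _ _ hμ.null
      cont := fun n i w hw => hμ.wt_cont hδ.le hw
      pos := fun n i w hw x hx => hμ.wt_pos hδ.le hw hx
      sum_one := fun n i x hx => hμ.wt_sum hδ.le n hx
      lip := fun n i w hw x hx y hy => hμ.wt_lip hδ.le hw hx hy
      inv := fun n f hf h0 => hμ.wt_inv hδ.le n hf h0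
      spread := fun n i x hx j => hμ.wt_spread hδ.le n hx j
      ann := ?_ }
  · have := (hμ.withDensity_bounds hδ.le MeasurableSet.univ).2
    rwa [probReal_univ (μ := μ), mul_one] at this
  · intro τ hτ hττ
    refine ⟨S.eigLow δ * (a₁ / 2 * τ ^ δ), by positivity, ?_⟩
    refine (withDensity_absolutelyContinuous _ _).ae_le ?_
    filter_upwards [hA μ hμ] with x hx
    have hset : {y | c₁ * τ ≤ |x - y| ∧ |x - y| < τ} =
        Metric.ball x τ \ Metric.ball x (c₁ * τ) := by
      ext y
      rw [Set.mem_sdiff, Metric.mem_ball, Metric.mem_ball, Real.dist_eq, abs_sub_comm y x, not_lt]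
      exact and_comm
    have hm : MeasurableSet {y | c₁ * τ ≤ |x - y| ∧ |x - y| < τ} := by
      rw [hset]; exact measurableSet_ball.diff measurableSet_ball
    have hb := hμ.withDensity_bounds hδ.le hm
    have hcτ : c₁ * τ ≤ τ := mul_le_of_le_one_left hτ.le hc1
    have hreal : μ.real {y | c₁ * τ ≤ |x - y| ∧ |x - y| < τ} =
        μ.real (Metric.ball x τ) - μ.real (Metric.ball x (c₁ * τ)) := by
      rw [hset, measureReal_sdiff (Metric.ball_subset_ball hcτ) measurableSet_ball]
    have hx1 := hx τ hτ hττ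
    have hx2 := hx (c₁ * τ) (by positivity) (hcτ.trans hττ)
    rw [Real.mul_rpow hc0.le hτ.le] at hx2
    have ht : 0 < τ ^ δ := by positivity
    have h0 : 0 ≤ μ.real (Metric.ball x (c₁ * τ)) := measureReal_nonneg
    constructor
    · refine le_trans ?_ hb.1
      rw [hreal]
      gcongr
      nlinarith
    · refine hb.2.trans ?_
      calc _ ≤ S.eigUp δ * (a₂ * τ ^ δ) := by
            rw [hreal]; gcongr; linarith
        _ = _ := by field_simp

end Schottky

section Hilbert

variable {ι κ V : Type*} [NormedAddCommGroup V] [InnerProductSpace ℂ V]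

lemma norm_sq_sum_add_variance (s : Finset ι) (p : ι → ℝ) (a : ι → V)
    (hp : ∑ i ∈ s, p i = 1) :
    ‖∑ i ∈ s, (p i : ℂ) • a i‖ ^ 2 + (∑ i ∈ s, ∑ j ∈ s, p i * p j * ‖a i - a j‖ ^ 2) / 2 =
      ∑ i ∈ s, p i * ‖a i‖ ^ 2 := by
  have h1 : ‖∑ i ∈ s, (p i : ℂ) • a i‖ ^ 2 =
      ∑ i ∈ s, ∑ j ∈ s, p i * p j * (inner ℂ (a i) (a j)).re := by
    have h := inner_self_eq_norm_sq (𝕜 := ℂ) (∑ i ∈ s, (p i : ℂ) • a i)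
    rw [← h, sum_inner]
    simp only [inner_sum, inner_smul_left, inner_smul_right, map_sum, Complex.conj_ofReal]
    refine Finset.sum_congr rfl fun i _ => Finset.sum_congr rfl fun j _ => ?_
    simp
    ring
  have h2 : ∀ i j, p i * p j * ‖a i - a j‖ ^ 2 = p i * ‖a i‖ ^ 2 * p j +
      p i * (p j * ‖a j‖ ^ 2) - 2 * (p i * p j * (inner ℂ (a i) (a j)).re) := by
    intro i j
    have := norm_sub_sq (𝕜 := ℂ) (a i) (a j)
    simp at this
    rw [this]; ring
  rw [h1]
  simp only [h2, Finset.sum_sub_distrib, Finset.sum_add_distrib, ← Finset.mul_sum,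
    ← Finset.sum_mul, hp]
  ring

/-- Distinct rotation speeds force a definite variance at one of two nearby points. -/
lemma phase_spread [DecidableEq κ] (s : Finset ι) (p q err : ι → ℝ) (a a' : ι → V) (e : ι → ℂ)
    (L : ι → κ) {c₂ c₃ : ℝ} (hc₂ : 0 ≤ c₂) (hp : ∀ i ∈ s, 0 ≤ p i) (hq : ∀ i ∈ s, p i ≤ 2 * q i)
    (hp1 : ∑ i ∈ s, p i = 1) (he : ∀ i ∈ s, ‖e i‖ = 1)
    (herr : ∀ i ∈ s, ‖a' i - e i • a i‖ ≤ err i)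
    (hsep : ∀ i ∈ s, ∀ j ∈ s, L i ≠ L j → c₂ ≤ ‖e i - e j‖)
    (hspread : ∀ j ∈ s, c₃ ≤ ∑ i ∈ s with L i ≠ L j, p i) :
    c₂ ^ 2 * c₃ * ∑ i ∈ s, p i * ‖a i‖ ^ 2 ≤
      4 * (∑ i ∈ s, ∑ j ∈ s, p i * p j * ‖a i - a j‖ ^ 2) +
      16 * (∑ i ∈ s, ∑ j ∈ s, q i * q j * ‖a' i - a' j‖ ^ 2) +
      8 * ∑ i ∈ s, p i * err i ^ 2 := by
  have key : ∀ i ∈ s, ∀ j ∈ s, L i ≠ L j → c₂ ^ 2 * ‖a j‖ ^ 2 ≤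
      4 * ‖a i - a j‖ ^ 2 + 4 * ‖a' i - a' j‖ ^ 2 + 4 * err i ^ 2 + 4 * err j ^ 2 := by
    intro i hi j hj hL
    have h1 : (e i - e j) • a j = (a' i - a' j) - (a' i - e i • a i) + (a' j - e j • a j)
        - e i • (a i - a j) := by module
    have h2 : c₂ * ‖a j‖ ≤ ‖a' i - a' j‖ + err i + err j + ‖a i - a j‖ := by
      calc c₂ * ‖a j‖ ≤ ‖e i - e j‖ * ‖a j‖ :=
            mul_le_mul_of_nonneg_right (hsep i hi j hj hL) (norm_nonneg _)
        _ = ‖(e i - e j) • a j‖ := (norm_smul _ _).symm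
        _ ≤ _ := by
          rw [h1]
          refine (norm_sub_le _ _).trans (add_le_add ?_ (by rw [norm_smul, he i hi, one_mul]))
          refine (norm_add_le _ _).trans (add_le_add ?_ (herr j hj))
          exact (norm_sub_le _ _).trans (add_le_add le_rfl (herr i hi))
    have h3 : 0 ≤ c₂ * ‖a j‖ := by positivity
    set u := ‖a' i - a' j‖
    set v := ‖a i - a j‖
    calc c₂ ^ 2 * ‖a j‖ ^ 2 = (c₂ * ‖a j‖) ^ 2 := by ring
      _ ≤ (u + err i + err j + v) ^ 2 := by gcongr
      _ ≤ _ := by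
        nlinarith [sq_nonneg (u - err i), sq_nonneg (u - err j), sq_nonneg (u - v),
          sq_nonneg (err i - err j), sq_nonneg (err i - v), sq_nonneg (err j - v)]
  have h1 : c₂ ^ 2 * c₃ * ∑ i ∈ s, p i * ‖a i‖ ^ 2 ≤
      ∑ j ∈ s, ∑ i ∈ s with L i ≠ L j, p i * p j * (c₂ ^ 2 * ‖a j‖ ^ 2) := by
    rw [Finset.mul_sum]
    refine Finset.sum_le_sum fun j hj => ?_
    have : ∑ i ∈ s with L i ≠ L j, p i * p j * (c₂ ^ 2 * ‖a j‖ ^ 2) =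
        (∑ i ∈ s with L i ≠ L j, p i) * (p j * (c₂ ^ 2 * ‖a j‖ ^ 2)) := by
      rw [Finset.sum_mul]
      exact Finset.sum_congr rfl fun i _ => by ring
    rw [this]
    have := mul_le_mul_of_nonneg_right (hspread j hj)
      (show 0 ≤ p j * (c₂ ^ 2 * ‖a j‖ ^ 2) from mul_nonneg (hp j hj) (by positivity))
    linarith
  have h2 : ∑ j ∈ s, ∑ i ∈ s with L i ≠ L j, p i * p j * (c₂ ^ 2 * ‖a j‖ ^ 2) ≤
      ∑ j ∈ s, ∑ i ∈ s, (4 * (p i * p j * ‖a i - a j‖ ^ 2) +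
        16 * (q i * q j * ‖a' i - a' j‖ ^ 2) + 4 * (p i * err i ^ 2 * p j)
        + 4 * (p i * (p j * err j ^ 2))) := by
    refine Finset.sum_le_sum fun j hj => ?_
    have hnn : ∀ i ∈ s, 0 ≤ q i := fun i hi => by linarith [hp i hi, hq i hi]
    have term : ∀ i ∈ s, p i * p j * (4 * ‖a i - a j‖ ^ 2 + 4 * ‖a' i - a' j‖ ^ 2 +
        4 * err i ^ 2 + 4 * err j ^ 2) ≤ 4 * (p i * p j * ‖a i - a j‖ ^ 2) +
        16 * (q i * q j * ‖a' i - a' j‖ ^ 2) + 4 * (p i * err i ^ 2 * p j)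
        + 4 * (p i * (p j * err j ^ 2)) := by
      intro i hi
      have h5 : p i * p j ≤ 4 * (q i * q j) := by
        calc p i * p j ≤ (2 * q i) * (2 * q j) :=
              mul_le_mul (hq i hi) (hq j hj) (hp j hj) (by linarith [hnn i hi])
          _ = _ := by ring
      have := mul_le_mul_of_nonneg_right h5 (sq_nonneg ‖a' i - a' j‖)
      nlinarith
    refine le_trans (Finset.sum_le_sum (s := s.filter (fun i => L i ≠ L j)) fun i hi => ?_)
      (Finset.sum_le_sum_of_subset_of_nonneg (Finset.filter_subset _ s) fun i hi _ => ?_)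
    · obtain ⟨hi, hL⟩ := Finset.mem_filter.1 hi
      exact (mul_le_mul_of_nonneg_left (key i hi j hj hL)
        (mul_nonneg (hp i hi) (hp j hj))).trans (term i hi)
    · refine le_trans (mul_nonneg (mul_nonneg (hp i hi) (hp j hj)) (by positivity)) (term i hi)
  refine h1.trans (h2.trans (le_of_eq ?_))
  rw [Finset.sum_comm]
  simp only [Finset.sum_add_distrib, ← Finset.mul_sum, ← Finset.sum_mul, hp1]
  ring

end Hilbert

lemma abs_exp_sub_exp_le {u v M : ℝ} (hu : Real.exp u ≤ M) (hv : Real.exp v ≤ M) :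
    |Real.exp u - Real.exp v| ≤ M * |u - v| := by
  wlog h : v ≤ u generalizing u v
  · rw [abs_sub_comm, abs_sub_comm u v]
    exact this hv hu (by linarith)
  have h1 : Real.exp v = Real.exp u * Real.exp (v - u) := by rw [← Real.exp_add]; congr 1; ring
  have h2 := Real.add_one_le_exp (v - u)
  have h3 := Real.exp_pos u
  have h4 := Real.exp_le_exp.2 h
  rw [abs_of_nonneg (by linarith), abs_of_nonneg (by linarith)]
  calc _ = Real.exp u * (1 - Real.exp (v - u)) := by rw [h1]; ring
    _ ≤ Real.exp u * (u - v) := mul_le_mul_of_nonneg_left (by linarith) h3.le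
    _ ≤ _ := mul_le_mul_of_nonneg_right hu (by linarith)

lemma le_norm_exp_sub_exp {α β : ℝ} (h : |α - β| ≤ 2) :
    |α - β| / 2 ≤ ‖Complex.exp (Complex.I * α) - Complex.exp (Complex.I * β)‖ := by
  have h1 : Complex.exp (Complex.I * α) - Complex.exp (Complex.I * β) =
      Complex.exp (Complex.I * β) * (Complex.exp (Complex.I * (α - β : ℝ)) - 1) := by
    rw [mul_sub, ← Complex.exp_add, mul_one]
    congr 2
    push_cast; ring
  have h2 : ‖Complex.exp (Complex.I * β)‖ = 1 := by
    rw [mul_comm]; exact Complex.norm_exp_ofReal_mul_I β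
  rw [h1, norm_mul, h2, one_mul, Complex.norm_exp_I_mul_ofReal_sub_one, norm_mul, Real.norm_eq_abs,
    Real.norm_eq_abs]
  have h3 := Real.mul_abs_le_abs_sin (x := (α - β) / 2) (by
    rw [abs_div, abs_two]; linarith [Real.pi_gt_three])
  rw [abs_div, abs_two] at h3
  have h4 : 1 / 2 ≤ 2 / Real.pi := by
    rw [div_le_div_iff₀ two_pos Real.pi_pos]; linarith [Real.pi_le_four]
  rw [abs_two]
  nlinarith [abs_nonneg (α - β)]

lemma norm_exp_sub_exp_le (α β : ℝ) :
    ‖Complex.exp (Complex.I * α) - Complex.exp (Complex.I * β)‖ ≤ |α - β| := by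
  have h1 : Complex.exp (Complex.I * α) - Complex.exp (Complex.I * β) =
      Complex.exp (Complex.I * β) * (Complex.exp (Complex.I * (α - β : ℝ)) - 1) := by
    rw [mul_sub, ← Complex.exp_add, mul_one]
    congr 2
    push_cast; ring
  have h2 : ‖Complex.exp (Complex.I * β)‖ = 1 := by
    rw [mul_comm]; exact Complex.norm_exp_ofReal_mul_I β
  rw [h1, norm_mul, h2, one_mul]
  exact Real.norm_exp_I_mul_ofReal_sub_one_le

/-- Integrating a pointwise bound over a symmetric relation. -/
lemma integral_le_of_symm_rel {ν : Measure ℝ} [IsFiniteMeasure ν] {R : Set (ℝ × ℝ)}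
    (hR : MeasurableSet R) (hsymm : ∀ x y, (x, y) ∈ R → (y, x) ∈ R) {P : Set ℝ}
    (hP : ∀ᵐ x ∂ν, x ∈ P) {f g k : ℝ → ℝ} (hf : Integrable f ν) (hg : Integrable g ν)
    (hk : Integrable k ν) (hf0 : ∀ x ∈ P, 0 ≤ f x) (hg0 : ∀ x ∈ P, 0 ≤ g x)
    (hk0 : ∀ x ∈ P, 0 ≤ k x)
    (hle : ∀ x ∈ P, ∀ y ∈ P, (x, y) ∈ R → f x ≤ g x + g y + k x) {m B : ℝ} (hm : 0 < m)
    (hann : ∀ᵐ x ∂ν, m ≤ ν.real {y | (x, y) ∈ R} ∧ ν.real {y | (x, y) ∈ R} ≤ B * m) :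
    ∫ x, f x ∂ν ≤ 2 * B * ∫ x, g x ∂ν + B * ∫ x, k x ∂ν := by
  have hR1 : ∀ x, MeasurableSet {y | (x, y) ∈ R} := fun x => measurable_prodMk_left hR
  have hint : ∀ {u : ℝ → ℝ}, Integrable u ν → Integrable (fun z : ℝ × ℝ =>
      R.indicator (fun z => u z.1) z) (ν.prod ν) := fun hu =>
    (hu.comp_fst ν).indicator hR
  have hint2 : Integrable (fun z : ℝ × ℝ => R.indicator (fun z => g z.2) z) (ν.prod ν) :=
    (hg.comp_snd ν).indicator hR
  have hpt : ∀ (u : ℝ → ℝ) (x : ℝ), ∫ y, R.indicator (fun z : ℝ × ℝ => u z.1) (x, y) ∂ν =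
      ν.real {y | (x, y) ∈ R} * u x := by
    intro u x
    have : (fun y => R.indicator (fun z : ℝ × ℝ => u z.1) (x, y)) =
        {y | (x, y) ∈ R}.indicator (fun _ => u x) := by
      ext y
      by_cases h : (x, y) ∈ R
      · rw [Set.indicator_of_mem h, Set.indicator_of_mem (s := {y | (x, y) ∈ R}) h]
      · rw [Set.indicator_of_notMem h, Set.indicator_of_notMem (s := {y | (x, y) ∈ R}) h]
    simp only [this]
    rw [integral_indicator_const _ (hR1 x), smul_eq_mul]
  have hval : ∀ {u : ℝ → ℝ}, Integrable u ν → ∫ z, R.indicator (fun z => u z.1) z ∂(ν.prod ν) =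
      ∫ x, ν.real {y | (x, y) ∈ R} * u x ∂ν := by
    intro u hu
    rw [integral_prod _ (hint hu)]
    simp only [hpt]
  have hswap : ∫ z, R.indicator (fun z => g z.2) z ∂(ν.prod ν) =
      ∫ z, R.indicator (fun z => g z.1) z ∂(ν.prod ν) := by
    rw [← integral_prod_swap]
    refine integral_congr_ae (Filter.Eventually.of_forall fun z => ?_)
    obtain ⟨x, y⟩ := z
    by_cases h : (x, y) ∈ R
    · simp only [Prod.swap_prod_mk]
      rw [Set.indicator_of_mem (hsymm _ _ h), Set.indicator_of_mem h]
    · simp only [Prod.swap_prod_mk]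
      rw [Set.indicator_of_notMem (fun h' => h (hsymm _ _ h')), Set.indicator_of_notMem h]
  have hbd : ∀ {u : ℝ → ℝ}, Integrable u ν →
      Integrable (fun x => ν.real {y | (x, y) ∈ R} * u x) ν := fun hu =>
    ((hint hu).integral_prod_left).congr (Filter.Eventually.of_forall fun x => hpt _ x)
  have h1 : m * ∫ x, f x ∂ν ≤ ∫ x, ν.real {y | (x, y) ∈ R} * f x ∂ν := by
    rw [← integral_const_mul]
    refine integral_mono_ae (hf.const_mul m) (hbd hf) ?_
    filter_upwards [hP, hann] with x hx hm' using mul_le_mul_of_nonneg_right hm'.1 (hf0 x hx)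
  have h2 : ∀ {u : ℝ → ℝ}, Integrable u ν → (∀ x ∈ P, 0 ≤ u x) →
      ∫ x, ν.real {y | (x, y) ∈ R} * u x ∂ν ≤ B * m * ∫ x, u x ∂ν := by
    intro u hu hu0
    rw [← integral_const_mul]
    refine integral_mono_ae (hbd hu) (hu.const_mul _) ?_
    filter_upwards [hP, hann] with x hx hm' using mul_le_mul_of_nonneg_right hm'.2 (hu0 x hx)
  have hP1 : ∀ᵐ z ∂ν.prod ν, z.1 ∈ P := Measure.quasiMeasurePreserving_fst.ae hP
  have hP2 : ∀ᵐ z ∂ν.prod ν, z.2 ∈ P := Measure.quasiMeasurePreserving_snd.ae hP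
  have h3 : ∫ z, R.indicator (fun z => f z.1) z ∂(ν.prod ν) ≤
      ∫ z, (R.indicator (fun z => g z.1) z + R.indicator (fun z => g z.2) z +
        R.indicator (fun z => k z.1) z) ∂(ν.prod ν) := by
    refine integral_mono_ae (hint hf) (((hint hg).add hint2).add (hint hk)) ?_
    filter_upwards [hP1, hP2] with z hz1 hz2
    by_cases h : z ∈ R
    · simpa only [Set.indicator_of_mem h] using hle z.1 hz1 z.2 hz2 h
    · simp only [Set.indicator_of_notMem h]; norm_num
  have h4 : ∫ z, (R.indicator (fun z => g z.1) z + R.indicator (fun z => g z.2) z +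
        R.indicator (fun z => k z.1) z) ∂(ν.prod ν) =
      2 * (∫ x, ν.real {y | (x, y) ∈ R} * g x ∂ν) + ∫ x, ν.real {y | (x, y) ∈ R} * k x ∂ν := by
    have h5 := integral_add ((hint hg).add hint2) (hint hk)
    have h6 := integral_add (hint hg) hint2
    rw [hswap, hval hg] at h6
    simp only [Pi.add_apply] at h5
    rw [h5, h6, hval hk]
    ring
  rw [hval hf, h4] at h3
  have h5 := h2 hg hg0
  have h6 := h2 hk hk0
  have h7 : m * ∫ x, f x ∂ν ≤ m * (2 * B * ∫ x, g x ∂ν + B * ∫ x, k x ∂ν) := by linarith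
  exact le_of_mul_le_mul_left h7 hm

lemma cpow_add_mul_I {d : ℝ} (hd : 0 < d) (η t : ℝ) :
    (d : ℂ) ^ ((η : ℂ) + t * Complex.I) =
      (Real.exp (η * Real.log d) : ℂ) * Complex.exp (Complex.I * (t * Real.log d : ℝ)) := by
  rw [Complex.cpow_def_of_ne_zero (by exact_mod_cast hd.ne'), ← Complex.ofReal_log hd.le,
    Complex.ofReal_exp, ← Complex.exp_add]
  congr 1
  push_cast
  ring

namespace Schottky

variable {S : Schottky} {V : Type*} [NormedAddCommGroup V] [InnerProductSpace ℂ V]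

/-- A branch of the twisted operator. -/
noncomputable def branch (S : Schottky) (U : List (Fin (2 * S.r)) → (V ≃ₗᵢ[ℂ] V)) (η t : ℝ)
    (G : ℝ → V) (w : List (Fin (2 * S.r))) (x : ℝ) : V :=
  ((mobiusDerivR (S.wprod w) x : ℂ) ^ ((η : ℂ) + t * Complex.I)) • U w (G (mobiusR (S.wprod w) x))

/-- The normalised twisted operator. -/
noncomputable def step (S : Schottky) (W : List (Fin (2 * S.r)) → ℝ → ℝ)
    (U : List (Fin (2 * S.r)) → (V ≃ₗᵢ[ℂ] V)) (η t : ℝ) (n : ℕ) (G : ℝ → V) (x : ℝ) : V :=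
  ∑ w ∈ S.Words n (S.idx x), (W w x : ℂ) • S.branch U η t G w x

/-- Bound for the amplitude of a branch. -/
noncomputable def ampl (S : Schottky) (η : ℝ) (n : ℕ) : ℝ := Real.exp (|η| * (n * Real.log S.dC))

/-- Local Lipschitz control at scale `τ`. -/
structure Loc (S : Schottky) (τ : ℝ) (G : ℝ → V) (ℓ : ℝ → ℝ) : Prop where
  cont : ContinuousOn G S.Iall
  bdd : ∃ C, ∀ x ∈ S.Iall, ‖G x‖ ≤ C
  nice : S.Nice ℓ
  nonneg : ∀ x ∈ S.Iall, 0 ≤ ℓ x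
  lip : ∀ i, ∀ x ∈ S.Ireal i, ∀ y ∈ S.Ireal i, |x - y| < τ → ‖G x - G y‖ ≤ ℓ x * |x - y|

omit [InnerProductSpace ℂ V] in
lemma Loc.nice_norm {τ : ℝ} {G : ℝ → V} {ℓ : ℝ → ℝ} (h : S.Loc τ G ℓ) :
    S.Nice fun x => ‖G x‖ := Schottky.nice_norm h.cont h.bdd.choose_spec

section branch

variable {U : List (Fin (2 * S.r)) → (V ≃ₗᵢ[ℂ] V)} {η t : ℝ} {G : ℝ → V} {n : ℕ}
  {i : Fin (2 * S.r)} {w : List (Fin (2 * S.r))} {x y : ℝ}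

lemma branch_eq (hw : w ∈ S.Words n i) (hx : x ∈ S.Ireal i) :
    S.branch U η t G w x = ((Real.exp (η * Real.log (mobiusDerivR (S.wprod w) x)) : ℂ) *
      Complex.exp (Complex.I * (t * Real.log (mobiusDerivR (S.wprod w) x) : ℝ))) •
        U w (G (mobiusR (S.wprod w) x)) := by
  rw [branch, cpow_add_mul_I (words_deriv_pos hw hx)]

lemma exp_log_deriv_le (hw : w ∈ S.Words n i) (hx : x ∈ S.Ireal i) :
    Real.exp (η * Real.log (mobiusDerivR (S.wprod w) x)) ≤ S.ampl η n := by
  refine Real.exp_le_exp.2 ((le_abs_self _).trans ?_)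
  rw [abs_mul]
  exact mul_le_mul_of_nonneg_left (abs_log_deriv_le hw hx) (abs_nonneg _)

lemma norm_exp_I_mul (a : ℝ) : ‖Complex.exp (Complex.I * a)‖ = 1 := by
  rw [mul_comm]; exact Complex.norm_exp_ofReal_mul_I a

lemma norm_branch_le (hw : w ∈ S.Words n i) (hx : x ∈ S.Ireal i) :
    ‖S.branch U η t G w x‖ ≤ S.ampl η n * ‖G (mobiusR (S.wprod w) x)‖ := by
  rw [branch_eq hw hx, norm_smul, norm_mul, norm_exp_I_mul, LinearIsometryEquiv.norm_map, mul_one,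
    Complex.norm_real, Real.norm_eq_abs, abs_of_pos (Real.exp_pos _)]
  exact mul_le_mul_of_nonneg_right (exp_log_deriv_le hw hx) (norm_nonneg _)

lemma ampl_pos (S : Schottky) (η : ℝ) (n : ℕ) : 0 < S.ampl η n := Real.exp_pos _

/-- The phase acquired by a branch between two points. -/
noncomputable def phase (S : Schottky) (t : ℝ) (w : List (Fin (2 * S.r))) (x y : ℝ) : ℂ :=
  Complex.exp (Complex.I * (t * (Real.log (mobiusDerivR (S.wprod w) y) -
    Real.log (mobiusDerivR (S.wprod w) x)) : ℝ))

lemma norm_phase (t : ℝ) (w : List (Fin (2 * S.r))) (x y : ℝ) : ‖S.phase t w x y‖ = 1 :=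
  norm_exp_I_mul _

lemma norm_phase_sub_one_le (hw : w ∈ S.Words n i) (hx : x ∈ S.Ireal i) (hy : y ∈ S.Ireal i) :
    ‖S.phase t w x y - 1‖ ≤ |t| * (2 / S.gap * |x - y|) := by
  have := norm_exp_sub_exp_le (t * (Real.log (mobiusDerivR (S.wprod w) y) -
    Real.log (mobiusDerivR (S.wprod w) x))) 0
  simp only [Complex.ofReal_zero, mul_zero, Complex.exp_zero, sub_zero] at this
  refine this.trans ?_
  rw [abs_mul, abs_sub_comm]
  exact mul_le_mul_of_nonneg_left (log_deriv_lipschitz hw hx hy) (abs_nonneg _)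

lemma norm_branch_sub_phase_le {τ : ℝ} {ℓ : ℝ → ℝ} (hG : S.Loc τ G ℓ) (hη : |η| ≤ 1)
    (hκ : S.kap n ≤ 1) (hw : w ∈ S.Words n i) (hx : x ∈ S.Ireal i) (hy : y ∈ S.Ireal i)
    (hxy : |x - y| < τ) :
    ‖S.branch U η t G w y - S.phase t w x y • S.branch U η t G w x‖ ≤
      S.ampl η n * |x - y| * (2 / S.gap * ‖G (mobiusR (S.wprod w) x)‖ +
        S.kap n * ℓ (mobiusR (S.wprod w) x)) := by
  obtain ⟨k, hk⟩ := words_maps hw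
  set x' := mobiusR (S.wprod w) x
  set y' := mobiusR (S.wprod w) y
  set Lx := Real.log (mobiusDerivR (S.wprod w) x) with hLx
  set Ly := Real.log (mobiusDerivR (S.wprod w) y) with hLy
  have hx' : x' ∈ S.Ireal k := (hk x hx).2
  have hy' : y' ∈ S.Ireal k := (hk y hy).2
  have hd : |x' - y'| ≤ S.kap n * |x - y| := words_dist_le hw hx hy
  have hd1 : |x' - y'| < τ :=
    (hd.trans (mul_le_of_le_one_left (abs_nonneg _) hκ)).trans_lt hxy
  have h1 : S.branch U η t G w y - S.phase t w x y • S.branch U η t G w x =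
      Complex.exp (Complex.I * (t * Ly : ℝ)) • U w ((Real.exp (η * Ly) : ℂ) • (G y' - G x') +
        ((Real.exp (η * Ly) : ℂ) - (Real.exp (η * Lx) : ℂ)) • G x') := by
    rw [branch_eq hw hy, branch_eq hw hx, phase]
    have h2 : Complex.exp (Complex.I * (t * Ly : ℝ)) =
        Complex.exp (Complex.I * (t * (Ly - Lx) : ℝ)) * Complex.exp (Complex.I * (t * Lx : ℝ)) := by
      rw [← Complex.exp_add]; congr 1; push_cast; ring
    rw [← hLx, ← hLy, h2]
    simp only [map_add, map_smul, map_sub]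
    module
  have h3 : |Real.exp (η * Ly) - Real.exp (η * Lx)| ≤ S.ampl η n * (2 / S.gap * |x - y|) := by
    refine (abs_exp_sub_exp_le (exp_log_deriv_le hw hy) (exp_log_deriv_le hw hx)).trans ?_
    refine mul_le_mul_of_nonneg_left ?_ (ampl_pos S η n).le
    rw [← mul_sub, abs_mul, abs_sub_comm]
    exact (mul_le_of_le_one_left (abs_nonneg _) hη).trans (log_deriv_lipschitz hw hx hy)
  rw [h1, norm_smul, norm_exp_I_mul, one_mul, LinearIsometryEquiv.norm_map]
  refine (norm_add_le _ _).trans ?_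
  rw [norm_smul, norm_smul, ← Complex.ofReal_sub, Complex.norm_real, Complex.norm_real,
    Real.norm_eq_abs, Real.norm_eq_abs, abs_of_pos (Real.exp_pos _)]
  have h4 : ‖G y' - G x'‖ ≤ ℓ x' * (S.kap n * |x - y|) := by
    rw [norm_sub_rev]
    exact (hG.lip k x' hx' y' hy' hd1).trans
      (mul_le_mul_of_nonneg_left hd (hG.nonneg _ (S.mem_Iall.2 ⟨k, hx'⟩)))
  have h5 := mul_le_mul (exp_log_deriv_le (η := η) hw hy) h4 (norm_nonneg _) (ampl_pos S η n).le
  have h6 := mul_le_mul_of_nonneg_right h3 (norm_nonneg (G x'))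
  refine (add_le_add h5 h6).trans (le_of_eq ?_)
  ring

lemma norm_branch_sub_le {τ : ℝ} {ℓ : ℝ → ℝ} (hG : S.Loc τ G ℓ) (hη : |η| ≤ 1)
    (hκ : S.kap n ≤ 1) (hw : w ∈ S.Words n i) (hx : x ∈ S.Ireal i) (hy : y ∈ S.Ireal i)
    (hxy : |x - y| < τ) :
    ‖S.branch U η t G w x - S.branch U η t G w y‖ ≤
      S.ampl η n * |x - y| * (2 / S.gap * (1 + |t|) * ‖G (mobiusR (S.wprod w) x)‖ +
        S.kap n * ℓ (mobiusR (S.wprod w) x)) := by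
  have h1 := norm_branch_sub_phase_le (U := U) (t := t) hG hη hκ hw hx hy hxy
  have h2 : ‖(S.phase t w x y - 1) • S.branch U η t G w x‖ ≤ (|t| * (2 / S.gap * |x - y|)) *
      (S.ampl η n * ‖G (mobiusR (S.wprod w) x)‖) := by
    rw [norm_smul]
    exact mul_le_mul (norm_phase_sub_one_le hw hx hy) (norm_branch_le hw hx) (norm_nonneg _)
      (mul_nonneg (abs_nonneg _) (mul_nonneg (div_nonneg two_pos.le S.gap_pos.le) (abs_nonneg _)))
  have h3 : S.branch U η t G w y - S.branch U η t G w x =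
      (S.branch U η t G w y - S.phase t w x y • S.branch U η t G w x) +
        (S.phase t w x y - 1) • S.branch U η t G w x := by module
  rw [norm_sub_rev, h3]
  refine (norm_add_le _ _).trans ((add_le_add h1 h2).trans (le_of_eq ?_))
  ring

lemma continuousOn_branch (hG : ContinuousOn G S.Iall) (hw : w ∈ S.Words n i) :
    ContinuousOn (S.branch U η t G w) (S.Ireal i) := by
  have h1 : ContinuousOn (fun x => Real.log (mobiusDerivR (S.wprod w) x)) (S.Ireal i) :=
    (continuousOn_deriv_word hw).log fun x hx => (words_deriv_pos hw hx).ne'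
  have h2 : ContinuousOn (fun x => U w (G (mobiusR (S.wprod w) x))) (S.Ireal i) :=
    (U w).continuous.comp_continuousOn (continuousOn_comp_word hG hw)
  have h3 : Continuous fun l : ℝ => (Real.exp (η * l) : ℂ) * Complex.exp (Complex.I * (t * l : ℝ)) := by
    fun_prop
  exact ((h3.comp_continuousOn h1).smul h2).congr fun x hx => branch_eq hw hx

end branch

end Schottky

lemma two_mul_weight {C d p q : ℝ} (hCd : C * d ≤ 1 / 2) (hp : 0 < p)
    (hpq : p ≤ Real.exp (C * d) * q) (hqp : q ≤ Real.exp (C * d) * p) (hC : 0 ≤ C * d) :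
    p ≤ 2 * q ∧ |p - q| ≤ 2 * C * d * p := by
  have h1 := Real.add_one_le_exp (-(C * d))
  have h2 : Real.exp (C * d) * Real.exp (-(C * d)) = 1 := by rw [← Real.exp_add]; simp
  have h3 := Real.exp_pos (C * d)
  set E := Real.exp (C * d)
  have h4 : E * (1 - C * d) ≤ 1 := by
    rw [← h2]; exact mul_le_mul_of_nonneg_left (by linarith) h3.le
  have hE : E ≤ 1 + 2 * (C * d) := by nlinarith
  have hq : 0 < q := by
    by_contra! h
    nlinarith
  have h5 : p * (1 - C * d) ≤ q := by nlinarith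
  refine ⟨by nlinarith, abs_le.2 ⟨by nlinarith, by nlinarith⟩⟩

namespace Schottky

variable {S : Schottky} {V : Type*} [NormedAddCommGroup V] [InnerProductSpace ℂ V]
  {C c₃ c₁ B τ₀ m₁ : ℝ} {ν : Measure ℝ} {W : List (Fin (2 * S.r)) → ℝ → ℝ}
  {U : List (Fin (2 * S.r)) → (V ≃ₗᵢ[ℂ] V)} {η t : ℝ} {G : ℝ → V} {n : ℕ}

lemma avg_mono {f g : ℝ → ℝ} (hW : ∀ i, ∀ w ∈ S.Words n i, ∀ x ∈ S.Ireal i, 0 < W w x)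
    (hfg : ∀ x ∈ S.Iall, f x ≤ g x) {x : ℝ} (hx : x ∈ S.Iall) :
    S.avg W n f x ≤ S.avg W n g x :=
  Finset.sum_le_sum fun w hw => mul_le_mul_of_nonneg_left
    (hfg _ (words_mem_Iall hw (mem_idx hx))) (hW _ w hw x (mem_idx hx)).le

lemma avg_nonneg {f : ℝ → ℝ} (hW : ∀ i, ∀ w ∈ S.Words n i, ∀ x ∈ S.Ireal i, 0 < W w x)
    (hf : ∀ x ∈ S.Iall, 0 ≤ f x) {x : ℝ} (hx : x ∈ S.Iall) : 0 ≤ S.avg W n f x :=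
  Finset.sum_nonneg fun w hw => mul_nonneg (hW _ w hw x (mem_idx hx)).le
    (hf _ (words_mem_Iall hw (mem_idx hx)))

lemma avg_sq_le (hW : ∀ i, ∀ w ∈ S.Words n i, ∀ x ∈ S.Ireal i, 0 < W w x)
    (h1 : ∀ i, ∀ x ∈ S.Ireal i, ∑ w ∈ S.Words n i, W w x = 1) (f : ℝ → ℝ) {x : ℝ}
    (hx : x ∈ S.Iall) : S.avg W n f x ^ 2 ≤ S.avg W n (fun x => f x ^ 2) x := by
  have h2 := mem_idx hx
  have h3 : 0 ≤ ∑ w ∈ S.Words n (S.idx x), W w x *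
      (f (mobiusR (S.wprod w) x) - S.avg W n f x) ^ 2 :=
    Finset.sum_nonneg fun w hw => mul_nonneg (hW _ w hw x h2).le (sq_nonneg _)
  have h4 : ∑ w ∈ S.Words n (S.idx x), W w x * (f (mobiusR (S.wprod w) x) - S.avg W n f x) ^ 2 =
      S.avg W n (fun x => f x ^ 2) x - 2 * S.avg W n f x * S.avg W n f x +
        S.avg W n f x ^ 2 * ∑ w ∈ S.Words n (S.idx x), W w x := by
    conv_rhs => rw [avg]
    conv_rhs => enter [1, 2, 2]; rw [avg]
    rw [Finset.mul_sum, Finset.mul_sum, ← Finset.sum_sub_distrib, ← Finset.sum_add_distrib]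
    exact Finset.sum_congr rfl fun w _ => by ring
  rw [h4, h1 _ x h2] at h3
  linarith

namespace Gibbs

lemma cont_step (h : S.Gibbs C c₃ c₁ B τ₀ m₁ ν W) (hG : ContinuousOn G S.Iall) :
    ContinuousOn (S.step W U η t n G) S.Iall :=
  continuousOn_idx (F := fun i x => ∑ w ∈ S.Words n i, (W w x : ℂ) • S.branch U η t G w x)
    fun i => continuousOn_finsetSum _ fun w hw =>
      (Complex.continuous_ofReal.comp_continuousOn (h.cont n i w hw)).smul
        (continuousOn_branch hG hw)

lemma norm_step_le (h : S.Gibbs C c₃ c₁ B τ₀ m₁ ν W) {x : ℝ} (hx : x ∈ S.Iall) :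
    ‖S.step W U η t n G x‖ ≤ S.ampl η n * S.avg W n (fun x => ‖G x‖) x := by
  have h2 := mem_idx hx
  refine (norm_sum_le _ _).trans ?_
  rw [avg, Finset.mul_sum]
  refine Finset.sum_le_sum fun w hw => ?_
  rw [norm_smul, Complex.norm_real, Real.norm_eq_abs, abs_of_pos (h.pos n _ w hw x h2)]
  calc _ ≤ W w x * (S.ampl η n * ‖G (mobiusR (S.wprod w) x)‖) :=
        mul_le_mul_of_nonneg_left (norm_branch_le hw h2) (h.pos n _ w hw x h2).le
    _ = _ := by ring

lemma norm_step_sq_le (h : S.Gibbs C c₃ c₁ B τ₀ m₁ ν W) {x : ℝ} (hx : x ∈ S.Iall) :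
    ‖S.step W U η t n G x‖ ^ 2 ≤ S.ampl η n ^ 2 * S.avg W n (fun x => ‖G x‖ ^ 2) x :=
  calc _ ≤ (S.ampl η n * S.avg W n (fun x => ‖G x‖) x) ^ 2 :=
        pow_le_pow_left₀ (norm_nonneg _) (h.norm_step_le hx) 2
    _ = S.ampl η n ^ 2 * S.avg W n (fun x => ‖G x‖) x ^ 2 := by ring
    _ ≤ _ := mul_le_mul_of_nonneg_left (avg_sq_le (h.pos n) (h.sum_one n) _ hx) (sq_nonneg _)

lemma bdd_step (h : S.Gibbs C c₃ c₁ B τ₀ m₁ ν W) {D : ℝ} (hG : ∀ x ∈ S.Iall, ‖G x‖ ≤ D) :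
    ∀ x ∈ S.Iall, ‖S.step W U η t n G x‖ ≤ S.ampl η n * D := by
  intro x hx
  refine (h.norm_step_le hx).trans (mul_le_mul_of_nonneg_left ?_ (ampl_pos S η n).le)
  refine (avg_mono (h.pos n) hG hx).trans (le_of_eq ?_)
  rw [avg, ← Finset.sum_mul, h.sum_one n _ x (mem_idx hx), one_mul]

lemma integral_step_le (h : S.Gibbs C c₃ c₁ B τ₀ m₁ ν W) (hG : ContinuousOn G S.Iall) {D : ℝ}
    (hD : ∀ x ∈ S.Iall, ‖G x‖ ≤ D) :
    ∫ x, ‖S.step W U η t n G x‖ ^ 2 ∂ν ≤ S.ampl η n ^ 2 * ∫ x, ‖G x‖ ^ 2 ∂ν := by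
  have := h.fin
  have hn : S.Nice fun x => ‖G x‖ ^ 2 := (nice_norm hG hD).pow
  rw [← h.inv n _ hn fun x _ => sq_nonneg _, ← integral_const_mul]
  refine integral_mono_ae
    ((nice_norm (h.cont_step hG) (h.bdd_step hD)).pow.integrable h.null)
    (((h.nice_avg n hn).integrable h.null).const_mul _) ?_
  filter_upwards [ae_mem_of_null h.null] with x hx using h.norm_step_sq_le hx

lemma loc_step (h : S.Gibbs C c₃ c₁ B τ₀ m₁ ν W) (hC : 0 ≤ C) {τ : ℝ} {ℓ : ℝ → ℝ}
    (hG : S.Loc τ G ℓ) (hη : |η| ≤ 1) (hκ : S.kap n ≤ 1) (hM : S.ampl η n ≤ 2) (ht : 1 ≤ |t|)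
    (hCτ : C * τ ≤ 1 / 2) :
    S.Loc τ (S.step W U η t n G) (S.avg W n fun x =>
      (2 * (8 / S.gap + 2 * C) * |t|) * ‖G x‖ + (4 * S.kap n) * ℓ x) := by
  have hg := S.gap_pos
  have hk := S.kap_pos n
  obtain ⟨D, hD⟩ := hG.bdd
  have hnice : S.Nice fun x => (2 * (8 / S.gap + 2 * C) * |t|) * ‖G x‖ + (4 * S.kap n) * ℓ x :=
    ((S.nice_const _).mul hG.nice_norm).add ((S.nice_const _).mul hG.nice)
  have hnn : ∀ x ∈ S.Iall,
      0 ≤ (2 * (8 / S.gap + 2 * C) * |t|) * ‖G x‖ + (4 * S.kap n) * ℓ x := fun x hx => by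
    have := hG.nonneg x hx
    positivity
  refine ⟨h.cont_step hG.cont, ⟨_, h.bdd_step hD⟩, h.nice_avg n hnice,
    fun x hx => avg_nonneg (h.pos n) hnn hx, fun i x hx y hy hxy => ?_⟩
  have hd := abs_nonneg (x - y)
  have hCd : C * |x - y| ≤ 1 / 2 := (mul_le_mul_of_nonneg_left hxy.le hC).trans hCτ
  rw [step, step, avg, idx_eq hx, idx_eq hy, ← Finset.sum_sub_distrib, Finset.sum_mul]
  refine (norm_sum_le _ _).trans (Finset.sum_le_sum fun w hw => ?_)
  have hpx := h.pos n i w hw x hx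
  have hpy := h.pos n i w hw y hy
  obtain ⟨-, hp⟩ := two_mul_weight hCd hpx (h.lip n i w hw x hx y hy)
    (by rw [abs_sub_comm]; exact h.lip n i w hw y hy x hx) (mul_nonneg hC hd)
  obtain ⟨hq, -⟩ := two_mul_weight hCd hpy
    (by rw [abs_sub_comm]; exact h.lip n i w hw y hy x hx) (h.lip n i w hw x hx y hy)
    (mul_nonneg hC hd)
  have h1 : (W w x : ℂ) • S.branch U η t G w x - (W w y : ℂ) • S.branch U η t G w y =
      ((W w x : ℂ) - W w y) • S.branch U η t G w x +
        (W w y : ℂ) • (S.branch U η t G w x - S.branch U η t G w y) := by module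
  have h2 := norm_branch_sub_le (U := U) (t := t) hG hη hκ hw hx hy hxy
  have h3 := norm_branch_le (U := U) (η := η) (t := t) (G := G) hw hx
  rw [h1]
  refine (norm_add_le _ _).trans ?_
  rw [norm_smul, norm_smul, ← Complex.ofReal_sub, Complex.norm_real, Complex.norm_real,
    Real.norm_eq_abs, Real.norm_eq_abs, abs_of_pos hpy]
  have hℓ := hG.nonneg _ (words_mem_Iall hw hx)
  set gx := ‖G (mobiusR (S.wprod w) x)‖ with hgx
  set lx := ℓ (mobiusR (S.wprod w) x)
  have hgx0 : 0 ≤ gx := norm_nonneg _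
  have ha := (ampl_pos S η n).le
  have h4 : |W w x - W w y| * ‖S.branch U η t G w x‖ ≤
      (2 * C * |x - y| * W w x) * (2 * gx * |t|) := by
    refine mul_le_mul hp (h3.trans ?_) (norm_nonneg _) (by positivity)
    nlinarith [mul_le_mul_of_nonneg_right hM hgx0, mul_le_mul_of_nonneg_left ht hgx0]
  have h5 : W w y * ‖S.branch U η t G w x - S.branch U η t G w y‖ ≤
      (2 * W w x) * (2 * |x - y| * (2 / S.gap * (2 * |t|) * gx + S.kap n * lx)) := by
    refine mul_le_mul hq (h2.trans ?_) (norm_nonneg _) (by positivity)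
    have hb : 2 / S.gap * (1 + |t|) * gx ≤ 2 / S.gap * (2 * |t|) * gx := by
      gcongr; linarith
    refine mul_le_mul (mul_le_mul_of_nonneg_right hM hd) (by linarith) (by positivity)
      (by positivity)
  refine (add_le_add h4 h5).trans (le_of_eq ?_)
  ring

/-- Away from low frequencies the twisted operator loses a definite amount of energy. -/
lemma energy_step (h : S.Gibbs C c₃ c₁ B τ₀ m₁ ν W) (hC : 0 ≤ C) (hc₃ : 0 ≤ c₃) (hc₁ : 0 < c₁)
    (hB : 0 < B) {τ : ℝ} {ℓ : ℝ → ℝ} (hG : S.Loc τ G ℓ) (hη : |η| ≤ 1) (hκ : S.kap (n + 1) ≤ 1)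
    (hτ : 0 < τ) (hτ₀ : τ ≤ τ₀) (hτg : τ < S.gap) (hCτ : C * τ ≤ 1 / 2)
    (htτ : |t| * τ = S.gap / 2) {c₅ : ℝ} (hc₅1 : c₅ ≤ 1)
    (hc : c₅ * (32 * B) ≤ (S.gap / S.span ^ 2 * c₁ * (S.gap / 2) / 2) ^ 2 * c₃) :
    ∫ x, ‖S.step W U η t (n + 1) G x‖ ^ 2 ∂ν ≤
      (1 - c₅ / 2) * (S.ampl η (n + 1) ^ 2 * ∫ x, ‖G x‖ ^ 2 ∂ν) +
      S.ampl η (n + 1) ^ 2 * τ ^ 2 / 4 * ((2 / S.gap) ^ 2 * (∫ x, ‖G x‖ ^ 2 ∂ν) +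
        S.kap (n + 1) ^ 2 * ∫ x, ℓ x ^ 2 ∂ν) := by
  have := h.fin
  have hg := S.gap_pos
  have hk := S.kap_pos (n + 1)
  have hsp : 0 < S.span := one_pos.trans_le S.one_le_span
  obtain ⟨D, hD⟩ := hG.bdd
  set M := S.ampl η (n + 1) with hM
  have hM0 : 0 < M := ampl_pos S η _
  set br := S.branch U η t G with hbr
  set c₂ := S.gap / S.span ^ 2 * c₁ * (S.gap / 2) / 2 with hc₂
  have hc₂0 : 0 ≤ c₂ := by positivity
  set Uf : ℝ → ℝ := fun x => ∑ w ∈ S.Words (n + 1) (S.idx x), W w x * ‖br w x‖ ^ 2 with hUf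
  set Vd : ℝ → ℝ := fun x => ∑ w ∈ S.Words (n + 1) (S.idx x), ∑ v ∈ S.Words (n + 1) (S.idx x),
    W w x * W v x * ‖br w x - br v x‖ ^ 2 with hVd
  have hcbr : ∀ i, ∀ w ∈ S.Words (n + 1) i, ContinuousOn (br w) (S.Ireal i) :=
    fun i w hw => continuousOn_branch hG.cont hw
  have hvar : ∀ x ∈ S.Iall, ‖S.step W U η t (n + 1) G x‖ ^ 2 + Vd x / 2 = Uf x :=
    fun x hx => norm_sq_sum_add_variance _ (fun w => W w x) (fun w => br w x)
      (h.sum_one _ _ x (mem_idx hx))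
  have hVd0 : ∀ x ∈ S.Iall, 0 ≤ Vd x := fun x hx => Finset.sum_nonneg fun w hw =>
    Finset.sum_nonneg fun v hv => mul_nonneg (mul_nonneg (h.pos _ _ w hw x (mem_idx hx)).le
      (h.pos _ _ v hv x (mem_idx hx)).le) (sq_nonneg _)
  have hUf0 : ∀ x ∈ S.Iall, 0 ≤ Uf x := fun x hx => Finset.sum_nonneg fun w hw =>
    mul_nonneg (h.pos _ _ w hw x (mem_idx hx)).le (sq_nonneg _)
  have hUle : ∀ x ∈ S.Iall, Uf x ≤ M ^ 2 * S.avg W (n + 1) (fun x => ‖G x‖ ^ 2) x := by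
    intro x hx
    rw [avg, Finset.mul_sum]
    refine Finset.sum_le_sum fun w hw => ?_
    have h1 := pow_le_pow_left₀ (norm_nonneg _)
      (norm_branch_le (U := U) (η := η) (t := t) (G := G) hw (mem_idx hx)) 2
    have h2 := mul_le_mul_of_nonneg_left h1 (h.pos _ _ w hw x (mem_idx hx)).le
    refine h2.trans (le_of_eq ?_)
    ring
  have hstepN : S.Nice fun x => ‖S.step W U η t (n + 1) G x‖ ^ 2 :=
    (Schottky.nice_norm (h.cont_step hG.cont) (h.bdd_step hD)).pow
  have hGN : S.Nice fun x => ‖G x‖ ^ 2 := hG.nice_norm.pow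
  have hUN : S.Nice Uf := by
    refine ⟨continuousOn_idx (F := fun i x => ∑ w ∈ S.Words (n + 1) i, W w x * ‖br w x‖ ^ 2)
      fun i => continuousOn_finsetSum _ fun w hw =>
        (h.cont _ i w hw).mul ((hcbr i w hw).norm.pow 2), M ^ 2 * D ^ 2, fun x hx => ?_⟩
    rw [abs_of_nonneg (hUf0 x hx)]
    refine (hUle x hx).trans (mul_le_mul_of_nonneg_left ?_ (sq_nonneg _))
    refine (avg_mono (g := fun _ => D ^ 2) (h.pos _) (fun y hy =>
      pow_le_pow_left₀ (norm_nonneg _) (hD y hy) 2) hx).trans (le_of_eq ?_)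
    rw [avg, ← Finset.sum_mul, h.sum_one _ _ x (mem_idx hx), one_mul]
  have hVN : S.Nice Vd := by
    have h1 : S.Nice fun x => 2 * (Uf x + (-1) * ‖S.step W U η t (n + 1) G x‖ ^ 2) :=
      (S.nice_const 2).mul (hUN.add ((S.nice_const (-1)).mul hstepN))
    exact h1.congr fun x hx => by linarith [hvar x hx]
  set K : ℝ → ℝ := fun x => 16 * M ^ 2 * τ ^ 2 * (2 / S.gap) ^ 2 * ‖G x‖ ^ 2 +
    16 * M ^ 2 * τ ^ 2 * S.kap (n + 1) ^ 2 * ℓ x ^ 2 with hK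
  have hKN : S.Nice K := ((S.nice_const _).mul hGN).add ((S.nice_const _).mul hG.nice.pow)
  have hK0 : ∀ x ∈ S.Iall, 0 ≤ K x := fun x _ => by positivity
  have hiU := hUN.integrable h.null
  have hiV := hVN.integrable h.null
  have hiS := hstepN.integrable h.null
  have hmain : ∫ x, c₂ ^ 2 * c₃ * Uf x ∂ν ≤ 2 * B * ∫ x, 16 * Vd x ∂ν +
      B * ∫ x, S.avg W (n + 1) K x ∂ν := by
    obtain ⟨m, hm, hann⟩ := h.ann τ hτ hτ₀
    refine integral_le_of_symm_rel (R := {z | c₁ * τ ≤ |z.1 - z.2| ∧ |z.1 - z.2| < τ})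
      (P := S.Iall) ?_ ?_ (ae_mem_of_null h.null) (hiU.const_mul _) (hiV.const_mul _)
      ((h.nice_avg _ hKN).integrable h.null) (fun x hx => mul_nonneg (by positivity) (hUf0 x hx))
      (fun x hx => mul_nonneg (by norm_num) (hVd0 x hx))
      (fun x hx => avg_nonneg (h.pos _) hK0 hx) ?_ hm hann
    · have hm : Measurable fun z : ℝ × ℝ => |z.1 - z.2| := by fun_prop
      exact (measurableSet_le measurable_const hm).inter (measurableSet_lt hm measurable_const)
    · intro x y hxy
      simpa only [Set.mem_ofPred_eq, abs_sub_comm x y] using hxy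
    rintro x hxI y hyI ⟨hl, hu⟩
    simp only at hl hu
    obtain ⟨i, hx⟩ := S.mem_Iall.1 hxI
    have hy : y ∈ S.Ireal i := by
      obtain ⟨j, hy⟩ := S.mem_Iall.1 hyI
      by_cases hij : i = j
      · rwa [hij]
      · have := S.gap_le hij (S.mem_Ireal.1 hx).le (S.mem_Ireal.1 hy).le
        linarith
    have hd := abs_nonneg (x - y)
    have hCd : C * |x - y| ≤ 1 / 2 := (mul_le_mul_of_nonneg_left hu.le hC).trans hCτ
    have hps := phase_spread (S.Words (n + 1) i) (fun w => W w x) (fun w => W w y)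
      (fun w => M * τ * (2 / S.gap * ‖G (mobiusR (S.wprod w) x)‖ +
        S.kap (n + 1) * ℓ (mobiusR (S.wprod w) x)))
      (fun w => br w x) (fun w => br w y) (fun w => S.phase t w x y) (fun w => w.getLast?)
      (c₂ := c₂) (c₃ := c₃) hc₂0 (fun w hw => (h.pos _ i w hw x hx).le)
      (fun w hw => (two_mul_weight hCd (h.pos _ i w hw x hx) (h.lip _ i w hw x hx y hy)
        (by rw [abs_sub_comm]; exact h.lip _ i w hw y hy x hx) (mul_nonneg hC hd)).1)
      (h.sum_one _ i x hx) (fun w _ => norm_phase t w x y) ?_ ?_ ?_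
    · simp only [hUf, hVd, idx_eq hx, idx_eq hy]
      refine hps.trans ?_
      have hVx := hVd0 x hxI
      simp only [hVd, idx_eq hx] at hVx
      have h8 : 8 * ∑ w ∈ S.Words (n + 1) i, W w x *
          (M * τ * (2 / S.gap * ‖G (mobiusR (S.wprod w) x)‖ +
            S.kap (n + 1) * ℓ (mobiusR (S.wprod w) x))) ^ 2 ≤ S.avg W (n + 1) K x := by
        rw [avg, idx_eq hx, Finset.mul_sum]
        refine Finset.sum_le_sum fun w hw => ?_
        have hp := (h.pos _ i w hw x hx).le
        simp only [hK]
        have : ∀ a b : ℝ, 8 * (M * τ * (a + b)) ^ 2 ≤ 16 * M ^ 2 * τ ^ 2 * (a ^ 2 + b ^ 2) := by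
          intro a b
          nlinarith [mul_nonneg (sq_nonneg (M * τ)) (sq_nonneg (a - b))]
        refine le_trans (le_of_eq ?_) ((mul_le_mul_of_nonneg_left
          (this (2 / S.gap * ‖G (mobiusR (S.wprod w) x)‖)
            (S.kap (n + 1) * ℓ (mobiusR (S.wprod w) x))) hp).trans (le_of_eq ?_))
        · ring
        · ring
      linarith
    · intro w hw
      refine (norm_branch_sub_phase_le hG hη hκ hw hx hy hu).trans ?_
      have := hG.nonneg _ (words_mem_Iall hw hx)
      gcongr
    · intro w hw v hv hL
      obtain ⟨j, hj, b, hb, rfl⟩ := mem_words_succ.1 hw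
      obtain ⟨j', hj', b', hb', rfl⟩ := mem_words_succ.1 hv
      have hjj : j ≠ j' := fun hh => hL (by simp [hh])
      have hlow := log_deriv_uni hb hj hb' hj' hjj hx hy
      have h1 := log_deriv_lipschitz hw hx hy
      have h2 := log_deriv_lipschitz hv hx hy
      set p := S.wprod (b ++ [j])
      set q := S.wprod (b' ++ [j'])
      have ht0 := abs_nonneg t
      have e1 : |t * (Real.log (mobiusDerivR p y) - Real.log (mobiusDerivR p x)) -
          t * (Real.log (mobiusDerivR q y) - Real.log (mobiusDerivR q x))| =
          |t| * |(Real.log (mobiusDerivR p x) - Real.log (mobiusDerivR p y)) -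
            (Real.log (mobiusDerivR q x) - Real.log (mobiusDerivR q y))| := by
        rw [← abs_mul, ← abs_neg]; congr 1; ring
      refine le_trans ?_ (le_norm_exp_sub_exp ?_)
      · rw [e1]
        have h3 : S.gap / S.span ^ 2 * (c₁ * τ) ≤ S.gap / S.span ^ 2 * |x - y| := by gcongr
        have h4 := mul_le_mul_of_nonneg_left (h3.trans hlow) ht0
        have h5 : |t| * (S.gap / S.span ^ 2 * (c₁ * τ)) =
          S.gap / S.span ^ 2 * c₁ * (S.gap / 2) := by rw [← htτ]; ring
        rw [hc₂]
        linarith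
      · rw [e1]
        have h3 := (abs_sub _ _).trans (add_le_add h1 h2)
        have h4 : 2 / S.gap * |x - y| ≤ 2 / S.gap * τ := by gcongr
        have h5 := mul_le_mul_of_nonneg_left (h3.trans (add_le_add h4 h4)) ht0
        have h6 : |t| * (2 / S.gap * τ + 2 / S.gap * τ) = 2 := by
          have : |t| * (2 / S.gap * τ + 2 / S.gap * τ) = 4 / S.gap * (|t| * τ) := by ring
          rw [this, htτ]; field_simp; norm_num
        linarith
    · intro w hw
      obtain ⟨j, hj, b, hb, rfl⟩ := mem_words_succ.1 hw
      have := h.spread n i x hx j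
      simpa using this
  have hIU : ∫ x, Uf x ∂ν ≤ M ^ 2 * ∫ x, ‖G x‖ ^ 2 ∂ν := by
    rw [← h.inv (n + 1) _ hGN fun x _ => sq_nonneg _, ← integral_const_mul]
    refine integral_mono_ae hiU (((h.nice_avg _ hGN).integrable h.null).const_mul _) ?_
    filter_upwards [ae_mem_of_null h.null] with x hx using hUle x hx
  have hIvar : ∫ x, ‖S.step W U η t (n + 1) G x‖ ^ 2 ∂ν + (∫ x, Vd x ∂ν) / 2 = ∫ x, Uf x ∂ν := by
    rw [← integral_div, ← integral_add hiS (hiV.div_const 2)]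
    refine integral_congr_ae ?_
    filter_upwards [ae_mem_of_null h.null] with x hx using hvar x hx
  have hIU0 : 0 ≤ ∫ x, Uf x ∂ν := integral_nonneg_of_ae (by
    filter_upwards [ae_mem_of_null h.null] with x hx using hUf0 x hx)
  have hIK : ∫ x, S.avg W (n + 1) K x ∂ν = 16 * M ^ 2 * τ ^ 2 * ((2 / S.gap) ^ 2 *
      (∫ x, ‖G x‖ ^ 2 ∂ν) + S.kap (n + 1) ^ 2 * ∫ x, ℓ x ^ 2 ∂ν) := by
    rw [h.inv _ K hKN hK0, hK, integral_add ((hGN.integrable h.null).const_mul _)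
      ((hG.nice.pow.integrable h.null).const_mul _), integral_const_mul, integral_const_mul]
    ring
  rw [integral_const_mul, integral_const_mul, hIK] at hmain
  set IU := ∫ x, Uf x ∂ν
  set IV := ∫ x, Vd x ∂ν
  set IS := ∫ x, ‖S.step W U η t (n + 1) G x‖ ^ 2 ∂ν
  set R := (2 / S.gap) ^ 2 * (∫ x, ‖G x‖ ^ 2 ∂ν) + S.kap (n + 1) ^ 2 * ∫ x, ℓ x ^ 2 ∂ν
  have h1 : c₅ * (32 * B) * IU ≤ 2 * B * (16 * IV) + B * (16 * M ^ 2 * τ ^ 2 * R) :=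
    (mul_le_mul_of_nonneg_right hc hIU0).trans hmain
  have h2 : B * (c₅ * 32 * IU) ≤ B * (32 * IV + 16 * M ^ 2 * τ ^ 2 * R) := by linarith
  have h3 := le_of_mul_le_mul_left h2 hB
  have h4 : (1 - c₅ / 2) * IU ≤ (1 - c₅ / 2) * (M ^ 2 * ∫ x, ‖G x‖ ^ 2 ∂ν) :=
    mul_le_mul_of_nonneg_left hIU (by linarith)
  linarith

end Gibbs

end Schottky

namespace Schottky

variable {S : Schottky} {V : Type*} [NormedAddCommGroup V] [InnerProductSpace ℂ V]
  {C c₃ c₁ B τ₀ m₁ : ℝ} {ν : Measure ℝ} {W : List (Fin (2 * S.r)) → ℝ → ℝ}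
  {U : List (Fin (2 * S.r)) → (V ≃ₗᵢ[ℂ] V)} {η t : ℝ} {G : ℝ → V} {n : ℕ}

omit [InnerProductSpace ℂ V] in
lemma Gibbs.integral_avg_sq_le (h : S.Gibbs C c₃ c₁ B τ₀ m₁ ν W) {τ : ℝ} {ℓ : ℝ → ℝ}
    (hG : S.Loc τ G ℓ) (a b : ℝ) :
    ∫ x, S.avg W n (fun x => a * ‖G x‖ + b * ℓ x) x ^ 2 ∂ν ≤
      2 * a ^ 2 * (∫ x, ‖G x‖ ^ 2 ∂ν) + 2 * b ^ 2 * ∫ x, ℓ x ^ 2 ∂ν := by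
  have := h.fin
  have hN : S.Nice fun x => a * ‖G x‖ + b * ℓ x :=
    ((S.nice_const _).mul hG.nice_norm).add ((S.nice_const _).mul hG.nice)
  have h1 := hG.nice_norm.pow.integrable h.null
  have h2 := hG.nice.pow.integrable h.null
  calc _ ≤ ∫ x, S.avg W n (fun x => (a * ‖G x‖ + b * ℓ x) ^ 2) x ∂ν := by
        refine integral_mono_ae ((h.nice_avg n hN).pow.integrable h.null)
          ((h.nice_avg n hN.pow).integrable h.null) ?_
        filter_upwards [ae_mem_of_null h.null] with x hx using
          avg_sq_le (h.pos n) (h.sum_one n) _ hx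
    _ = ∫ x, (a * ‖G x‖ + b * ℓ x) ^ 2 ∂ν := h.inv n _ hN.pow fun x _ => sq_nonneg _
    _ ≤ ∫ x, (2 * a ^ 2 * ‖G x‖ ^ 2 + 2 * b ^ 2 * ℓ x ^ 2) ∂ν := by
        refine integral_mono_ae (hN.pow.integrable h.null)
          ((h1.const_mul _).add (h2.const_mul _)) (Filter.Eventually.of_forall fun x => ?_)
        have := sq_nonneg (a * ‖G x‖ - b * ℓ x)
        simp only
        linarith
    _ = _ := by
        rw [integral_add (h1.const_mul _) (h2.const_mul _), integral_const_mul, integral_const_mul]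

/-- Bookkeeping for the contraction of the mixed energy. -/
lemma contraction_arith {c₅ C₅ g κ lam M τ t E L E' L' : ℝ} (hg : 0 < g)
    (hc₅ : 0 < c₅) (hc₅1 : c₅ ≤ 1) (hlam : 0 < lam) (hE : 0 ≤ E) (hL : 0 ≤ L) (ht : 0 < t ^ 2)
    (hlamC : 2 * lam * C₅ ^ 2 = c₅ / 16) (hκ : κ ^ 2 * (g ^ 2 / 4 + 32 * lam) ≤ lam / 2)
    (htc : 1 / t ^ 2 ≤ c₅ / 16) (hM : M ^ 2 ≤ 1 + c₅ / 4) (hτ : τ ^ 2 = g ^ 2 / 4 / t ^ 2)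
    (hE' : E' ≤ (1 - c₅ / 2) * (M ^ 2 * E) +
      M ^ 2 * τ ^ 2 / 4 * ((2 / g) ^ 2 * E + κ ^ 2 * L))
    (hL' : L' ≤ 2 * (C₅ * |t|) ^ 2 * E + 2 * (4 * κ) ^ 2 * L) :
    E' + lam * (L' / t ^ 2) ≤ (1 - c₅ / 8) * (E + lam * (L / t ^ 2)) := by
  obtain ⟨D, hD⟩ : ∃ D, D = L / t ^ 2 := ⟨_, rfl⟩
  have hLD : L = D * t ^ 2 := by rw [hD, div_mul_cancel₀ _ ht.ne']
  have hD0 : 0 ≤ D := by rw [hD]; positivity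
  rw [← hD]
  have hL2 : L' / t ^ 2 ≤ 2 * C₅ ^ 2 * E + 32 * κ ^ 2 * D := by
    rw [div_le_iff₀ ht]
    refine hL'.trans (le_of_eq ?_)
    rw [hLD, mul_pow, sq_abs]
    ring
  have h1 : (1 - c₅ / 2) * (M ^ 2 * E) ≤ (1 - c₅ / 4) * E := by
    have h0 : (1 - c₅ / 2) * M ^ 2 ≤ (1 - c₅ / 2) * (1 + c₅ / 4) :=
      mul_le_mul_of_nonneg_left hM (by linarith)
    have h0' : (1 - c₅ / 2) * M ^ 2 ≤ 1 - c₅ / 4 := by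
      have := mul_pos hc₅ hc₅
      linarith
    have := mul_le_mul_of_nonneg_right h0' hE
    linarith
  have h4 : τ ^ 2 * ((2 / g) ^ 2 * E + κ ^ 2 * L) =
      1 / t ^ 2 * E + κ ^ 2 * (g ^ 2 / 4) * D := by
    have htt : t ≠ 0 := fun h => by simp [h] at ht
    rw [hτ, hLD]; field_simp; ring
  have h2 : M ^ 2 * τ ^ 2 / 4 * ((2 / g) ^ 2 * E + κ ^ 2 * L) ≤
      c₅ / 16 * E + κ ^ 2 * (g ^ 2 / 4) * D := by
    have h3 : M ^ 2 / 4 ≤ 1 := by linarith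
    have h5 : 0 ≤ τ ^ 2 * ((2 / g) ^ 2 * E + κ ^ 2 * L) := by positivity
    have h7 := mul_le_mul_of_nonneg_right htc hE
    calc _ = M ^ 2 / 4 * (τ ^ 2 * ((2 / g) ^ 2 * E + κ ^ 2 * L)) := by ring
      _ ≤ 1 * (τ ^ 2 * ((2 / g) ^ 2 * E + κ ^ 2 * L)) := mul_le_mul_of_nonneg_right h3 h5
      _ ≤ _ := by rw [one_mul, h4]; linarith
  have h8 := mul_le_mul_of_nonneg_left hL2 hlam.le
  have h9 := mul_le_mul_of_nonneg_right hκ hD0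
  have h10 : lam * (2 * C₅ ^ 2 * E) = c₅ / 16 * E := by rw [← hlamC]; ring
  have h11 : lam / 2 * D ≤ (1 - c₅ / 8) * (lam * D) := by
    have h12 : 0 ≤ lam * D := by positivity
    have : 0 ≤ (1 - c₅) * (lam * D) := mul_nonneg (by linarith) h12
    linarith
  have h13 : 0 ≤ c₅ * E := by positivity
  linarith

/-- A suitable power of the twisted operator contracts a mixed energy. -/
theorem exists_contraction (S : Schottky) {C c₃ c₁ B τ₀ : ℝ} (hC : 0 ≤ C) (hc₃ : 0 < c₃)
    (hc₁ : 0 < c₁) (hB : 0 < B) (hτ₀ : 0 < τ₀) (m₁ : ℝ) :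
    ∃ (n : ℕ) (lam q ε T : ℝ), 0 < n ∧ 0 < lam ∧ 0 < q ∧ q < 1 ∧ 0 < ε ∧ ε ≤ 1 ∧ 1 ≤ T ∧
      ∀ (ν : Measure ℝ) (W : List (Fin (2 * S.r)) → ℝ → ℝ), S.Gibbs C c₃ c₁ B τ₀ m₁ ν W →
      ∀ (V : Type) [NormedAddCommGroup V] [InnerProductSpace ℂ V]
        (U : List (Fin (2 * S.r)) → (V ≃ₗᵢ[ℂ] V)) (η t : ℝ), |η| ≤ ε → T ≤ |t| →
      ∀ (G : ℝ → V) (ℓ : ℝ → ℝ), S.Loc (S.gap / 2 / |t|) G ℓ →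
        ∃ ℓ', S.Loc (S.gap / 2 / |t|) (S.step W U η t n G) ℓ' ∧
          ∫ x, ‖S.step W U η t n G x‖ ^ 2 ∂ν + lam * ((∫ x, ℓ' x ^ 2 ∂ν) / t ^ 2) ≤
            q * (∫ x, ‖G x‖ ^ 2 ∂ν + lam * ((∫ x, ℓ x ^ 2 ∂ν) / t ^ 2)) := by
  have hg := S.gap_pos
  have hsp : 0 < S.span := one_pos.trans_le S.one_le_span
  obtain ⟨c₅, hc₅, hc₅1, hc⟩ : ∃ c₅ : ℝ, 0 < c₅ ∧ c₅ ≤ 1 ∧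
      c₅ * (32 * B) ≤ (S.gap / S.span ^ 2 * c₁ * (S.gap / 2) / 2) ^ 2 * c₃ := by
    set Q := (S.gap / S.span ^ 2 * c₁ * (S.gap / 2) / 2) ^ 2 * c₃ with hQ
    have hQ0 : 0 < Q := by positivity
    refine ⟨min 1 (Q / (32 * B)), lt_min one_pos (by positivity), min_le_left _ _, ?_⟩
    calc _ ≤ Q / (32 * B) * (32 * B) :=
          mul_le_mul_of_nonneg_right (min_le_right _ _) (by positivity)
      _ = Q := by field_simp
  set C₅ := 2 * (8 / S.gap + 2 * C) with hC₅
  have hC₅0 : 0 < C₅ := by positivity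
  set lam := c₅ / (32 * C₅ ^ 2) with hlam
  have hlam0 : 0 < lam := by positivity
  have hlamC : 2 * lam * C₅ ^ 2 = c₅ / 16 := by rw [hlam]; field_simp; norm_num
  obtain ⟨n, hκ1, hκ2⟩ : ∃ n : ℕ, S.kap (n + 1) ≤ 1 ∧
      S.kap (n + 1) ^ 2 * (S.gap ^ 2 / 4 + 32 * lam) ≤ lam / 2 := by
    have hK : 0 < S.gap ^ 2 / 4 + 32 * lam := by positivity
    have hev := (S.tendsto_kap.comp (Filter.tendsto_add_atTop_nat 1)).eventually
      (gt_mem_nhds (lt_min one_pos (show 0 < lam / 2 / (S.gap ^ 2 / 4 + 32 * lam) by positivity)))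
    obtain ⟨n, hn⟩ := hev.exists
    simp only [Function.comp_apply, lt_min_iff] at hn
    have hk := S.kap_pos (n + 1)
    refine ⟨n, hn.1.le, ?_⟩
    have h1 := (lt_div_iff₀ hK).1 hn.2
    have h2 : S.kap (n + 1) ^ 2 ≤ S.kap (n + 1) := by nlinarith [hn.1]
    exact (mul_le_mul_of_nonneg_right h2 hK.le).trans h1.le
  set A := ((n + 1 : ℕ) : ℝ) * |Real.log S.dC| + 1 with hA
  have hA0 : 0 < A := by positivity
  have hl0 : 0 < Real.log (1 + c₅ / 4) := Real.log_pos (by linarith)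
  refine ⟨n + 1, lam, 1 - c₅ / 8, min 1 (Real.log (1 + c₅ / 4) / (2 * A)),
    1 + 16 / c₅ + S.gap / 2 / τ₀ + C * S.gap, n.succ_pos, hlam0, by linarith, by linarith,
    lt_min one_pos (by positivity), min_le_left _ _, ?_, ?_⟩
  · have : 0 ≤ 16 / c₅ + S.gap / 2 / τ₀ + C * S.gap := by positivity
    linarith
  intro ν W h V _ _ U η t hη ht G ℓ hG
  have e1 : 0 ≤ 16 / c₅ := by positivity
  have e2 : 0 ≤ S.gap / 2 / τ₀ := by positivity
  have e3 : 0 ≤ C * S.gap := by positivity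
  have ht1 : 1 ≤ |t| := by linarith
  have ht0 : 0 < |t| := by linarith
  have htc : 1 / t ^ 2 ≤ c₅ / 16 := by
    rw [← sq_abs, div_le_div_iff₀ (by positivity) (by norm_num)]
    have : 16 / c₅ ≤ |t| := by linarith
    rw [div_le_iff₀ hc₅] at this
    nlinarith
  have hη1 : |η| ≤ 1 := hη.trans (min_le_left _ _)
  set M := S.ampl η (n + 1) with hM
  have hM0 : 0 < M := ampl_pos S η _
  have hM2 : M ^ 2 ≤ 1 + c₅ / 4 := by
    have h1 : |η| * A ≤ Real.log (1 + c₅ / 4) / 2 := by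
      have := hη.trans (min_le_right _ _)
      rw [le_div_iff₀ (by positivity)] at this
      linarith
    have h2 : |η| * (((n + 1 : ℕ) : ℝ) * Real.log S.dC) ≤ |η| * A := by
      refine mul_le_mul_of_nonneg_left ?_ (abs_nonneg _)
      have := mul_le_mul_of_nonneg_left (le_abs_self (Real.log S.dC))
        (Nat.cast_nonneg (α := ℝ) (n + 1))
      linarith
    calc M ^ 2 = Real.exp (2 * (|η| * (((n + 1 : ℕ) : ℝ) * Real.log S.dC))) := by
          rw [hM, ampl, ← Real.exp_nat_mul]; norm_num
      _ ≤ Real.exp (Real.log (1 + c₅ / 4)) := Real.exp_le_exp.2 (by linarith)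
      _ = _ := Real.exp_log (by linarith)
  have hMle : M ≤ 2 := by nlinarith
  set τ := S.gap / 2 / |t| with hτ
  have hτ0 : 0 < τ := by positivity
  have hττ : τ ≤ τ₀ := by
    rw [hτ, div_le_iff₀ ht0]
    have : S.gap / 2 / τ₀ ≤ |t| := by linarith
    rw [div_le_iff₀ hτ₀] at this
    linarith
  have hτg : τ < S.gap := by
    rw [hτ, div_lt_iff₀ ht0]
    nlinarith
  have hCτ : C * τ ≤ 1 / 2 := by
    have : C * τ = (C * S.gap) / (2 * |t|) := by rw [hτ]; field_simp
    rw [this, div_le_div_iff₀ (by positivity) two_pos]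
    linarith
  have htτ : |t| * τ = S.gap / 2 := by rw [hτ]; field_simp
  have hτ2 : τ ^ 2 = S.gap ^ 2 / 4 / t ^ 2 := by rw [hτ, div_pow, sq_abs]; ring
  refine ⟨_, h.loc_step hC hG hη1 hκ1 hMle ht1 hCτ, ?_⟩
  have hE := h.energy_step (U := U) (t := t) hC hc₃.le hc₁ hB hG hη1 hκ1 hτ0 hττ hτg hCτ htτ hc₅1 hc
  have hL := h.integral_avg_sq_le (n := n + 1) hG (C₅ * |t|) (4 * S.kap (n + 1))
  have hE0 : 0 ≤ ∫ x, ‖G x‖ ^ 2 ∂ν := integral_nonneg fun x => sq_nonneg _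
  have hL0 : 0 ≤ ∫ x, ℓ x ^ 2 ∂ν := integral_nonneg fun x => sq_nonneg _
  have ht2 : 0 < t ^ 2 := by rw [← sq_abs]; positivity
  exact contraction_arith hg hc₅ hc₅1 hlam0 hE0 hL0 ht2 hlamC hκ2 htc hM2 hτ2 hE hL

end Schottky

namespace Schottky

variable {S : Schottky} {V : Type*} [NormedAddCommGroup V] [InnerProductSpace ℂ V]

/-- The iterates of the twisted transfer operator as finite sums. -/
noncomputable def twist (S : Schottky) (s : ℂ) (ρ : S.SGroup →* (V ≃ₗᵢ[ℂ] V)) (n : ℕ)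
    (F : ℝ → V) (x : ℝ) : V :=
  ∑ w ∈ S.Words n (S.idx x), ((mobiusDerivR (S.wprod w) x : ℂ) ^ s) •
    ρ (S.wprodG w)⁻¹ (F (mobiusR (S.wprod w) x))

lemma lIterate_eq_twist (s : ℂ) (ρ : S.SGroup →* (V ≃ₗᵢ[ℂ] V)) (n : ℕ) (F : ℝ → V) {x : ℝ}
    (hx : x ∈ S.Iall) : S.LIterate s ρ n F x = S.twist s ρ n F x := by
  have h : ∃ i, x ∈ S.Ireal i := S.mem_Iall.1 hx
  have hi : S.idx x = h.choose := by rw [idx, dif_pos h]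
  have hset : {w : List (Fin (2 * S.r)) | IsWord w ∧ w.length = n ∧ arrow w [h.choose]} =
      (S.Words n (S.idx x) : Set (List (Fin (2 * S.r)))) := by
    ext w
    rw [Finset.mem_coe, mem_words_iff, hi]
    rfl
  rw [LIterate, dif_pos h, hset, finsum_mem_coe_finset, twist]

lemma twist_congr {s : ℂ} {ρ : S.SGroup →* (V ≃ₗᵢ[ℂ] V)} {n : ℕ} {F H : ℝ → V}
    (h : ∀ x ∈ S.Iall, F x = H x) {x : ℝ} (hx : x ∈ S.Iall) :
    S.twist s ρ n F x = S.twist s ρ n H x :=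
  Finset.sum_congr rfl fun w hw => by rw [h _ (words_mem_Iall hw (mem_idx hx))]

lemma twist_succ (s : ℂ) (ρ : S.SGroup →* (V ≃ₗᵢ[ℂ] V)) (n : ℕ) (F : ℝ → V) {x : ℝ}
    (hx : x ∈ S.Iall) : S.twist s ρ (n + 1) F x =
      ∑ j ∈ S.Pred (S.idx x), ((mobiusDerivR (S.g j) x : ℂ) ^ s) •
        ρ (S.genG j)⁻¹ (S.twist s ρ n F (mobiusR (S.g j) x)) := by
  rw [twist, sum_words_succ]
  refine Finset.sum_congr rfl fun j hj => ?_
  have hij := mem_Pred.1 hj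
  rw [twist, idx_g hx hj, map_sum, Finset.smul_sum]
  refine Finset.sum_congr rfl fun b hb => ?_
  obtain ⟨h1, h2⟩ := words_succ_apply hij b (mem_idx hx)
  have hG : S.wprodG (b ++ [j]) = S.wprodG b * S.genG j :=
    Subtype.ext (wprod_append_singleton b j)
  rw [h1, h2, hG, mul_inv_rev, map_mul, Complex.ofReal_mul,
    Complex.mul_cpow_ofReal_nonneg (mobiusDerivR_nonneg _ _) (mobiusDerivR_nonneg _ _),
    LinearIsometryEquiv.coe_mul, Function.comp_apply, map_smul, smul_smul, mul_comm]

lemma twist_zero (s : ℂ) (ρ : S.SGroup →* (V ≃ₗᵢ[ℂ] V)) (F : ℝ → V) (x : ℝ) :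
    S.twist s ρ 0 F x = F x := by
  have hG : S.wprodG [] = 1 := rfl
  have h1 : S.wprod [] = 1 := rfl
  rw [twist, Words, Finset.sum_singleton, hG, h1, inv_one, map_one, LinearIsometryEquiv.coe_one]
  simp [mobiusDerivR, mobiusR]

lemma twist_add (s : ℂ) (ρ : S.SGroup →* (V ≃ₗᵢ[ℂ] V)) (m n : ℕ) (F : ℝ → V) {x : ℝ}
    (hx : x ∈ S.Iall) : S.twist s ρ (m + n) F x = S.twist s ρ n (S.twist s ρ m F) x := by
  induction n generalizing x with
  | zero => rw [twist_zero, add_zero]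
  | succ n ih =>
    rw [← add_assoc, twist_succ s ρ _ F hx, twist_succ s ρ n _ hx]
    exact Finset.sum_congr rfl fun j hj =>
      by rw [ih (S.mem_Iall.2 ⟨j, S.g_mem (mem_Pred.1 hj) (mem_idx hx)⟩)]

lemma Conf.twist_eig {δ : ℝ} (hδ : 0 ≤ δ) {μ : Measure ℝ} (hμ : S.Conf δ μ)
    (ρ : S.SGroup →* (V ≃ₗᵢ[ℂ] V)) (η t : ℝ) (n : ℕ) (G : ℝ → V) {x : ℝ} (hx : x ∈ S.Iall) :
    S.twist ((δ : ℂ) + ((η : ℂ) + t * Complex.I)) ρ n (fun y => (S.eig δ μ y : ℂ) • G y) x =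
      (S.eig δ μ x : ℂ) •
        S.step (S.wt δ μ) (fun w => ρ (S.wprodG w)⁻¹) η t n G x := by
  rw [twist, step, Finset.smul_sum]
  refine Finset.sum_congr rfl fun w hw => ?_
  have hd := words_deriv_pos hw (mem_idx hx)
  have he : (S.eig δ μ x : ℂ) ≠ 0 := by exact_mod_cast (hμ.eig_pos hδ hx).ne'
  rw [branch, wt, smul_smul, smul_smul, map_smul, smul_smul,
    Complex.cpow_add _ _ (by exact_mod_cast hd.ne')]
  congr 1
  rw [← Complex.ofReal_cpow hd.le]
  push_cast
  field_simp

lemma Conf.twist_iterate {δ : ℝ} (hδ : 0 ≤ δ) {μ : Measure ℝ} (hμ : S.Conf δ μ)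
    (ρ : S.SGroup →* (V ≃ₗᵢ[ℂ] V)) (η t : ℝ) (n : ℕ) (G : ℝ → V) (k : ℕ) {x : ℝ}
    (hx : x ∈ S.Iall) :
    S.twist ((δ : ℂ) + ((η : ℂ) + t * Complex.I)) ρ (n * k)
        (fun y => (S.eig δ μ y : ℂ) • G y) x =
      (S.eig δ μ x : ℂ) •
        (S.step (S.wt δ μ) (fun w => ρ (S.wprodG w)⁻¹) η t n)^[k] G x := by
  induction k generalizing x with
  | zero => rw [mul_zero, twist_zero]; rfl
  | succ k ih =>
    rw [mul_add, mul_one, twist_add _ _ _ _ _ hx, twist_congr (fun y hy => ih hy) hx,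
      hμ.twist_eig hδ ρ η t n _ hx, Function.iterate_succ_apply']

end Schottky

lemma le_biSup_of_bdd {f : ℝ → ℝ} {s : Set ℝ} {C : ℝ} (hC : ∀ x ∈ s, f x ≤ C) {x : ℝ}
    (hx : x ∈ s) : f x ≤ ⨆ y ∈ s, f y := by
  have hb : BddAbove (Set.range fun y => ⨆ _ : y ∈ s, f y) := by
    refine ⟨max C 0, ?_⟩
    rintro _ ⟨y, rfl⟩
    by_cases hy : y ∈ s
    · simp only [hy, ciSup_unique]; exact (hC y hy).trans (le_max_left _ _)
    · simp [hy]
  refine le_trans (le_of_eq ?_) (le_ciSup hb x)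
  simp [hx]

namespace Schottky

variable {S : Schottky}

lemma closure_Iall_eq (S : Schottky) : closure S.Iall = ⋃ i, closure (S.Ireal i) := by
  rw [Iall, closure_iUnion_of_finite]

lemma isCompact_closure_Iall (S : Schottky) : IsCompact (closure S.Iall) := by
  rw [S.closure_Iall_eq]
  refine isCompact_iUnion fun i => ?_
  rw [Ireal_eq_ball]
  exact Metric.isBounded_ball.isCompact_closure

lemma uniqueDiffOn_closure_Iall (S : Schottky) : UniqueDiffOn ℝ (closure S.Iall) := by
  intro x hx
  rw [S.closure_Iall_eq] at hx ⊢
  obtain ⟨i, hi⟩ := Set.mem_iUnion.1 hx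
  refine UniqueDiffWithinAt.mono (uniqueDiffOn_convex (S.Ireal_convex i).closure ?_ x hi)
    (Set.subset_iUnion (fun i => closure (S.Ireal i)) i)
  refine Set.Nonempty.mono (interior_mono subset_closure) ?_
  rw [(S.isOpen_Ireal i).interior_eq, Ireal_eq_ball]
  exact ⟨_, Metric.mem_ball_self (S.radius_pos i)⟩

variable {V : Type*} [NormedAddCommGroup V] [NormedSpace ℝ V] {F : ℝ → V}

lemma norm_le_biSup (hF : ContDiffOn ℝ 1 F (closure S.Iall)) {x : ℝ} (hx : x ∈ S.Iall) :
    ‖F x‖ ≤ ⨆ y ∈ S.Iall, ‖F y‖ := by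
  obtain ⟨C, hC⟩ := S.isCompact_closure_Iall.exists_bound_of_continuousOn hF.continuousOn
  exact le_biSup_of_bdd (fun y hy => hC y (subset_closure hy)) hx

lemma norm_deriv_le_biSup (hF : ContDiffOn ℝ 1 F (closure S.Iall)) {x : ℝ} (hx : x ∈ S.Iall) :
    ‖deriv F x‖ ≤ ⨆ y ∈ S.Iall, ‖deriv F y‖ := by
  obtain ⟨C, hC⟩ := S.isCompact_closure_Iall.exists_bound_of_continuousOn
    (hF.continuousOn_derivWithin S.uniqueDiffOn_closure_Iall le_rfl)
  refine le_biSup_of_bdd (f := fun y => ‖deriv F y‖) (C := C) (fun y hy => ?_) hx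
  rw [← derivWithin_of_mem_nhds (Filter.mem_of_superset (S.isOpen_Iall.mem_nhds hy)
    subset_closure)]
  exact hC y (subset_closure hy)

lemma norm_sub_le_biSup (hF : ContDiffOn ℝ 1 F (closure S.Iall)) {i : Fin (2 * S.r)} {x y : ℝ}
    (hx : x ∈ S.Ireal i) (hy : y ∈ S.Ireal i) :
    ‖F x - F y‖ ≤ (⨆ y ∈ S.Iall, ‖deriv F y‖) * |x - y| := by
  have hI : ∀ z ∈ S.Ireal i, z ∈ S.Iall := fun z hz => S.mem_Iall.2 ⟨i, hz⟩
  refine (S.Ireal_convex i).norm_image_sub_le_of_norm_deriv_le (𝕜 := ℝ) (fun z hz => ?_)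
    (fun z hz => norm_deriv_le_biSup hF (hI z hz)) hy hx
  exact (hF.contDiffAt (Filter.mem_of_superset (S.isOpen_Iall.mem_nhds (hI z hz))
    subset_closure)).differentiableAt one_ne_zero

lemma Conf.abs_inv_eig_sub_le {δ : ℝ} (hδ : 0 ≤ δ) {μ : Measure ℝ} (hμ : S.Conf δ μ)
    {i : Fin (2 * S.r)} {x y : ℝ} (hx : x ∈ S.Ireal i) (hy : y ∈ S.Ireal i) (hxy : |x - y| ≤ 1) :
    |(S.eig δ μ x)⁻¹ - (S.eig δ μ y)⁻¹| ≤
      S.eigLip δ * Real.exp (S.eigLip δ) / S.eigLow δ * |x - y| := by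
  have hxI := S.mem_Iall.2 ⟨i, hx⟩
  have hyI := S.mem_Iall.2 ⟨i, hy⟩
  have hL : 0 ≤ S.eigLip δ := div_nonneg (by linarith) S.gap_pos.le
  have hlow := S.eigLow_pos δ
  have key : ∀ x ∈ S.Ireal i, ∀ y ∈ S.Ireal i, |x - y| ≤ 1 → (S.eig δ μ x)⁻¹ - (S.eig δ μ y)⁻¹ ≤
      S.eigLip δ * Real.exp (S.eigLip δ) / S.eigLow δ * |x - y| := by
    intro x hx y hy hxy
    have hxI := S.mem_Iall.2 ⟨i, hx⟩
    have hyI := S.mem_Iall.2 ⟨i, hy⟩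
    have h1 := hμ.eig_lip hδ hy hx
    rw [abs_sub_comm] at h1
    have hpx := hμ.eig_pos hδ hxI
    have hpy := hμ.eig_pos hδ hyI
    set u := S.eigLip δ * |x - y| with hu
    have hu0 : 0 ≤ u := by positivity
    have h2 : (S.eig δ μ x)⁻¹ ≤ Real.exp u * (S.eig δ μ y)⁻¹ := by
      rw [inv_le_iff_one_le_mul₀ hpx, mul_assoc, inv_mul_eq_div, ← mul_div_assoc, le_div_iff₀ hpy,
        one_mul]
      exact h1
    have h3 : Real.exp u - 1 ≤ u * Real.exp (S.eigLip δ) := by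
      have h4 := Real.add_one_le_exp (-u)
      have h5 : Real.exp u * Real.exp (-u) = 1 := by rw [← Real.exp_add]; simp
      have h6 : Real.exp u ≤ Real.exp (S.eigLip δ) :=
        Real.exp_le_exp.2 (mul_le_of_le_one_right hL hxy)
      have h7 := mul_le_mul_of_nonneg_left h4 (Real.exp_pos u).le
      have h8 := mul_le_mul_of_nonneg_left h6 hu0
      linarith
    have h9 : (S.eig δ μ y)⁻¹ ≤ (S.eigLow δ)⁻¹ := inv_anti₀ hlow (hμ.eig_bounds hδ hyI).1
    calc _ ≤ (Real.exp u - 1) * (S.eig δ μ y)⁻¹ := by linarith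
      _ ≤ (u * Real.exp (S.eigLip δ)) * (S.eigLow δ)⁻¹ :=
        mul_le_mul h3 h9 (inv_pos.2 hpy).le (by positivity)
      _ = _ := by rw [hu]; ring
  rw [abs_le]
  have h1 := key x hx y hy hxy
  have h2 := key y hy x hx (by rwa [abs_sub_comm])
  rw [abs_sub_comm] at h2
  constructor <;> linarith

end Schottky

namespace Schottky

variable {S : Schottky} {V : Type*} [NormedAddCommGroup V] [InnerProductSpace ℂ V]

/-- Lipschitz constant of the inverse of the eigenfunction. -/
noncomputable def invLip (S : Schottky) (δ : ℝ) : ℝ :=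
  S.eigLip δ * Real.exp (S.eigLip δ) / S.eigLow δ

lemma invLip_nonneg (S : Schottky) {δ : ℝ} (hδ : 0 ≤ δ) : 0 ≤ S.invLip δ :=
  div_nonneg (mul_nonneg (div_nonneg (by linarith) S.gap_pos.le) (Real.exp_pos _).le)
    (S.eigLow_pos δ).le

namespace Conf

variable {δ : ℝ} {μ : Measure ℝ} {F : ℝ → V}

lemma norm_div_eig_le (hδ : 0 ≤ δ) (hμ : S.Conf δ μ) (hF : ContDiffOn ℝ 1 F (closure S.Iall))
    {x : ℝ} (hx : x ∈ S.Iall) :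
    ‖(((S.eig δ μ x)⁻¹ : ℝ) : ℂ) • F x‖ ≤ (⨆ y ∈ S.Iall, ‖F y‖) / S.eigLow δ := by
  have he := hμ.eig_pos hδ hx
  rw [norm_smul, Complex.norm_real, Real.norm_eq_abs, abs_of_pos (inv_pos.2 he), div_eq_inv_mul]
  exact mul_le_mul (inv_anti₀ (S.eigLow_pos δ) (hμ.eig_bounds hδ hx).1) (norm_le_biSup hF hx)
    (norm_nonneg _) (inv_pos.2 (S.eigLow_pos δ)).le

lemma loc_div_eig (hδ : 0 ≤ δ) (hμ : S.Conf δ μ) (hF : ContDiffOn ℝ 1 F (closure S.Iall))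
    {τ : ℝ} (hτ : τ ≤ 1) :
    S.Loc τ (fun x => (((S.eig δ μ x)⁻¹ : ℝ) : ℂ) • F x)
      (fun _ => (⨆ y ∈ S.Iall, ‖deriv F y‖) / S.eigLow δ +
        S.invLip δ * ⨆ y ∈ S.Iall, ‖F y‖) := by
  have hlow := S.eigLow_pos δ
  have hB : 0 ≤ ⨆ y ∈ S.Iall, ‖deriv F y‖ :=
    Real.iSup_nonneg fun _ => Real.iSup_nonneg fun _ => norm_nonneg _
  have hA : 0 ≤ ⨆ y ∈ S.Iall, ‖F y‖ :=
    Real.iSup_nonneg fun _ => Real.iSup_nonneg fun _ => norm_nonneg _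
  have hL := S.invLip_nonneg hδ
  refine ⟨?_, ⟨_, fun x hx => hμ.norm_div_eig_le hδ hF hx⟩, S.nice_const _,
    fun x _ => by positivity, fun i x hx y hy hxy => ?_⟩
  · exact (Complex.continuous_ofReal.comp_continuousOn ((hμ.continuousOn_eig hδ).inv₀
      fun x hx => (hμ.eig_pos hδ hx).ne')).smul (hF.continuousOn.mono subset_closure)
  have hxI := S.mem_Iall.2 ⟨i, hx⟩
  have hyI := S.mem_Iall.2 ⟨i, hy⟩
  have h1 : (((S.eig δ μ x)⁻¹ : ℝ) : ℂ) • F x - (((S.eig δ μ y)⁻¹ : ℝ) : ℂ) • F y =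
      (((S.eig δ μ x)⁻¹ : ℝ) : ℂ) • (F x - F y) +
        (((S.eig δ μ x)⁻¹ - (S.eig δ μ y)⁻¹ : ℝ) : ℂ) • F y := by
    push_cast; module
  rw [h1, add_mul]
  refine (norm_add_le _ _).trans (add_le_add ?_ ?_)
  · rw [norm_smul, Complex.norm_real, Real.norm_eq_abs, abs_of_pos (inv_pos.2 (hμ.eig_pos hδ hxI)),
      div_eq_inv_mul, mul_assoc]
    exact mul_le_mul (inv_anti₀ hlow (hμ.eig_bounds hδ hxI).1) (norm_sub_le_biSup hF hx hy)
      (norm_nonneg _) (inv_pos.2 hlow).le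
  · rw [norm_smul, Complex.norm_real, Real.norm_eq_abs, mul_right_comm]
    exact mul_le_mul (hμ.abs_inv_eig_sub_le hδ hx hy (hxy.le.trans hτ)) (norm_le_biSup hF hyI)
      (norm_nonneg _) (mul_nonneg hL (abs_nonneg _))

lemma integral_sq_eig_smul (hδ : 0 ≤ δ) (hμ : S.Conf δ μ) {H : ℝ → V}
    (hH : ContinuousOn H S.Iall) {D : ℝ} (hD : ∀ x ∈ S.Iall, ‖H x‖ ≤ D) :
    Integrable (fun x => ‖(S.eig δ μ x : ℂ) • H x‖ ^ 2) μ ∧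
    ∫ x, ‖(S.eig δ μ x : ℂ) • H x‖ ^ 2 ∂μ ≤
      S.eigUp δ * ∫ x, ‖H x‖ ^ 2 ∂(μ.withDensity (S.eigE δ μ)) := by
  have := hμ.prob
  have hn := nice_norm hH hD
  have he : S.Nice (S.eig δ μ) := ⟨hμ.continuousOn_eig hδ, S.eigUp δ, fun x hx => by
    rw [abs_of_pos (hμ.eig_pos hδ hx)]; exact (hμ.eig_bounds hδ hx).2⟩
  have heq : ∀ x ∈ S.Iall, ‖(S.eig δ μ x : ℂ) • H x‖ ^ 2 = (S.eig δ μ x * ‖H x‖) ^ 2 := by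
    intro x hx
    rw [norm_smul, Complex.norm_real, Real.norm_eq_abs, abs_of_pos (hμ.eig_pos hδ hx)]
  have hi : Integrable (fun x => ‖(S.eig δ μ x : ℂ) • H x‖ ^ 2) μ :=
    ((he.mul hn).pow.congr heq).integrable hμ.null
  refine ⟨hi, ?_⟩
  rw [integral_withDensity_eq_integral_toReal_smul (measurable_eigE δ μ)
    (by filter_upwards [hμ.ae_mem] with x hx using
      (hμ.eigE_bounds hδ hx).2.trans_lt ENNReal.ofReal_lt_top), ← integral_const_mul]
  refine integral_mono_ae hi (((he.mul hn.pow).integrable hμ.null).const_mul _) ?_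
  filter_upwards [hμ.ae_mem] with x hx
  have h1 := hμ.eig_bounds hδ hx
  have h2 := hμ.eig_pos hδ hx
  have h3 : (S.eigE δ μ x).toReal • ‖H x‖ ^ 2 = S.eig δ μ x * ‖H x‖ ^ 2 := rfl
  simp only [heq x hx, h3]
  rw [mul_pow, sq (S.eig δ μ x), mul_assoc]
  exact mul_le_mul_of_nonneg_right h1.2 (by positivity)

end Conf

omit [InnerProductSpace ℂ V] in
/-- Iterating a contraction of the mixed energy. -/
lemma iterate_contraction {τ t lam q : ℝ} {ν : Measure ℝ} (hq : 0 ≤ q)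
    {P : (ℝ → V) → ℝ → V} (hP : ∀ G ℓ, S.Loc τ G ℓ → ∃ ℓ', S.Loc τ (P G) ℓ' ∧
      ∫ x, ‖P G x‖ ^ 2 ∂ν + lam * ((∫ x, ℓ' x ^ 2 ∂ν) / t ^ 2) ≤
        q * (∫ x, ‖G x‖ ^ 2 ∂ν + lam * ((∫ x, ℓ x ^ 2 ∂ν) / t ^ 2)))
    {G : ℝ → V} {ℓ : ℝ → ℝ} (hG : S.Loc τ G ℓ) (k : ℕ) :
    ∃ ℓ', S.Loc τ (P^[k] G) ℓ' ∧
      ∫ x, ‖P^[k] G x‖ ^ 2 ∂ν + lam * ((∫ x, ℓ' x ^ 2 ∂ν) / t ^ 2) ≤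
        q ^ k * (∫ x, ‖G x‖ ^ 2 ∂ν + lam * ((∫ x, ℓ x ^ 2 ∂ν) / t ^ 2)) := by
  induction k with
  | zero => exact ⟨ℓ, hG, by simp⟩
  | succ k ih =>
    obtain ⟨ℓ₁, h1, h2⟩ := ih
    obtain ⟨ℓ₂, h3, h4⟩ := hP _ _ h1
    rw [Function.iterate_succ_apply']
    refine ⟨ℓ₂, h3, h4.trans ?_⟩
    rw [pow_succ' q k, mul_assoc]
    exact mul_le_mul_of_nonneg_left h2 hq

end Schottky

lemma pow_floor_div_le {q : ℝ} (hq : 0 < q) (hq1 : q ≤ 1) {n : ℕ} (hn : 0 < n) (L : ℝ) :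
    q ^ (⌊L⌋₊ / n) ≤ q⁻¹ * Real.exp (L * Real.log q / n) := by
  have hn' : (0 : ℝ) < n := by exact_mod_cast hn
  have h1 : L / n ≤ ((⌊L⌋₊ / n : ℕ) : ℝ) + 1 := by
    rw [div_le_iff₀ hn']
    have h2 : ⌊L⌋₊ + 1 ≤ (⌊L⌋₊ / n + 1) * n := by
      have := Nat.div_add_mod ⌊L⌋₊ n
      have := Nat.mod_lt ⌊L⌋₊ hn
      nlinarith
    have h3 : ((⌊L⌋₊ : ℝ) + 1) ≤ (((⌊L⌋₊ / n : ℕ) : ℝ) + 1) * n := by exact_mod_cast h2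
    exact (Nat.lt_floor_add_one L).le.trans h3
  have hlog : Real.log q ≤ 0 := Real.log_nonpos hq.le hq1
  have h4 : q ^ (⌊L⌋₊ / n) = Real.exp (((⌊L⌋₊ / n : ℕ) : ℝ) * Real.log q) := by
    rw [Real.exp_nat_mul, Real.exp_log hq]
  have h5 : q⁻¹ = Real.exp (-Real.log q) := by rw [Real.exp_neg, Real.exp_log hq]
  rw [h4, h5, ← Real.exp_add]
  refine Real.exp_le_exp.2 ?_
  have h6 := mul_le_mul_of_nonpos_right h1 hlog
  have h7 : L * Real.log q / n = L / n * Real.log q := by ring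
  rw [h7]
  linarith

namespace Schottky

variable {S : Schottky}

lemma not_conf_zero (μ : Measure ℝ) : ¬ S.Conf 0 μ := by
  intro h
  have := h.prob
  have hcard : ∀ i : Fin (2 * S.r), 2 ≤ (S.Pred i).card := by
    intro i
    have he : S.Pred i = Finset.univ.erase (wordBar i) := by
      ext j
      rw [mem_Pred, ne_wordBar_comm, Finset.mem_erase]
      simp
    rw [he, Finset.card_erase_of_mem (Finset.mem_univ _), Finset.card_univ, Fintype.card_fin]
    have := S.two_le_r
    omega
  have h1 := h.inv_one (fun _ => 1) measurable_const
  have h2 : ∫⁻ _, 2 ∂μ ≤ ∫⁻ x, S.opL 0 1 (fun _ => 1) x ∂μ := by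
    refine lintegral_mono fun x => ?_
    rw [opL_one_apply]
    simp only [Real.rpow_zero, ENNReal.ofReal_one, mul_one, Finset.sum_const, nsmul_eq_mul]
    exact_mod_cast hcard _
  rw [← h1] at h2
  simp only [lintegral_const, measure_univ, mul_one] at h2
  exact absurd h2 (by norm_num)

variable {V : Type*} [NormedAddCommGroup V] [InnerProductSpace ℂ V]

omit [InnerProductSpace ℂ V] in
lemma mixed_energy_le {C c₃ c₁ B τ₀ m₁ lam δ t : ℝ} {ν : Measure ℝ}
    {W : List (Fin (2 * S.r)) → ℝ → ℝ} (h : S.Gibbs C c₃ c₁ B τ₀ m₁ ν W) (hδ : 0 ≤ δ)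
    (hlam : 0 ≤ lam) (ht : 1 ≤ |t|) {G : ℝ → V} {a b : ℝ} (hG : S.Nice fun x => ‖G x‖)
    (ha : 0 ≤ a) (hb : 0 ≤ b) (hle : ∀ x ∈ S.Iall, ‖G x‖ ≤ a / S.eigLow δ) :
    ∫ x, ‖G x‖ ^ 2 ∂ν +
        lam * ((∫ _, (b / S.eigLow δ + S.invLip δ * a) ^ 2 ∂ν) / t ^ 2) ≤
      m₁ * ((1 / S.eigLow δ) ^ 2 + lam * (1 / S.eigLow δ + S.invLip δ) ^ 2) *
        (a + |t|⁻¹ * b) ^ 2 := by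
  have := h.fin
  have hlow := S.eigLow_pos δ
  have hL := S.invLip_nonneg hδ
  have hm := h.mass
  have hm0 : 0 ≤ ν.real Set.univ := measureReal_nonneg
  have ht0 : 0 < |t| := one_pos.trans_le ht
  set Q := a + |t|⁻¹ * b with hQ
  have haQ : a ≤ Q := by rw [hQ]; have := mul_nonneg (inv_pos.2 ht0).le hb; linarith
  have hbQ : |t|⁻¹ * b ≤ Q := by rw [hQ]; linarith
  have hQ0 : 0 ≤ Q := ha.trans haQ
  have h1 : ∫ x, ‖G x‖ ^ 2 ∂ν ≤ m₁ * ((1 / S.eigLow δ) ^ 2 * Q ^ 2) := by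
    calc _ ≤ ∫ _, (1 / S.eigLow δ * Q) ^ 2 ∂ν := by
          refine integral_mono_ae (hG.pow.integrable h.null) (integrable_const _) ?_
          filter_upwards [ae_mem_of_null h.null] with x hx
          refine pow_le_pow_left₀ (norm_nonneg _) ((hle x hx).trans ?_) 2
          rw [one_div_mul_eq_div]
          exact div_le_div_of_nonneg_right haQ hlow.le
      _ ≤ _ := by
          rw [integral_const, smul_eq_mul, mul_pow]
          exact mul_le_mul_of_nonneg_right hm (by positivity)
  have h2 : (∫ _, (b / S.eigLow δ + S.invLip δ * a) ^ 2 ∂ν) / t ^ 2 ≤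
      m₁ * ((1 / S.eigLow δ + S.invLip δ) ^ 2 * Q ^ 2) := by
    rw [integral_const, smul_eq_mul, mul_div_assoc, ← sq_abs t, ← div_pow, ← mul_pow]
    have h4 : (b / S.eigLow δ + S.invLip δ * a) / |t| ≤ (1 / S.eigLow δ + S.invLip δ) * Q := by
      have h6 : (b / S.eigLow δ + S.invLip δ * a) / |t| =
          1 / S.eigLow δ * (|t|⁻¹ * b) + S.invLip δ * (a / |t|) := by field_simp
      rw [h6, add_mul]
      exact add_le_add (mul_le_mul_of_nonneg_left hbQ (by positivity))
        (mul_le_mul_of_nonneg_left ((div_le_self ha ht).trans haQ) hL)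
    have h5 : 0 ≤ (b / S.eigLow δ + S.invLip δ * a) / |t| := by positivity
    exact mul_le_mul hm (pow_le_pow_left₀ h5 h4 2) (by positivity) (hm0.trans hm)
  have h3 := mul_le_mul_of_nonneg_left h2 hlam
  linarith

end Schottky

namespace Schottky

lemma wtLip_nonneg (S : Schottky) {δ : ℝ} (hδ : 0 ≤ δ) : 0 ≤ S.wtLip δ := by
  have hg := S.gap_pos
  have hk := (S.kap_pos 0).le
  unfold wtLip eigLip
  positivity

/-- Decay of the twisted iterates for `δ > 0`. -/
theorem exists_decay (S : Schottky) {δ : ℝ} (hδ : 0 < δ) :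
    ∃ ε T₀ β : ℝ, 0 < ε ∧ 1 ≤ T₀ ∧ 0 < β ∧ ∀ μ : Measure ℝ, S.Conf δ μ →
      ∀ (V : Type) [NormedAddCommGroup V] [InnerProductSpace ℂ V]
        (ρ : S.SGroup →* (V ≃ₗᵢ[ℂ] V)) (η t : ℝ), |η| ≤ ε → T₀ ≤ |t| →
      ∀ F : ℝ → V, ContDiffOn ℝ 1 F (closure S.Iall) →
        ∫ x in S.limitSetR, ‖S.LIterate ((δ : ℂ) + ((η : ℂ) + t * Complex.I)) ρ
            ⌊Real.log |t|⌋₊ F x‖ ^ 2 ∂μ ≤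
          ((⨆ x ∈ S.Iall, ‖F x‖) + |t|⁻¹ * ⨆ x ∈ S.Iall, ‖deriv F x‖) ^ 2 / |t| ^ β := by
  obtain ⟨c₁, B, τ₀, hc₁, hB, hτ₀, hgibbs⟩ := S.exists_gibbs hδ
  obtain ⟨n, lam, q, ε, T, hn, hlam, hq, hq1, hε, hε1, hT, hcontr⟩ :=
    S.exists_contraction (C := S.wtLip δ) (c₃ := S.wtLow δ) (wtLip_nonneg S hδ.le) (wtLow_pos S δ)
      hc₁ hB hτ₀ (S.eigUp δ)
  have hlow := S.eigLow_pos δ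
  have hup := S.eigUp_pos δ
  have hL := S.invLip_nonneg hδ.le
  have hn' : (0 : ℝ) < n := by exact_mod_cast hn
  have hlogq : Real.log q < 0 := Real.log_neg hq hq1
  set A := Real.exp (n * Real.log S.dC) with hA
  set K := S.eigUp δ * ((1 / S.eigLow δ) ^ 2 + lam * (1 / S.eigLow δ + S.invLip δ) ^ 2) with hK
  have hK0 : 0 < K := by positivity
  set M := S.eigUp δ * (A ^ 2 * (q⁻¹ * K)) with hM
  have hM0 : 0 < M := by positivity
  set β := -Real.log q / (2 * n) with hβ
  have hβ0 : 0 < β := div_pos (neg_pos.2 hlogq) (by positivity)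
  refine ⟨ε, max T (Real.exp (Real.log M / β)), β, hε, hT.trans (le_max_left _ _), hβ0, ?_⟩
  intro μ hμ V _ _ ρ η t hη ht F hF
  have hTt : T ≤ |t| := (le_max_left _ _).trans ht
  have ht1 : 1 ≤ |t| := hT.trans hTt
  have ht0 : 0 < |t| := one_pos.trans_le ht1
  have hh := hgibbs μ hμ
  have := hμ.prob
  have := hh.fin
  have hτ : S.gap / 2 / |t| ≤ 1 := by
    rw [div_le_one ht0]
    have := S.gap_le_one
    linarith
  set U : List (Fin (2 * S.r)) → (V ≃ₗᵢ[ℂ] V) := fun w => ρ (S.wprodG w)⁻¹ with hU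
  set G : ℝ → V := fun x => (((S.eig δ μ x)⁻¹ : ℝ) : ℂ) • F x with hG
  set ν := μ.withDensity (S.eigE δ μ) with hν
  have hloc : S.Loc (S.gap / 2 / |t|) G _ := hμ.loc_div_eig hδ.le hF hτ
  obtain ⟨ℓ, hℓ, hE⟩ := iterate_contraction hq.le
    (fun G ℓ hG => hcontr ν _ hh V U η t hη hTt G ℓ hG) hloc (⌊Real.log |t|⌋₊ / n)
  set k := ⌊Real.log |t|⌋₊ / n with hk
  set m := ⌊Real.log |t|⌋₊ % n with hm
  have hN : ⌊Real.log |t|⌋₊ = n * k + m := (Nat.div_add_mod _ _).symm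
  set H := (S.step (S.wt δ μ) U η t n)^[k] G with hH
  obtain ⟨D, hD⟩ := hℓ.bdd
  set Hm := S.step (S.wt δ μ) U η t m H with hHm
  have hFG : ∀ x ∈ S.Iall, F x = (S.eig δ μ x : ℂ) • G x := by
    intro x hx
    have he := (hμ.eig_pos hδ.le hx).ne'
    rw [hG]
    simp only
    rw [smul_smul, ← Complex.ofReal_mul, mul_inv_cancel₀ he, Complex.ofReal_one, one_smul]
  have hiter : ∀ x ∈ S.Iall, S.LIterate ((δ : ℂ) + ((η : ℂ) + t * Complex.I)) ρ
      ⌊Real.log |t|⌋₊ F x = (S.eig δ μ x : ℂ) • Hm x := by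
    intro x hx
    rw [lIterate_eq_twist _ _ _ _ hx, hN, twist_add _ _ _ _ _ hx,
      twist_congr (fun y hy => (twist_congr hFG hy).trans
        (hμ.twist_iterate hδ.le ρ η t n G k hy)) hx]
    exact hμ.twist_eig hδ.le ρ η t m H hx
  obtain ⟨hint, hbound⟩ := hμ.integral_sq_eig_smul hδ.le (hh.cont_step (U := U) (η := η) (t := t)
    (n := m) hℓ.cont) (hh.bdd_step hD)
  have hae : (fun x => ‖S.LIterate ((δ : ℂ) + ((η : ℂ) + t * Complex.I)) ρ
      ⌊Real.log |t|⌋₊ F x‖ ^ 2) =ᵐ[μ] fun x => ‖(S.eig δ μ x : ℂ) • Hm x‖ ^ 2 := by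
    filter_upwards [hμ.ae_mem] with x hx
    rw [hiter x hx]
  set a := ⨆ x ∈ S.Iall, ‖F x‖ with ha
  set b := ⨆ x ∈ S.Iall, ‖deriv F x‖ with hb
  have ha0 : 0 ≤ a := Real.iSup_nonneg fun _ => Real.iSup_nonneg fun _ => norm_nonneg _
  have hb0 : 0 ≤ b := Real.iSup_nonneg fun _ => Real.iSup_nonneg fun _ => norm_nonneg _
  set Q := (a + |t|⁻¹ * b) ^ 2 with hQ
  have hQ0 : 0 ≤ Q := sq_nonneg _
  have hinit := mixed_energy_le (t := t) hh hδ.le hlam.le ht1 hloc.nice_norm ha0 hb0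
    (fun x hx => hμ.norm_div_eig_le hδ.le hF hx)
  have hHE : ∫ x, ‖H x‖ ^ 2 ∂ν ≤ q ^ k * (K * Q) := by
    have h1 : 0 ≤ lam * ((∫ x, ℓ x ^ 2 ∂ν) / t ^ 2) :=
      mul_nonneg hlam.le (div_nonneg (integral_nonneg fun x => sq_nonneg _) (sq_nonneg _))
    have h2 := mul_le_mul_of_nonneg_left hinit (pow_nonneg hq.le k)
    linarith
  have hmE := hh.integral_step_le (U := U) (η := η) (t := t) (n := m) hℓ.cont hD
  have hampl : S.ampl η m ^ 2 ≤ A ^ 2 := by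
    refine pow_le_pow_left₀ (ampl_pos S η m).le (Real.exp_le_exp.2 ?_) 2
    have h1 : (m : ℝ) ≤ n := by exact_mod_cast (Nat.mod_lt _ hn).le
    have h2 := Real.log_nonneg S.one_le_dC
    calc |η| * (m * Real.log S.dC) ≤ 1 * (m * Real.log S.dC) :=
          mul_le_mul_of_nonneg_right (hη.trans hε1) (by positivity)
      _ ≤ _ := by rw [one_mul]; exact mul_le_mul_of_nonneg_right h1 h2
  have hqk := pow_floor_div_le hq hq1.le hn (Real.log |t|)
  have hfinal : M * Real.exp (Real.log |t| * Real.log q / n) ≤ (|t| ^ β)⁻¹ := by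
    rw [← Real.exp_log hM0, Real.rpow_def_of_pos ht0, ← Real.exp_neg, ← Real.exp_add]
    refine Real.exp_le_exp.2 ?_
    have h1 : Real.log M / β ≤ Real.log |t| :=
      (Real.le_log_iff_exp_le ht0).2 ((le_max_right _ _).trans ht)
    rw [div_le_iff₀ hβ0] at h1
    have h2 : Real.log |t| * Real.log q / n = -(2 * (Real.log |t| * β)) := by
      rw [hβ]; field_simp
    rw [h2]
    linarith
  calc _ ≤ ∫ x, ‖S.LIterate ((δ : ℂ) + ((η : ℂ) + t * Complex.I)) ρ
        ⌊Real.log |t|⌋₊ F x‖ ^ 2 ∂μ :=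
        setIntegral_le_integral (hint.congr hae.symm)
          (Filter.Eventually.of_forall fun x => sq_nonneg _)
    _ = ∫ x, ‖(S.eig δ μ x : ℂ) • Hm x‖ ^ 2 ∂μ := integral_congr_ae hae
    _ ≤ S.eigUp δ * (A ^ 2 * (q⁻¹ * Real.exp (Real.log |t| * Real.log q / n) * (K * Q))) := by
        refine hbound.trans (mul_le_mul_of_nonneg_left (hmE.trans ?_) hup.le)
        refine mul_le_mul hampl (hHE.trans ?_) (integral_nonneg fun x => sq_nonneg _)
          (sq_nonneg _)
        exact mul_le_mul_of_nonneg_right hqk (by positivity)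
    _ = M * Real.exp (Real.log |t| * Real.log q / n) * Q := by rw [hM]; ring
    _ ≤ (|t| ^ β)⁻¹ * Q := mul_le_mul_of_nonneg_right hfinal hQ0
    _ = _ := by rw [div_eq_inv_mul]

end Schottky

/-- uniform Dolgopyat estimate: there are `ε, T₀, C₁, β > 0` such that
for any Borel probability measure `μ` with support `Λ` satisfying `ℒ_δ^* μ = μ`, any
unitary representation `(ρ, V)` of `Γ`, any `s = σ + it` with `|σ − δ| ≤ ε`, `|t| ≥ T₀`,
and any `F ∈ C¹(I, V)`, with `N = ⌊C₁ log |t|⌋` one has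
`∫_Λ ‖ℒ_{s,ρ}^N F‖²_V dμ ≤ ‖F‖²_{(t),V} / |t|^β`. -/
theorem stmt_17 (S : Schottky) :
    ∃ ε T₀ C₁ β : ℝ, 0 < ε ∧ 0 < T₀ ∧ 0 < C₁ ∧ 0 < β ∧
      ∀ μ : MeasureTheory.Measure ℝ, MeasureTheory.IsProbabilityMeasure μ →
        ({x : ℝ | ∀ U ∈ nhds x, 0 < μ U} = S.limitSetR) →
        (∀ f : ℝ → ℝ, ContinuousOn f (closure S.Iall) →
          ∫ x, S.Lscalar S.delta f x ∂μ = ∫ x, f x ∂μ) →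
        ∀ (V : Type) [NormedAddCommGroup V] [InnerProductSpace ℂ V] [CompleteSpace V],
        ∀ (ρ : S.SGroup →* (V ≃ₗᵢ[ℂ] V)) (σ t : ℝ),
          |σ - S.delta| ≤ ε → T₀ ≤ |t| →
          ∀ F : ℝ → V, ContDiffOn ℝ 1 F (closure S.Iall) →
            ∫ x in S.limitSetR,
                ‖S.LIterate ((σ : ℂ) + t * Complex.I) ρ (⌊C₁ * Real.log |t|⌋₊) F x‖ ^ 2 ∂μ ≤
              ((⨆ x ∈ S.Iall, ‖F x‖) + |t|⁻¹ * ⨆ x ∈ S.Iall, ‖deriv F x‖) ^ 2 / |t| ^ β := by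
  have hδ : 0 ≤ S.delta := ENNReal.toReal_nonneg
  rcases hδ.eq_or_lt with h0 | hpos
  · refine ⟨1, 1, 1, 1, one_pos, one_pos, one_pos, one_pos, fun μ hμ hsupp hinv => ?_⟩
    have hconf : S.Conf S.delta μ := Schottky.conf_of_invariant hδ hsupp hinv
    rw [← h0] at hconf
    exact absurd hconf (Schottky.not_conf_zero μ)
  · obtain ⟨ε, T₀, β, hε, hT₀, hβ, h⟩ := S.exists_decay hpos
    refine ⟨ε, T₀, 1, β, hε, one_pos.trans_le hT₀, one_pos, hβ, ?_⟩
    intro μ hμ hsupp hinv V _ _ _ ρ σ t hσ ht F hF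
    have hs : (σ : ℂ) + t * Complex.I =
        (S.delta : ℂ) + (((σ - S.delta : ℝ) : ℂ) + t * Complex.I) := by
      push_cast; ring
    rw [one_mul, hs]
    exact h μ (Schottky.conf_of_invariant hδ hsupp hinv) V ρ (σ - S.delta) t hσ ht F hF
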